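/- arXiv:1804.03957 — 4 statements merged into one kernel-verified Lean document; each statement's English description precedes it below -/
import Mathlib

section
/- Let 2 ≤ p < ∞ be fixed. Then limsup_{d→∞} rad(D_p^d)/(√d · L_{D_p^d}) ≤ √3, where rad(D_p^d) = sup_{y ∈ D_p^d} ‖y‖₂ = α_{d,p}·d^{1/2−1/p}. Equivalently, limsup_{d→∞} d^{−1/p}/γ_{d,p} ≤ √3. -/
open MeasureTheory Filter
open scoped Pointwise

noncomputable section

/-- The unit ball of `ℓ_p^d`, as a subset of Euclidean space. -/
def lpBall (d : ℕ) (p : ℝ) : Set (EuclideanSpace ℝ (Fin d)) :=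
  {x | ∑ i, |x i| ^ p ≤ 1}

/-- `α_{d,p} = vol_d(B_p^d)^{-1/d}`, the normalizing factor. -/
def alphadp (d : ℕ) (p : ℝ) : ℝ :=
  (volume (lpBall d p)).toReal ^ (-(1 / (d : ℝ)))

/-- The volume-normalized `ℓ_p`-ball `D_p^d = α_{d,p} · B_p^d`. -/
def lpNormalizedBall (d : ℕ) (p : ℝ) : Set (EuclideanSpace ℝ (Fin d)) :=
  alphadp d p • lpBall d p

/-- The radius `rad(D_p^d) = sup_{y ∈ D_p^d} ‖y‖₂` (Euclidean norm). -/
def lpRad (d : ℕ) (p : ℝ) : ℝ :=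
  sSup ((fun y => ‖y‖) '' lpNormalizedBall d p)

/-- The isotropic constant `L_{D_p^d} = (∫_{D_p^d} x₁² dx)^{1/2}`.
(Junk value for `d = 0`.) -/
def isoConstDp (d : ℕ) (p : ℝ) : ℝ :=
  if hd : 0 < d then
    Real.sqrt (∫ x in lpNormalizedBall d p, (x ⟨0, hd⟩) ^ 2)
  else 0

def pB (d : ℕ) (p : ℝ) : Set (Fin d → ℝ) := {x | ∑ i, |x i| ^ p ≤ 1}

lemma pB_meas (d : ℕ) (p : ℝ) : MeasurableSet (pB d p) := by
  apply measurableSet_le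
  · fun_prop
  · fun_prop

lemma pB_vol (d : ℕ) (hd : 1 ≤ d) (p : ℝ) (hp : 2 ≤ p) :
    volume (pB d p) = ENNReal.ofReal ((2 * Real.Gamma (1 / p + 1)) ^ d / Real.Gamma (d / p + 1)) := by
  have : Nonempty (Fin d) := ⟨⟨0, hd⟩⟩
  have h := MeasureTheory.volume_sum_rpow_le (Fin d) (p := p) (by linarith) 1
  simp only [ENNReal.ofReal_one, one_pow, one_mul, Fintype.card_fin] at h
  rw [← h]
  congr 1
  ext x
  simp only [pB, Set.mem_ofPred_eq]
  have h0 : 0 ≤ ∑ i, |x i| ^ p := Finset.sum_nonneg fun i _ => by positivity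
  constructor
  · intro h; exact Real.rpow_le_one h0 h (by positivity)
  · intro h
    by_contra hc
    exact absurd h (not_le.mpr (Real.one_lt_rpow (not_le.mp hc) (by positivity)))

lemma pB_abs_le (d : ℕ) (p : ℝ) (hp : 2 ≤ p) (x : Fin d → ℝ) (hx : x ∈ pB d p) (i : Fin d) :
    |x i| ≤ 1 := by
  have h1 : |x i| ^ p ≤ 1 :=
    (Finset.single_le_sum (f := fun i => |x i| ^ p) (fun j _ => by positivity)
      (Finset.mem_univ i)).trans hx
  by_contra hc
  push Not at hc
  exact absurd h1 (not_le.mpr (Real.one_lt_rpow hc (by linarith)))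

/-- Bathtub estimate. -/
lemma bathtub (n : ℕ) (hn : 1 ≤ n) (p : ℝ) (hp : 2 ≤ p) (a : ℝ) (ha : 0 ≤ a) :
    a ^ 2 * (volume (pB (n+1) p)).toReal - 4 * a ^ 3 / 3 * (volume (pB n p)).toReal
      ≤ ∫ x in pB (n+1) p, (x 0) ^ 2 := by
  have hK : volume (pB (n+1) p) ≠ ⊤ := by rw [pB_vol _ (by omega) p hp]; simp
  have hB : volume (pB n p) ≠ ⊤ := by rw [pB_vol _ hn p hp]; simp
  set e := MeasurableEquiv.piFinSuccAbove (fun _ : Fin (n+1) => ℝ) 0 with he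
  have hmp : MeasurePreserving e := volume_preserving_piFinSuccAbove (fun _ => ℝ) 0
  set C : Set (Fin (n+1) → ℝ) := e ⁻¹' (Set.Icc (-a) a ×ˢ pB n p) with hC
  have hCm : MeasurableSet C := e.measurable (measurableSet_Icc.prod (pB_meas n p))
  have he1 : ∀ x, (e x).1 = x 0 := fun x => rfl
  have he2 : ∀ x j, (e x).2 j = x j.succ := fun x j => rfl
  have hCmem : ∀ x, x ∈ C ↔ (-a ≤ x 0 ∧ x 0 ≤ a) ∧ (fun j : Fin n => x j.succ) ∈ pB n p := by
    intro x
    have : (e x).2 = (fun j : Fin n => x j.succ) := funext (he2 x)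
    rw [hC, Set.mem_preimage, Set.mem_prod, this, he1, Set.mem_Icc]
  have hint : ∫ x in C, ((x 0) ^ 2 - a ^ 2) = -(4 * a ^ 3 / 3) * (volume (pB n p)).toReal := by
    have h1 : ∫ x in C, ((x 0) ^ 2 - a ^ 2)
        = ∫ z in Set.Icc (-a) a ×ˢ pB n p, ((z.1 ^ 2 - a ^ 2) * 1 : ℝ) := by
      rw [← hmp.setIntegral_preimage_emb e.measurableEmbedding]
      simp only [he1, mul_one, hC]
    rw [h1, Measure.volume_eq_prod, setIntegral_prod_mul (fun t : ℝ => t ^ 2 - a ^ 2) (fun _ => (1:ℝ)),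
      integral_Icc_eq_integral_Ioc, ← intervalIntegral.integral_of_le (by linarith)]
    have : ∫ t in (-a)..a, (t ^ 2 - a ^ 2) = -(4 * a ^ 3 / 3) := by
      rw [intervalIntegral.integral_sub (by simp) (by simp)]
      simp
      ring
    rw [this]
    simp [Measure.real]
  have hCvol : volume C ≠ ⊤ := by
    rw [hC, hmp.measure_preimage_equiv, Measure.volume_eq_prod, Measure.prod_prod]
    exact ENNReal.mul_ne_top (by simp) hB
  have hKi : IntegrableOn (fun x : Fin (n+1) → ℝ => (x 0) ^ 2) (pB (n+1) p) := by
    apply Measure.integrableOn_of_bounded (M := 1) hK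
    · exact Measurable.aestronglyMeasurable (by fun_prop)
    · filter_upwards [ae_restrict_mem (pB_meas _ _)] with x hx
      have := pB_abs_le _ p hp x hx 0
      rw [Real.norm_eq_abs, abs_pow]
      exact pow_le_one₀ (abs_nonneg _) this
  have hKi' : IntegrableOn (fun x : Fin (n+1) → ℝ => (x 0) ^ 2 - a ^ 2) (pB (n+1) p) :=
    hKi.sub (integrableOn_const hK)
  have hCi : IntegrableOn (fun x : Fin (n+1) → ℝ => (x 0) ^ 2 - a ^ 2) C := by
    have hm : Measurable (fun x : Fin (n+1) → ℝ => (x 0) ^ 2 - a ^ 2) := by fun_prop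
    refine Measure.integrableOn_of_bounded (M := a ^ 2) hCvol hm.aestronglyMeasurable ?_
    · filter_upwards [ae_restrict_mem hCm] with x hx
      obtain ⟨⟨h1, h2⟩, -⟩ := (hCmem x).1 hx
      rw [Real.norm_eq_abs, abs_le]
      constructor <;> nlinarith
  have hle : ∫ x in C, ((x 0) ^ 2 - a ^ 2) ≤ ∫ x in pB (n+1) p, ((x 0) ^ 2 - a ^ 2) := by
    rw [← integral_indicator hCm, ← integral_indicator (pB_meas _ _)]
    apply integral_mono ((integrable_indicator_iff hCm).2 hCi)
      ((integrable_indicator_iff (pB_meas _ _)).2 hKi')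
    intro x
    by_cases hxC : x ∈ C <;> by_cases hxK : x ∈ pB (n+1) p
    · simp [hxC, hxK]
    · simp only [Set.indicator_of_mem hxC, Set.indicator_of_notMem hxK]
      obtain ⟨⟨h1, h2⟩, -⟩ := (hCmem x).1 hxC
      nlinarith
    · simp only [Set.indicator_of_notMem hxC, Set.indicator_of_mem hxK]
      have hxB : (fun j : Fin n => x j.succ) ∈ pB n p := by
        have h : ∑ i, |x i| ^ p ≤ 1 := hxK
        rw [Fin.sum_univ_succ] at h
        have : 0 ≤ |x 0| ^ p := by positivity
        show ∑ j : Fin n, |x j.succ| ^ p ≤ 1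
        linarith
      have hx : ¬ (-a ≤ x 0 ∧ x 0 ≤ a) := fun h => hxC ((hCmem x).2 ⟨h, hxB⟩)
      rw [← abs_le, not_le] at hx
      have := sq_lt_sq.2 (show |a| < |x 0| by rwa [abs_of_nonneg ha])
      linarith
    · simp [hxC, hxK]
  rw [hint, integral_sub hKi (integrableOn_const hK), setIntegral_const] at hle
  simp only [Measure.real, smul_eq_mul] at hle
  linarith

lemma gamma_s (s : ℝ) (hs : 0 < s) (hs1 : s < 1) : s ^ s ≤ Real.Gamma (s + 1) := by
  have h := Real.Gamma_mul_add_mul_le_rpow_Gamma_mul_rpow_Gamma (s := s) (t := s + 1) (a := s)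
    (b := 1 - s) hs (by linarith) hs (by linarith) (by ring)
  rw [show s * s + (1 - s) * (s + 1) = 1 by ring, Real.Gamma_one, Real.Gamma_add_one hs.ne',
    Real.mul_rpow hs.le (Real.Gamma_pos_of_pos hs).le] at h
  have hg := Real.Gamma_pos_of_pos hs
  have h2 : Real.Gamma s ^ s * (s ^ (1 - s) * Real.Gamma s ^ (1 - s)) = s ^ (1 - s) * Real.Gamma s := by
    rw [mul_left_comm, ← Real.rpow_add hg]; simp
  rw [h2] at h
  rw [Real.Gamma_add_one hs.ne']
  have h3 : s ^ s * s ^ (1 - s) = s := by rw [← Real.rpow_add hs]; simp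
  have h4 : 0 < s ^ s := by positivity
  calc s ^ s = s ^ s * 1 := by ring
    _ ≤ s ^ s * (s ^ (1 - s) * Real.Gamma s) := by gcongr
    _ = s * Real.Gamma s := by rw [← mul_assoc, h3]

lemma gamma_x (s x : ℝ) (hs : 0 < s) (hs1 : s < 1) (hx : 0 < x) :
    Real.Gamma (x + s) ≤ Real.Gamma x * x ^ s := by
  have h := Real.Gamma_mul_add_mul_le_rpow_Gamma_mul_rpow_Gamma (s := x) (t := x + 1) (a := 1 - s)
    (b := s) hx (by linarith) (by linarith) hs (by ring)
  have hg := Real.Gamma_pos_of_pos hx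
  rw [show (1 - s) * x + s * (x + 1) = x + s by ring, Real.Gamma_add_one hx.ne',
    Real.mul_rpow hx.le hg.le, mul_left_comm, ← Real.rpow_add hg] at h
  simp only [sub_add_cancel, Real.rpow_one] at h
  linarith

lemma ratio_bound (n : ℕ) (hn : 1 ≤ n) (p : ℝ) (hp : 2 ≤ p) :
    (1 / (n + p)) ^ (1 / p) * (2 * (volume (pB n p)).toReal) ≤ (volume (pB (n+1) p)).toReal := by
  have hp0 : 0 < p := by linarith
  set s := 1 / p with hs
  have hs0 : 0 < s := by positivity
  have hs1 : s < 1 := by rw [hs, div_lt_one hp0]; linarith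
  have hg1 : 0 < Real.Gamma (s + 1) := Real.Gamma_pos_of_pos (by linarith)
  have hx0 : 0 < (n : ℝ) / p + 1 := by positivity
  have hg2 : 0 < Real.Gamma ((n : ℝ) / p + 1) := Real.Gamma_pos_of_pos hx0
  have hg3 : 0 < Real.Gamma (((n + 1 : ℕ) : ℝ) / p + 1) := Real.Gamma_pos_of_pos (by positivity)
  rw [pB_vol n hn p hp, pB_vol (n+1) (by omega) p hp, ← hs, ENNReal.toReal_ofReal (by positivity),
    ENNReal.toReal_ofReal (by positivity)]
  have h1 := gamma_s s hs0 hs1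
  have h2 := gamma_x s (n / p + 1) hs0 hs1 hx0
  rw [show (n : ℝ) / p + 1 + s = ((n + 1 : ℕ) : ℝ) / p + 1 by push_cast; rw [hs]; ring] at h2
  have h3 : (1 / (n + p)) ^ s = s ^ s / ((n : ℝ) / p + 1) ^ s := by
    rw [← Real.div_rpow hs0.le hx0.le]
    congr 1
    rw [hs]; field_simp
  rw [h3, pow_succ]
  have h4 : 0 < ((n : ℝ) / p + 1) ^ s := by positivity
  rw [div_mul_eq_mul_div, mul_div_assoc', mul_div_assoc', div_div, div_le_div_iff₀ (by positivity) hg3]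
  have h5 : s ^ s * Real.Gamma (((n + 1 : ℕ) : ℝ) / p + 1) ≤
      Real.Gamma (s + 1) * (Real.Gamma (n / p + 1) * (n / p + 1) ^ s) := by gcongr
  have h6 : 0 < 2 * (2 * Real.Gamma (s + 1)) ^ n := by positivity
  nlinarith [mul_le_mul_of_nonneg_left h5 h6.le]

lemma second_moment (n : ℕ) (hn : 1 ≤ n) (p : ℝ) (hp : 2 ≤ p) :
    ((1 / (n + p)) ^ (1 / p)) ^ 2 / 3 * (volume (pB (n+1) p)).toReal
      ≤ ∫ x in pB (n+1) p, (x 0) ^ 2 := by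
  have ha : 0 ≤ (1 / (n + p)) ^ (1 / p) := by positivity
  have h1 := bathtub n hn p hp _ ha
  have h2 := ratio_bound n hn p hp
  set a := (1 / (n + p)) ^ (1 / p)
  nlinarith [mul_le_mul_of_nonneg_left h2 (sq_nonneg a)]

lemma pB_vol_pos (d : ℕ) (hd : 1 ≤ d) (p : ℝ) (hp : 2 ≤ p) : 0 < (volume (pB d p)).toReal := by
  have hp0 : 0 < p := by linarith
  have hg1 : 0 < Real.Gamma (1 / p + 1) := Real.Gamma_pos_of_pos (by positivity)
  have hg2 : 0 < Real.Gamma ((d : ℝ) / p + 1) := Real.Gamma_pos_of_pos (by positivity)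
  rw [pB_vol d hd p hp, ENNReal.toReal_ofReal (by positivity)]
  positivity

lemma toLp_pre (d : ℕ) (p : ℝ) :
    (MeasurableEquiv.toLp 2 (Fin d → ℝ)) ⁻¹' (lpBall d p) = pB d p := rfl

lemma vol_lpBall (d : ℕ) (p : ℝ) : volume (lpBall d p) = volume (pB d p) := by
  rw [← toLp_pre]
  exact ((PiLp.volume_preserving_toLp (Fin d)).measure_preimage_equiv
    (f := MeasurableEquiv.toLp 2 (Fin d → ℝ)) _).symm

lemma int_lpBall (n : ℕ) (p : ℝ) :
    ∫ x in lpBall (n+1) p, (x 0) ^ 2 = ∫ x in pB (n+1) p, (x 0) ^ 2 := by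
  rw [← toLp_pre]
  exact ((PiLp.volume_preserving_toLp (Fin (n+1))).setIntegral_preimage_emb
    (MeasurableEquiv.toLp 2 (Fin (n+1) → ℝ)).measurableEmbedding (fun x => (x 0) ^ 2) _).symm

lemma alpha_pos (d : ℕ) (hd : 1 ≤ d) (p : ℝ) (hp : 2 ≤ p) : 0 < alphadp d p := by
  rw [alphadp, vol_lpBall]
  exact Real.rpow_pos_of_pos (pB_vol_pos d hd p hp) _

lemma alpha_pow (d : ℕ) (hd : 1 ≤ d) (p : ℝ) (hp : 2 ≤ p) :
    alphadp d p ^ d = ((volume (pB d p)).toReal)⁻¹ := by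
  have h := pB_vol_pos d hd p hp
  rw [alphadp, vol_lpBall, ← Real.rpow_natCast, ← Real.rpow_mul h.le]
  have : (d : ℝ) ≠ 0 := by positivity
  rw [show -(1 / (d : ℝ)) * d = -1 by field_simp, Real.rpow_neg_one]

lemma iso_bound (n : ℕ) (hn : 1 ≤ n) (p : ℝ) (hp : 2 ≤ p) :
    alphadp (n+1) p * (1 / (n + p)) ^ (1 / p) / Real.sqrt 3 ≤ isoConstDp (n+1) p := by
  have ha := alpha_pos (n+1) (by omega) p hp
  have hv := pB_vol_pos (n+1) (by omega) p hp
  have hpw := alpha_pow (n+1) (by omega) p hp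
  rw [isoConstDp, dif_pos (Nat.succ_pos n)]
  apply Real.le_sqrt_of_sq_le
  have h := Measure.setIntegral_comp_smul_of_pos volume
    (fun x : EuclideanSpace ℝ (Fin (n+1)) => (x 0) ^ 2) (lpBall (n+1) p) ha
  rw [finrank_euclideanSpace_fin, hpw, inv_inv] at h
  simp only [PiLp.smul_apply, smul_eq_mul, mul_pow] at h
  rw [integral_const_mul, int_lpBall] at h
  have h2 := second_moment n hn p hp
  have h3 : ∫ x in lpNormalizedBall (n+1) p, (x ⟨0, Nat.succ_pos n⟩) ^ 2
      = ∫ x in alphadp (n+1) p • lpBall (n+1) p, (x 0) ^ 2 := rfl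
  rw [h3]
  rw [div_pow, Real.sq_sqrt (by norm_num), mul_pow]
  set I := ∫ x in alphadp (n+1) p • lpBall (n+1) p, (x 0) ^ 2
  have h4 := mul_le_mul_of_nonneg_left h2 (sq_nonneg (alphadp (n+1) p))
  rw [h] at h4
  refine le_of_mul_le_mul_left ?_ hv
  linarith

lemma rad_bound (d : ℕ) (hd : 1 ≤ d) (p : ℝ) (hp : 2 ≤ p) :
    lpRad d p ≤ alphadp d p * (Real.sqrt d * (1 / (d : ℝ)) ^ (1 / p)) := by
  have ha := alpha_pos d hd p hp
  have hd0 : (0 : ℝ) < d := by positivity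
  apply Real.sSup_le
  · rintro _ ⟨y, ⟨x, hx, rfl⟩, rfl⟩
    simp only [norm_smul, Real.norm_eq_abs, abs_of_pos ha]
    gcongr
    have hx' : ∑ i, |x i| ^ p ≤ 1 := hx
    have hp0 : 0 < p := by linarith
    have h1 := Real.rpow_sum_le_const_mul_sum_rpow_of_nonneg (Finset.univ : Finset (Fin d))
      (f := fun i => |x i| ^ 2) (p := p / 2) (by linarith) (fun i _ => by positivity)
    have h2 : ∀ i, (|x i| ^ 2) ^ (p / 2) = |x i| ^ p := fun i => by
      rw [← Real.rpow_natCast, ← Real.rpow_mul (abs_nonneg _)]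
      congr 1; push_cast; ring
    simp only [h2, Finset.card_univ, Fintype.card_fin] at h1
    have hS : 0 ≤ ∑ i, |x i| ^ 2 := Finset.sum_nonneg fun i _ => by positivity
    have h3 : (∑ i, |x i| ^ 2) ^ (p / 2) ≤ (d : ℝ) ^ (p / 2 - 1) :=
      h1.trans (mul_le_of_le_one_right (by positivity) hx')
    have h4 := Real.rpow_le_rpow (by positivity) h3 (show 0 ≤ 2 / p by positivity)
    rw [← Real.rpow_mul hS, ← Real.rpow_mul hd0.le, show p / 2 * (2 / p) = 1 by field_simp,
      Real.rpow_one, show (p / 2 - 1) * (2 / p) = 1 + (-(1 / p)) * (2 : ℕ) by push_cast; field_simp; ring,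
      Real.rpow_add hd0, Real.rpow_one, Real.rpow_mul hd0.le, Real.rpow_natCast] at h4
    apply abs_le_of_sq_le_sq' _ (by positivity) |>.2
    rw [EuclideanSpace.norm_sq_eq, mul_pow, Real.sq_sqrt hd0.le, one_div (d : ℝ),
      Real.inv_rpow hd0.le, ← Real.rpow_neg hd0.le]
    simpa using h4
  · positivity

theorem stmt3 (p : ℝ) (hp : 2 ≤ p) :
    Filter.limsup (fun d : ℕ => lpRad d p / (Real.sqrt d * isoConstDp d p)) Filter.atTop
      ≤ Real.sqrt 3 := by
  have hp0 : 0 < p := by linarith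
  have hnn : ∀ d : ℕ, 0 ≤ lpRad d p / (Real.sqrt d * isoConstDp d p) := by
    intro d
    have h1 : 0 ≤ lpRad d p := Real.sSup_nonneg (by rintro _ ⟨y, -, rfl⟩; exact norm_nonneg y)
    have h2 : 0 ≤ isoConstDp d p := by
      unfold isoConstDp; split_ifs
      · exact Real.sqrt_nonneg _
      · exact le_rfl
    positivity
  have hub : ∀ d : ℕ, 2 ≤ d → lpRad d p / (Real.sqrt d * isoConstDp d p)
      ≤ Real.sqrt 3 * (1 + (p - 1) / d) ^ (1 / p) := by
    intro d hd
    obtain ⟨n, rfl⟩ : ∃ n, d = n + 1 := ⟨d - 1, by omega⟩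
    have hn : 1 ≤ n := by omega
    have ha := alpha_pos (n+1) (by omega) p hp
    have hi := iso_bound n hn p hp
    have hr := rad_bound (n+1) (by omega) p hp
    have h3 : 0 < Real.sqrt 3 := by positivity
    have hd0 : 0 < Real.sqrt ((n + 1 : ℕ) : ℝ) := by positivity
    have hq : 0 < (1 / (n + p)) ^ (1 / p) := by positivity
    have hi0 : 0 < isoConstDp (n+1) p := lt_of_lt_of_le (by positivity) hi
    have hid : (1 / ((n + 1 : ℕ) : ℝ)) ^ (1 / p)
        = (1 + (p - 1) / ((n + 1 : ℕ) : ℝ)) ^ (1 / p) * (1 / (n + p)) ^ (1 / p) := by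
      have hb : 1 + (p - 1) / ((n + 1 : ℕ) : ℝ) = (n + p) / ((n + 1 : ℕ) : ℝ) := by
        push_cast; field_simp; ring
      rw [hb, ← Real.mul_rpow (by positivity) (by positivity)]
      congr 1
      field_simp
    rw [div_le_iff₀ (by positivity)]
    have hQ : 0 ≤ (1 + (p - 1) / ((n + 1 : ℕ) : ℝ)) ^ (1 / p) := by
      apply Real.rpow_nonneg
      have : 0 ≤ p - 1 := by linarith
      positivity
    rw [hid] at hr
    set Q := (1 + (p - 1) / ((n + 1 : ℕ) : ℝ)) ^ (1 / p)
    set q := (1 / (n + p)) ^ (1 / p)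
    set D := Real.sqrt ((n + 1 : ℕ) : ℝ)
    rw [div_le_iff₀ h3] at hi
    have := mul_le_mul_of_nonneg_left hi (mul_nonneg hd0.le hQ)
    nlinarith
  have ht : Tendsto (fun d : ℕ => Real.sqrt 3 * (1 + (p - 1) / (d : ℝ)) ^ (1 / p)) atTop
      (nhds (Real.sqrt 3)) := by
    have h1 : Tendsto (fun d : ℕ => 1 + (p - 1) / (d : ℝ)) atTop (nhds 1) := by
      simpa using (tendsto_const_div_atTop_nhds_zero_nat (p - 1)).const_add 1
    have h2 := (h1.rpow_const (p := 1 / p) (Or.inl one_ne_zero)).const_mul (Real.sqrt 3)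
    simpa using h2
  calc _ ≤ limsup (fun d : ℕ => Real.sqrt 3 * (1 + (p - 1) / (d : ℝ)) ^ (1 / p)) atTop := by
        apply limsup_le_limsup
        · filter_upwards [eventually_ge_atTop 2] with d hd using hub d hd
        · exact (isBoundedUnder_of ⟨0, hnn⟩ : IsBoundedUnder (· ≥ ·) atTop _).isCoboundedUnder_le
        · exact ht.isBoundedUnder_le
    _ = _ := ht.limsup_eq

end
end

section
/- Let α ∈ [1,2] and b > 0, and let (K_d)_{d∈ℕ} be a sequence where K_d ⊆ ℝ^d is an isotropic convex body satisfying a ψ_α-estimate with constant b. Let (r_d)_{d∈ℕ} be nonnegative reals with limsup_{d→∞} r_d/L_{K_d} < 1. Then there exist constants c, C ∈ (0,∞) such that for all d ∈ ℕ: vol_d(K_d ∩ r_d·√d·B₂^d) ≤ C·exp(−c·d^{α/2}), where B₂^d is the closed Euclidean unit ball. -/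
open MeasureTheory Filter
open scoped RealInnerProductSpace ENNReal

noncomputable section

theorem bm_compact (A B S : Set ℝ) (hA : IsCompact A) (hB : IsCompact B)
    (hAn : A.Nonempty) (hBn : B.Nonempty)
    (h : ∀ a ∈ A, ∀ b ∈ B, a + b ∈ S) : volume A + volume B ≤ volume S := by
  obtain ⟨a, ha⟩ := hA.exists_isGreatest hAn
  obtain ⟨b, hb⟩ := hB.exists_isLeast hBn
  have h1 : volume ((fun x => x + (-b)) ⁻¹' A) = volume A := measure_preimage_add_right _ _ _
  have h2 : volume ((fun x => x + (-a)) ⁻¹' B) = volume B := measure_preimage_add_right _ _ _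
  have hm2 : MeasurableSet ((fun x : ℝ => x + (-a)) ⁻¹' B) :=
    hB.measurableSet.preimage (by fun_prop)
  rw [← h1, ← h2, ← measure_union₀ hm2.nullMeasurableSet]
  · apply measure_mono
    rintro x (hx | hx)
    · have := h _ hx b hb.1
      simpa using this
    · have := h a ha.1 _ hx
      simpa using this
  · refine measure_mono_null (t := {a + b}) ?_ (by simp)
    rintro x ⟨hx, hy⟩
    have := ha.2 hx
    have := hb.2 hy
    simp only [Set.mem_singleton_iff]
    linarith

theorem bm_one (A B S : Set ℝ) (hA : MeasurableSet A) (hB : MeasurableSet B)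
    (hAn : A.Nonempty) (hBn : B.Nonempty)
    (h : ∀ a ∈ A, ∀ b ∈ B, a + b ∈ S) : volume A + volume B ≤ volume S := by
  rw [hA.measure_eq_iSup_isCompact, hB.measure_eq_iSup_isCompact]
  obtain ⟨a, ha⟩ := hAn
  obtain ⟨b, hb⟩ := hBn
  simp only [iSup_and']
  refine ENNReal.biSup_add_biSup_le' ⟨∅, by simp⟩ ⟨∅, by simp⟩ ?_
  rintro A' ⟨hA', hA''⟩ B' ⟨hB', hB''⟩
  refine le_trans (add_le_add (measure_mono (Set.subset_insert a A'))
    (measure_mono (Set.subset_insert b B'))) ?_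
  refine bm_compact _ _ S (hA''.insert a) (hB''.insert b) ⟨a, by simp⟩ ⟨b, by simp⟩ ?_
  intro x hx y hy
  exact h x ((Set.insert_subset ha hA') hx) y ((Set.insert_subset hb hB') hy)

theorem ennreal_amgm (x y : ℝ≥0∞) : 4 * x * y ≤ (x + y) ^ 2 := by
  rcases le_total x y with h | h
  · obtain ⟨d, rfl⟩ := exists_add_of_le h
    calc 4 * x * (x + d) ≤ 4 * x * (x + d) + d ^ 2 := le_self_add
      _ = _ := by ring
  · obtain ⟨d, rfl⟩ := exists_add_of_le h
    calc 4 * (y + d) * y ≤ 4 * (y + d) * y + d ^ 2 := le_self_add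
      _ = _ := by ring

theorem pl_norm (f g h : ℝ → ℝ≥0∞) (hf : Measurable f) (hg : Measurable g) (hh : Measurable h)
    (f1 : ⨆ x, f x = 1) (g1 : ⨆ x, g x = 1)
    (H : ∀ x y, f x * g y ≤ h ((1 / 2 : ℝ) • (x + y)) ^ 2) :
    (∫⁻ x, f x) + ∫⁻ x, g x ≤ 2 * ∫⁻ x, h x := by
  have fle : ∀ x, f x ≤ 1 := fun x => f1 ▸ le_iSup f x
  have gle : ∀ x, g x ≤ 1 := fun x => g1 ▸ le_iSup g x
  set h' : ℝ → ℝ≥0∞ := fun x => min (h x) 1 with hh'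
  have h'm : Measurable h' := hh.min measurable_const
  have hle : ∫⁻ x, h' x ≤ ∫⁻ x, h x := lintegral_mono fun x => min_le_left _ _
  have H' : ∀ x y, f x * g y ≤ h' ((1 / 2 : ℝ) • (x + y)) ^ 2 := by
    intro x y
    simp only [hh']
    rcases le_total (h ((1 / 2 : ℝ) • (x + y))) 1 with h0 | h0
    · rw [min_eq_left h0]; exact H x y
    · rw [min_eq_right h0, one_pow]
      exact mul_le_one' (fle x) (gle y)
  have lay : ∀ u : ℝ → ℝ≥0∞, Measurable u → (∀ x, u x ≤ 1) →
      ∫⁻ x, u x = ∫⁻ t in Set.Ioo (0:ℝ) 1, volume {x | ENNReal.ofReal t < u x} := by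
    intro u hu u1
    have e1 : ∫⁻ x, u x = ∫⁻ x, ENNReal.ofReal ((u x).toReal) := by
      refine lintegral_congr fun x => ?_
      rw [ENNReal.ofReal_toReal (ne_top_of_le_ne_top ENNReal.one_ne_top (u1 x))]
    rw [e1, lintegral_eq_lintegral_meas_lt _ (by filter_upwards with x using ENNReal.toReal_nonneg)
      (hu.ennreal_toReal.aemeasurable)]
    rw [← Set.Ioo_union_Ici_eq_Ioi (zero_lt_one' ℝ), lintegral_union measurableSet_Ici]
    · have z : ∫⁻ t in Set.Ici (1:ℝ), volume {x | t < (u x).toReal} = 0 := by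
        rw [setLIntegral_congr_fun (g := fun _ => 0) measurableSet_Ici]
        · simp
        · intro t ht
          have : {x | t < (u x).toReal} = ∅ := by
            ext x
            simp only [Set.mem_ofPred_eq, Set.mem_empty_iff_false, iff_false, not_lt]
            refine le_trans ?_ ht
            exact ENNReal.toReal_le_of_le_ofReal zero_le_one (by simpa using u1 x)
          simp [this]
      rw [z, add_zero]
      refine setLIntegral_congr_fun measurableSet_Ioo ?_
      intro t ht
      have : {x | t < (u x).toReal} = {x | ENNReal.ofReal t < u x} := by
        ext x
        simp only [Set.mem_ofPred_eq]
        rw [ENNReal.ofReal_lt_iff_lt_toReal ht.1.le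
          (ne_top_of_le_ne_top ENNReal.one_ne_top (u1 x))]
      simp only [this]
    · rw [Set.disjoint_left]
      intro x hx hx'
      exact absurd hx.2 (not_lt.2 hx')
  refine le_trans ?_ (mul_le_mul_right hle 2)
  rw [lay f hf fle, lay g hg gle, lay h' h'm (fun x => min_le_right _ _)]
  rw [← lintegral_const_mul' _ _ (by simp), ← lintegral_add_left']
  · refine setLIntegral_mono' measurableSet_Ioo ?_
    intro t ht
    have e2 : volume ((fun x : ℝ => x * (1/2)) ⁻¹' {x | ENNReal.ofReal t < h' x})
        = 2 * volume {x | ENNReal.ofReal t < h' x} := by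
      rw [Real.volume_preimage_mul_right (by norm_num)]
      norm_num
    rw [← e2]
    apply bm_one
    · exact measurableSet_lt measurable_const hf
    · exact measurableSet_lt measurable_const hg
    · have : ENNReal.ofReal t < ⨆ x, f x := by rw [f1]; simpa using ht.2
      exact lt_iSup_iff.1 this
    · have : ENNReal.ofReal t < ⨆ x, g x := by rw [g1]; simpa using ht.2
      exact lt_iSup_iff.1 this
    · intro a ha b hb
      simp only [Set.mem_preimage, Set.mem_ofPred_eq] at *
      have h3 := H' a b
      rw [show (1 / 2 : ℝ) • (a + b) = (a+b) * (1/2) by simp; ring] at h3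
      by_contra hc
      push Not at hc
      have h4 : ENNReal.ofReal t * ENNReal.ofReal t < f a * g b := ENNReal.mul_lt_mul ha hb
      have h5 := pow_le_pow_left' hc 2
      rw [← sq] at h4
      exact absurd (h4.trans_le h3) (not_lt.2 h5)
  · refine Measurable.aemeasurable ?_
    have : Antitone fun t : ℝ => volume {x | ENNReal.ofReal t < f x} := by
      intro s t hst
      exact measure_mono fun x hx => lt_of_le_of_lt (ENNReal.ofReal_le_ofReal hst) hx
    exact this.measurable

theorem pl_bdd (f g h : ℝ → ℝ≥0∞) (hf : Measurable f) (hg : Measurable g) (hh : Measurable h)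
    (f1 : ⨆ x, f x ≠ ∞) (g1 : ⨆ x, g x ≠ ∞)
    (H : ∀ x y, f x * g y ≤ h ((1 / 2 : ℝ) • (x + y)) ^ 2) :
    (∫⁻ x, f x) * ∫⁻ x, g x ≤ (∫⁻ x, h x) ^ 2 := by
  by_cases f0 : ⨆ x, f x = 0
  · have : ∀ x, f x = 0 := fun x => le_antisymm (f0 ▸ le_iSup f x) zero_le
    simp [this]
  by_cases g0 : ⨆ x, g x = 0
  · have : ∀ x, g x = 0 := fun x => le_antisymm (g0 ▸ le_iSup g x) zero_le
    simp [this]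
  set a := ⨆ x, f x
  set b := ⨆ x, g x
  set c := (a⁻¹ * b⁻¹) ^ (1/2 : ℝ) with hc
  have hc2 : c ^ 2 = a⁻¹ * b⁻¹ := by
    rw [hc, ← ENNReal.rpow_natCast, ← ENNReal.rpow_mul]; norm_num
  have key := pl_norm (fun x => a⁻¹ * f x) (fun x => b⁻¹ * g x) (fun x => c * h x)
    (hf.const_mul _) (hg.const_mul _) (hh.const_mul _)
    (by rw [← ENNReal.mul_iSup]; exact ENNReal.inv_mul_cancel f0 f1)
    (by rw [← ENNReal.mul_iSup]; exact ENNReal.inv_mul_cancel g0 g1)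
    (by
      intro x y
      rw [mul_pow, hc2, mul_mul_mul_comm]
      gcongr
      exact H x y)
  rw [lintegral_const_mul _ hf, lintegral_const_mul _ hg, lintegral_const_mul _ hh] at key
  set F := ∫⁻ x, f x
  set G := ∫⁻ x, g x
  set I := ∫⁻ x, h x
  have k2 := pow_le_pow_left' key 2
  have k3 : 4 * (a⁻¹ * F) * (b⁻¹ * G) ≤ (a⁻¹ * F + b⁻¹ * G) ^ 2 := ennreal_amgm _ _
  have k4 := k3.trans k2
  have k5 : 4 * (a⁻¹ * b⁻¹) * (F * G) ≤ 4 * (a⁻¹ * b⁻¹) * I ^ 2 := by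
    calc _ = 4 * (a⁻¹ * F) * (b⁻¹ * G) := by ring
      _ ≤ _ := k4
      _ = 4 * c^2 * I^2 := by ring
      _ = _ := by rw [hc2]
  have n0 : (4 * (a⁻¹ * b⁻¹) : ℝ≥0∞) ≠ 0 := by
    simp [ENNReal.inv_eq_zero, f1, g1]
  have nt : (4 * (a⁻¹ * b⁻¹) : ℝ≥0∞) ≠ ∞ := by
    refine ENNReal.mul_ne_top (by simp) (ENNReal.mul_ne_top ?_ ?_)
    · simpa using f0
    · simpa using g0
  exact (ENNReal.mul_le_mul_iff_right n0 nt).1 k5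

theorem pl_one (f g h : ℝ → ℝ≥0∞) (hf : Measurable f) (hg : Measurable g) (hh : Measurable h)
    (H : ∀ x y, f x * g y ≤ h ((1 / 2 : ℝ) • (x + y)) ^ 2) :
    (∫⁻ x, f x) * ∫⁻ x, g x ≤ (∫⁻ x, h x) ^ 2 := by
  have tr : ∀ u : ℝ → ℝ≥0∞, Measurable u → ∫⁻ x, u x = ⨆ n : ℕ, ∫⁻ x, min (u x) n := by
    intro u hu
    rw [← lintegral_iSup]
    · refine lintegral_congr fun x => ?_
      rw [← inf_iSup_eq]
      rw [ENNReal.iSup_natCast, inf_top_eq]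
    · intro n; exact hu.min measurable_const
    · intro m n hmn x
      exact min_le_min le_rfl (by exact_mod_cast hmn)
  rw [tr f hf, tr g hg, ENNReal.iSup_mul]
  refine iSup_le fun n => ?_
  rw [ENNReal.mul_iSup]
  refine iSup_le fun m => ?_
  refine pl_bdd _ _ h (hf.min measurable_const) (hg.min measurable_const) hh ?_ ?_ ?_
  · exact ne_top_of_le_ne_top (ENNReal.natCast_ne_top n) (iSup_le fun x => min_le_right _ _)
  · exact ne_top_of_le_ne_top (ENNReal.natCast_ne_top m) (iSup_le fun x => min_le_right _ _)
  · intro x y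
    exact le_trans (mul_le_mul' (min_le_left _ _) (min_le_left _ _)) (H x y)

/-- abstract weighted Prekopa-Leindler property -/
def GPL {E : Type} [AddCommGroup E] [Module ℝ E] [MeasurableSpace E] (μ : Measure E)
    (V : E → E → ℝ≥0∞) : Prop :=
  ∀ f g h : E → ℝ≥0∞, Measurable f → Measurable g → Measurable h →
    (∀ x y, f x * g y ≤ (h ((1 / 2 : ℝ) • (x + y)) * V x y) ^ 2) →
    (∫⁻ x, f x ∂μ) * ∫⁻ x, g x ∂μ ≤ (∫⁻ x, h x ∂μ) ^ 2

theorem GPL.prod {E F : Type} [AddCommGroup E] [Module ℝ E] [MeasurableSpace E]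
    [AddCommGroup F] [Module ℝ F] [MeasurableSpace F] {μ : Measure E} {ν : Measure F}
    [SFinite μ] [SFinite ν]
    {V : E → E → ℝ≥0∞} {W : F → F → ℝ≥0∞} (hμ : GPL μ V) (hν : GPL ν W) :
    GPL (μ.prod ν) (fun x y => V x.1 y.1 * W x.2 y.2) := by
  intro f g h hf hg hh H
  rw [lintegral_prod _ hf.aemeasurable, lintegral_prod _ hg.aemeasurable,
    lintegral_prod _ hh.aemeasurable]
  refine hμ _ _ _ hf.lintegral_prod_right' hg.lintegral_prod_right' hh.lintegral_prod_right' ?_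
  intro x y
  rw [← lintegral_mul_const (V x y) (f := fun z => h ((1 / 2 : ℝ) • (x + y), z)) (by fun_prop)]
  refine hν (fun z => f (x, z)) (fun z => g (y, z))
    (fun z => h ((1 / 2 : ℝ) • (x + y), z) * V x y) (by fun_prop) (by fun_prop) (by fun_prop) ?_
  intro x' y'
  refine (H (x, x') (y, y')).trans (le_of_eq ?_)
  simp only [Prod.mk_add_mk, Prod.smul_mk]
  ring

theorem GPL.pi {E : Type} [AddCommGroup E] [Module ℝ E] [MeasurableSpace E]
    {μ : Measure E} [SigmaFinite μ] {V : E → E → ℝ≥0∞} (hμ : GPL μ V) (k : ℕ) :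
    GPL (Measure.pi (fun _ : Fin k => μ)) (fun x y => ∏ i, V (x i) (y i)) := by
  induction k with
  | zero =>
    intro f g h hf hg hh H
    have := H 0 0
    simp only [Measure.pi_of_empty _ (0 : Fin 0 → E), lintegral_dirac' _ hf, lintegral_dirac' _ hg,
      lintegral_dirac' _ hh]
    simpa using this
  | succ k ih =>
    intro f g h hf hg hh H
    have mp := (measurePreserving_piFinSuccAbove (fun _ : Fin (k+1) => μ) 0).symm
    rw [← mp.lintegral_comp hf, ← mp.lintegral_comp hg, ← mp.lintegral_comp hh]
    refine GPL.prod hμ ih _ _ _ (hf.comp mp.measurable) (hg.comp mp.measurable)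
      (hh.comp mp.measurable) ?_
    intro x y
    refine (H _ _).trans (le_of_eq ?_)
    congr 2
    · congr 1
      ext i
      refine Fin.cases ?_ (fun j => ?_) i <;> simp [MeasurableEquiv.piFinSuccAbove]
    · beta_reduce
      rw [Fin.prod_univ_succ]
      simp [MeasurableEquiv.piFinSuccAbove]

theorem gpl_volume_real : GPL (volume : Measure ℝ) (fun _ _ => 1) := by
  intro f g h hf hg hh H
  exact pl_one f g h hf hg hh (by simpa using H)

theorem gpl_volume (n : ℕ) (f g h : EuclideanSpace ℝ (Fin n) → ℝ≥0∞)
    (hf : Measurable f) (hg : Measurable g) (hh : Measurable h)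
    (H : ∀ x y, f x * g y ≤ (h ((1 / 2 : ℝ) • (x + y))) ^ 2) :
    (∫⁻ x, f x) * ∫⁻ x, g x ≤ (∫⁻ x, h x) ^ 2 := by
  have mp := PiLp.volume_preserving_toLp (Fin n)
  rw [← mp.lintegral_comp hf, ← mp.lintegral_comp hg, ← mp.lintegral_comp hh]
  refine (gpl_volume_real.pi n) _ _ _ (hf.comp mp.measurable) (hg.comp mp.measurable)
      (hh.comp mp.measurable) ?_
  intro x y
  refine (H _ _).trans (le_of_eq ?_)
  simp

open ProbabilityTheory in
theorem gpl_gauss : GPL (gaussianReal 0 1)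
    (fun x y => ENNReal.ofReal (Real.exp ((x - y) ^ 2 / 8))) := by
  intro f g h hf hg hh H
  rw [gaussianReal_of_var_ne_zero _ one_ne_zero]
  have mg : Measurable (gaussianPDF 0 1) := measurable_gaussianPDF 0 1
  rw [lintegral_withDensity_eq_lintegral_mul _ mg hf, lintegral_withDensity_eq_lintegral_mul _ mg hg,
    lintegral_withDensity_eq_lintegral_mul _ mg hh]
  refine pl_one _ _ _ (mg.mul hf) (mg.mul hg) (mg.mul hh) ?_
  intro x y
  simp only [Pi.mul_apply]
  have e : gaussianPDF 0 1 x * gaussianPDF 0 1 y * ENNReal.ofReal (Real.exp ((x - y) ^ 2 / 8)) ^ 2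
      = gaussianPDF 0 1 ((1/2 : ℝ) • (x + y)) ^ 2 := by
    simp only [gaussianPDF, gaussianPDFReal]
    rw [← ENNReal.ofReal_pow (by positivity), ← ENNReal.ofReal_pow (by positivity),
      ← ENNReal.ofReal_mul (by positivity), ← ENNReal.ofReal_mul (by positivity)]
    congr 1
    rw [mul_pow, ← Real.exp_nat_mul, ← Real.exp_nat_mul]
    have : ∀ a A B C : ℝ, (a * Real.exp A) * (a * Real.exp B) * Real.exp C
      = a ^ 2 * Real.exp (A + B + C) := by
      intro a A B C
      rw [Real.exp_add, Real.exp_add]; ring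
    rw [this]
    congr 2
    simp
    ring
  calc _ = gaussianPDF 0 1 x * gaussianPDF 0 1 y * (f x * g y) := by ring
    _ ≤ gaussianPDF 0 1 x * gaussianPDF 0 1 y *
      (h ((1 / 2 : ℝ) • (x + y)) * ENNReal.ofReal (Real.exp ((x - y) ^ 2 / 8))) ^ 2 := by
        gcongr; exact H x y
    _ = (gaussianPDF 0 1 x * gaussianPDF 0 1 y * ENNReal.ofReal (Real.exp ((x - y) ^ 2 / 8)) ^ 2)
      * h ((1 / 2 : ℝ) • (x + y)) ^ 2 := by ring
    _ = _ := by rw [e]; ring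

/-- the standard gaussian measure on `k × n` matrices -/
def gam (k n : ℕ) : Measure (Fin k → Fin n → ℝ) :=
  Measure.pi (fun _ => Measure.pi (fun _ => ProbabilityTheory.gaussianReal 0 1))

instance (k n : ℕ) : IsProbabilityMeasure (gam k n) := by unfold gam; infer_instance

theorem gpl_gam (k n : ℕ) : GPL (gam k n)
    (fun x y => ENNReal.ofReal (Real.exp ((∑ i, ∑ j, (x i j - y i j) ^ 2) / 8))) := by
  have := (gpl_gauss.pi n).pi k
  have e : (fun x y : Fin k → Fin n → ℝ =>
      ENNReal.ofReal (Real.exp ((∑ i, ∑ j, (x i j - y i j) ^ 2) / 8))) =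
      (fun x y : Fin k → Fin n → ℝ => ∏ i, ∏ j,
        ENNReal.ofReal (Real.exp ((x i j - y i j) ^ 2 / 8))) := by
    funext x y
    have e1 : ∀ i, ∏ j, ENNReal.ofReal (Real.exp ((x i j - y i j) ^ 2 / 8)) =
        ENNReal.ofReal (Real.exp (∑ j, (x i j - y i j) ^ 2 / 8)) := by
      intro i
      rw [Real.exp_sum, ENNReal.ofReal_prod_of_nonneg (fun _ _ => (Real.exp_pos _).le)]
    simp_rw [e1]
    rw [← ENNReal.ofReal_prod_of_nonneg (fun _ _ => (Real.exp_pos _).le), ← Real.exp_sum]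
    simp_rw [Finset.sum_div]
  rw [e]
  exact this

theorem jens {Ω : Type} [MeasurableSpace Ω] {μ : Measure Ω} (u u' : Ω → ℝ) (m : ℝ)
    (I1 : Integrable (fun x => Real.exp (-u x)) μ)
    (I2 : Integrable (fun x => (u' x - u x) * Real.exp (-u x)) μ)
    (I3 : Integrable (fun x => Real.exp (-u' x)) μ)
    (h : ∫ x, (u' x - u x) * Real.exp (-u x) ∂μ ≤ m * ∫ x, Real.exp (-u x) ∂μ) :
    ∫ x, Real.exp (-u x) ∂μ ≤ Real.exp m * ∫ x, Real.exp (-u' x) ∂μ := by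
  have h1 : ∫ x, ((1 + m) * Real.exp (-u x) - (u' x - u x) * Real.exp (-u x)) ∂μ
      ≤ ∫ x, Real.exp m * Real.exp (-u' x) ∂μ := by
    refine integral_mono ((I1.const_mul _).sub I2) (I3.const_mul _) ?_
    intro x
    have := Real.add_one_le_exp (m - (u' x - u x))
    have e : Real.exp m * Real.exp (-u' x)
        = Real.exp (m - (u' x - u x)) * Real.exp (-u x) := by
      rw [← Real.exp_add, ← Real.exp_add]; congr 1; ring
    simp only [e]
    nlinarith [Real.exp_pos (-u x)]
  rw [integral_sub (I1.const_mul _) I2, integral_const_mul, integral_const_mul] at h1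
  linarith

theorem gibbs {Ω : Type} [MeasurableSpace Ω] {μ : Measure Ω} [IsProbabilityMeasure μ]
    (u : Ω → ℝ) (S : ℝ)
    (I1 : Integrable (fun x => Real.exp (-u x)) μ)
    (I2 : Integrable (fun x => u x * Real.exp (-u x)) μ)
    (h : Real.exp (-S) ≤ ∫ x, Real.exp (-u x) ∂μ) :
    ∫ x, u x * Real.exp (-u x) ∂μ ≤ S * ∫ x, Real.exp (-u x) ∂μ := by
  have h1 : ∫ x, (u x * Real.exp (-u x) - S * Real.exp (-u x)) ∂μ
      ≤ ∫ x, (Real.exp (-S) - Real.exp (-u x)) ∂μ := by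
    refine integral_mono (I2.sub (I1.const_mul _)) ((integrable_const _).sub I1) ?_
    intro x
    have := Real.add_one_le_exp (u x - S)
    have e : Real.exp (-S) = Real.exp (u x - S) * Real.exp (-u x) := by
      rw [← Real.exp_add]; congr 1; ring
    simp only [e]
    nlinarith [Real.exp_pos (-u x)]
  rw [integral_sub I2 (I1.const_mul _), integral_const_mul, integral_sub (integrable_const _) I1,
    integral_const] at h1
  simp at h1
  linarith

theorem psi_point (α U S : ℝ) (hα : α ∈ Set.Icc (1 : ℝ) 2) (hU : 0 ≤ U) (hS : 1 ≤ S) :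
    U ^ 2 ≤ S ^ (2 / α) * (1 + 2 * Real.exp (U ^ α - S)) := by
  have a0 : 0 < α := by linarith [hα.1]
  have hp : 1 ≤ 2 / α := by rw [le_div_iff₀ a0]; linarith [hα.2]
  have hp2 : 2 / α ≤ 2 := by rw [div_le_iff₀ a0]; linarith [hα.1]
  have e : U ^ 2 = (U ^ α) ^ (2 / α) := by
    rw [← Real.rpow_mul hU]
    rw [mul_div_cancel₀ _ a0.ne']
    simp
  rw [e]
  set s := U ^ α
  have hs : 0 ≤ s := Real.rpow_nonneg hU _
  have hSp : 0 < S ^ (2 / α) := Real.rpow_pos_of_pos (by linarith) _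
  rcases le_total s S with h | h
  · have := Real.rpow_le_rpow hs h (by linarith : 0 ≤ 2 / α)
    nlinarith [Real.exp_pos (s - S)]
  · have e2 : s ^ (2/α) = S ^ (2/α) * (s / S) ^ (2/α) := by
      rw [← Real.mul_rpow (by linarith) (by positivity)]
      congr 1; field_simp
    rw [e2]
    refine mul_le_mul_of_nonneg_left ?_ hSp.le
    have h1 : 1 ≤ s / S := by rw [le_div_iff₀ (by linarith)]; linarith
    have h2 : (s / S) ^ (2/α) ≤ (s/S) ^ (2:ℝ) := Real.rpow_le_rpow_of_exponent_le h1 hp2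
    have h3 : s / S ≤ 1 + (s - S) := by
      rw [div_le_iff₀ (by linarith)]; nlinarith
    have h4 : (s / S) ^ (2:ℝ) ≤ (1 + (s - S)) ^ 2 := by
      rw [Real.rpow_two]; gcongr
    have h5 := Real.quadratic_le_exp_of_nonneg (x := s - S) (by linarith)
    nlinarith

theorem psi_int {Ω : Type} [MeasurableSpace Ω] {μ : Measure Ω} [IsProbabilityMeasure μ]
    (u U : Ω → ℝ) (α S : ℝ) (hα : α ∈ Set.Icc (1 : ℝ) 2) (hS : 1 ≤ S)
    (hu : ∀ x, 0 ≤ u x) (hU : ∀ x, 0 ≤ U x)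
    (I1 : Integrable (fun x => Real.exp (-u x)) μ)
    (I2 : Integrable (fun x => U x ^ 2 * Real.exp (-u x)) μ)
    (I3 : Integrable (fun x => Real.exp (U x ^ α)) μ)
    (h2 : ∫ x, Real.exp (U x ^ α) ∂μ ≤ 2)
    (h : Real.exp (-S) ≤ ∫ x, Real.exp (-u x) ∂μ) :
    ∫ x, U x ^ 2 * Real.exp (-u x) ∂μ ≤ 5 * S ^ (2 / α) * ∫ x, Real.exp (-u x) ∂μ := by
  have hSp : 0 < S ^ (2 / α) := Real.rpow_pos_of_pos (by linarith) _
  have h1 : ∫ x, U x ^ 2 * Real.exp (-u x) ∂μ ≤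
      ∫ x, (S ^ (2/α) * Real.exp (-u x) +
        (S ^ (2/α) * 2 * Real.exp (-S)) * Real.exp (U x ^ α)) ∂μ := by
    refine integral_mono I2 ((I1.const_mul _).add (I3.const_mul _)) ?_
    intro x
    have p := psi_point α (U x) S hα (hU x) hS
    have e : Real.exp (U x ^ α - S) = Real.exp (-S) * Real.exp (U x ^ α) := by
      rw [← Real.exp_add]; congr 1; ring
    have l1 : Real.exp (-u x) ≤ 1 := Real.exp_le_one_iff.2 (by linarith [hu x])
    have l0 := Real.exp_pos (-u x)
    have l3 := Real.exp_pos (U x ^ α - S)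
    calc U x ^ 2 * Real.exp (-u x)
        ≤ (S ^ (2 / α) * (1 + 2 * Real.exp (U x ^ α - S))) * Real.exp (-u x) := by gcongr
      _ = S ^ (2 / α) * Real.exp (-u x) +
          S ^ (2 / α) * 2 * Real.exp (U x ^ α - S) * Real.exp (-u x) := by ring
      _ ≤ S ^ (2 / α) * Real.exp (-u x) +
          S ^ (2 / α) * 2 * Real.exp (U x ^ α - S) * 1 := by gcongr
      _ = _ := by rw [e]; ring
  rw [integral_add (I1.const_mul _) (I3.const_mul _), integral_const_mul, integral_const_mul] at h1
  have h3 : (S ^ (2/α) * 2 * Real.exp (-S)) * ∫ x, Real.exp (U x ^ α) ∂μ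
      ≤ (S ^ (2/α) * 2 * ∫ x, Real.exp (-u x) ∂μ) * 2 := by
    have : 0 ≤ ∫ x, Real.exp (U x ^ α) ∂μ := integral_nonneg fun x => (Real.exp_pos _).le
    have : 0 ≤ ∫ x, Real.exp (-u x) ∂μ := integral_nonneg fun x => (Real.exp_pos _).le
    gcongr
  linarith

def lf {n : ℕ} (t : ℝ) (g : Fin n → ℝ) (x : EuclideanSpace ℝ (Fin n)) : ℝ :=
  t * ∑ j, g j * x j

def qq {k n : ℕ} (t c : ℝ) (G : Fin k → Fin n → ℝ) (x : EuclideanSpace ℝ (Fin n)) : ℝ :=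
  (∑ i, (lf t (G i) x - c) ^ 2) / 2

theorem lf_cont {n : ℕ} (t : ℝ) (g : Fin n → ℝ) : Continuous (lf t g) := by
  unfold lf; fun_prop

theorem qq_cont {k n : ℕ} (t c : ℝ) (G : Fin k → Fin n → ℝ) : Continuous (qq t c G) := by
  unfold qq
  have := fun i => lf_cont t (G i)
  fun_prop

theorem qq_nonneg {k n : ℕ} (t c : ℝ) (G : Fin k → Fin n → ℝ) (x) : 0 ≤ qq t c G x := by
  unfold qq; positivity

theorem lip {n k : ℕ} (hn : 0 < n) (K : Set (EuclideanSpace ℝ (Fin n))) (hK : IsCompact K)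
    (hvol : volume K = 1) (α b L : ℝ) (hα : α ∈ Set.Icc (1 : ℝ) 2) (hb : 0 < b) (hL : 0 < L)
    (hiso : ∀ θ : EuclideanSpace ℝ (Fin n), ‖θ‖ = 1 → ∫ x in K, ⟪x, θ⟫ ^ 2 = L ^ 2)
    (hpsi : ∀ θ : EuclideanSpace ℝ (Fin n), ‖θ‖ = 1 →
      ∫ x in K, Real.exp ((|⟪x, θ⟫| / (b * L)) ^ α) ≤ 2)
    (t : ℝ) (ht : t ^ 2 * L ^ 2 * n = 1) (M c S η κ : ℝ) (hS : 1 ≤ S) (hS2 : (M + c ^ 2) * k ≤ S)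
    (hη : 5 * b ^ 2 * S ^ (2 / α) ≤ η * n) (hκ : 0 < κ) (hκη : (1 + 1 / κ) * η ≤ 1)
    (G D : Fin k → Fin n → ℝ) (hG : ∑ i, ∑ j, G i j ^ 2 ≤ M * k * n) :
    ∫ x in K, Real.exp (-qq t c G x) ≤ Real.exp (κ * S + (∑ i, ∑ j, D i j ^ 2) / 2) *
      ∫ x in K, Real.exp (-qq t c (G + D) x) := by
  have : IsProbabilityMeasure (volume.restrict K) := ⟨by simp [hvol]⟩
  have ic : ∀ f : EuclideanSpace ℝ (Fin n) → ℝ, Continuous f → Integrable f (volume.restrict K) :=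
    fun f hf => hf.continuousOn.integrableOn_compact hK
  have cq := fun c (G : Fin k → Fin n → ℝ) => qq_cont t c G
  have cl := fun (g : Fin n → ℝ) => lf_cont t g
  have a0 : 0 < α := by linarith [hα.1]
  have hn' : (0 : ℝ) < n := by exact_mod_cast hn
  -- writing a linear form through a unit vector
  have unit : ∀ g : Fin n → ℝ, 0 < ∑ j, g j ^ 2 → ∃ θ : EuclideanSpace ℝ (Fin n), ‖θ‖ = 1 ∧
      ∀ x, lf t g x ^ 2 = t ^ 2 * (∑ j, g j ^ 2) * ⟪x, θ⟫ ^ 2 := by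
    intro g hg
    set r := Real.sqrt (∑ j, g j ^ 2) with hr
    have r0 : 0 < r := Real.sqrt_pos.2 hg
    have r2 : r ^ 2 = ∑ j, g j ^ 2 := Real.sq_sqrt hg.le
    refine ⟨r⁻¹ • WithLp.toLp 2 g, ?_, ?_⟩
    · rw [norm_smul, EuclideanSpace.norm_eq]
      simp only [Real.norm_eq_abs, sq_abs, abs_inv, abs_of_pos r0]
      rw [← hr]
      exact inv_mul_cancel₀ r0.ne'
    · intro x
      rw [inner_smul_right, ← r2]
      have : ⟪x, WithLp.toLp 2 g⟫ = ∑ j, g j * x j := by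
        simp [PiLp.inner_apply]
      rw [this]
      unfold lf
      field_simp
  have zero : ∀ g : Fin n → ℝ, ¬ 0 < ∑ j, g j ^ 2 → ∑ j, g j ^ 2 = 0 ∧ ∀ x, lf t g x = 0 := by
    intro g hg
    have h0 : ∑ j, g j ^ 2 = 0 := le_antisymm (not_lt.1 hg) (by positivity)
    refine ⟨h0, fun x => ?_⟩
    have : ∀ j, g j = 0 := by
      intro j
      have := (Finset.sum_eq_zero_iff_of_nonneg (fun j _ => sq_nonneg (g j))).1 h0 j (Finset.mem_univ _)
      simpa using this
    simp [lf, this]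
  have sec : ∀ g : Fin n → ℝ, ∫ x in K, lf t g x ^ 2 = (∑ j, g j ^ 2) / n := by
    intro g
    by_cases hg : 0 < ∑ j, g j ^ 2
    · obtain ⟨θ, h1, h2⟩ := unit g hg
      simp_rw [h2]
      rw [integral_const_mul, hiso θ h1, eq_div_iff hn'.ne']
      linear_combination (∑ j, g j ^ 2) * ht
    · simp [(zero g hg).2, (zero g hg).1]
  -- lower bound on Z
  have Zlow : Real.exp (-S) ≤ ∫ x in K, Real.exp (-qq t c G x) := by
    have := jens (μ := volume.restrict K) (fun _ => 0) (qq t c G) S (by simp)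
      (by simpa using ic _ (cq c G)) (ic _ (by have := cq c G; fun_prop)) ?_
    · simp at this
      rw [Real.exp_neg, inv_le_iff_one_le_mul₀' (Real.exp_pos _)]
      simpa using this
    · simp only [sub_zero, neg_zero, Real.exp_zero, mul_one]
      have h1 : ∫ x in K, qq t c G x ≤ ∫ x in K, ∑ i, (lf t (G i) x ^ 2 + c ^ 2) := by
        refine integral_mono (ic _ (cq c G)) (ic _ (by fun_prop)) ?_
        intro x
        simp only [qq, Finset.sum_div]
        refine Finset.sum_le_sum fun i _ => ?_
        nlinarith [sq_nonneg (lf t (G i) x + c)]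
      refine h1.trans ?_
      rw [integral_finsetSum _ (fun i _ => ic _ (by have := cl (G i); fun_prop))]
      have h2 : ∀ i, ∫ x in K, (lf t (G i) x ^ 2 + c ^ 2) = (∑ j, G i j ^ 2) / n + c ^ 2 := by
        intro i
        rw [integral_add (ic _ (by have := cl (G i); fun_prop)) (integrable_const _), sec]
        simp [Measure.real]
      simp_rw [h2]
      rw [Finset.sum_add_distrib, ← Finset.sum_div]
      have : (∑ i, ∑ j, G i j ^ 2) / n ≤ M * k := by
        rw [div_le_iff₀ hn']; exact hG
      simp [Measure.real]
      linarith
  have I1 : Integrable (fun x => Real.exp (-qq t c G x)) (volume.restrict K) :=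
    ic _ (by have := cq c G; fun_prop)
  have gb := gibbs (μ := volume.restrict K) (qq t c G) S I1
    (ic _ (by have := cq c G; fun_prop)) Zlow
  set Z := ∫ x in K, Real.exp (-qq t c G x) with hZ
  have Z0 : 0 < Z := (Real.exp_pos _).trans_le Zlow
  have sec2 : ∀ g : Fin n → ℝ, ∫ x in K, lf t g x ^ 2 * Real.exp (-qq t c G x)
      ≤ η * (∑ j, g j ^ 2) * Z := by
    intro g
    by_cases hg : 0 < ∑ j, g j ^ 2
    · obtain ⟨θ, h1, h2⟩ := unit g hg
      have bl : 0 < b * L := by positivity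
      have P := psi_int (μ := volume.restrict K) (qq t c G) (fun x => |⟪x, θ⟫| / (b * L)) α S hα hS
        (qq_nonneg t c G) (fun x => by positivity) I1
        (ic _ (by have := cq c G; fun_prop))
        (ic _ (by
          refine Real.continuous_exp.comp ?_
          refine Continuous.rpow_const (by fun_prop) (fun x => Or.inr a0.le)))
        (hpsi θ h1) Zlow
      have e : ∀ x, lf t g x ^ 2 * Real.exp (-qq t c G x) =
          (t ^ 2 * (∑ j, g j ^ 2) * (b * L) ^ 2) *
            ((|⟪x, θ⟫| / (b * L)) ^ 2 * Real.exp (-qq t c G x)) := by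
        intro x
        rw [h2, div_pow, sq_abs]
        field_simp
      simp_rw [e]
      rw [integral_const_mul]
      calc _ ≤ (t ^ 2 * (∑ j, g j ^ 2) * (b * L) ^ 2) * (5 * S ^ (2 / α) * Z) := by gcongr
        _ = (5 * b ^ 2 * S ^ (2 / α)) * (t ^ 2 * L ^ 2) * (∑ j, g j ^ 2) * Z := by ring
        _ ≤ (η * n) * (t ^ 2 * L ^ 2) * (∑ j, g j ^ 2) * Z := by gcongr
        _ = (t ^ 2 * L ^ 2 * n) * (η * (∑ j, g j ^ 2) * Z) := by ring
        _ = _ := by rw [ht, one_mul]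
    · simp [(zero g hg).2, (zero g hg).1]
  refine jens (μ := volume.restrict K) (qq t c G) (qq t c (G + D)) _ I1
    (ic _ (by have := cq c G; have := cq c (G + D); fun_prop))
    (ic _ (by have := cq c (G + D); fun_prop)) ?_
  have h1 : ∫ x in K, (qq t c (G + D) x - qq t c G x) * Real.exp (-qq t c G x) ≤
      ∫ x in K, (κ * (qq t c G x * Real.exp (-qq t c G x)) +
        ((1 + 1 / κ) / 2) * ∑ i, lf t (D i) x ^ 2 * Real.exp (-qq t c G x)) := by
    refine integral_mono (ic _ (by have := cq c G; have := cq c (G + D); fun_prop))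
      (ic _ (by have := cq c G; fun_prop)) ?_
    intro x
    have p : qq t c (G + D) x - qq t c G x ≤
        κ * qq t c G x + ((1 + 1 / κ) / 2) * ∑ i, lf t (D i) x ^ 2 := by
      simp only [qq, Finset.sum_div, Finset.mul_sum]
      rw [← Finset.sum_sub_distrib, ← Finset.sum_add_distrib]
      refine Finset.sum_le_sum fun i _ => ?_
      have e : lf t ((G + D) i) x = lf t (G i) x + lf t (D i) x := by
        simp only [lf, Pi.add_apply, add_mul, Finset.sum_add_distrib, mul_add]
      rw [e]
      set y := lf t (G i) x - c
      set z := lf t (D i) x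
      have : 2 * y * z ≤ κ * y ^ 2 + 1 / κ * z ^ 2 := by
        have h := sq_nonneg (κ * y - z)
        have : κ * y ^ 2 + 1 / κ * z ^ 2 - 2 * y * z = (κ * y - z) ^ 2 / κ := by
          field_simp; ring
        have : 0 ≤ (κ * y - z) ^ 2 / κ := by positivity
        linarith
      have e3 : lf t (G i) x + z - c = y + z := by simp only [y]; ring
      rw [e3]
      nlinarith
    have := mul_le_mul_of_nonneg_right p (Real.exp_pos (-qq t c G x)).le
    refine this.trans (le_of_eq ?_)
    beta_reduce
    rw [← Finset.sum_mul]
    ring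
  refine h1.trans ?_
  rw [integral_add (ic _ (by have := cq c G; fun_prop)) (ic _ (by have := cq c G; fun_prop)),
    integral_const_mul, integral_const_mul,
    integral_finsetSum _ (fun i _ => ic _ (by have := cl (D i); have := cq c G; fun_prop))]
  have h3 : ∑ i, ∫ x in K, lf t (D i) x ^ 2 * Real.exp (-qq t c G x) ≤
      η * (∑ i, ∑ j, D i j ^ 2) * Z := by
    rw [Finset.mul_sum, Finset.sum_mul]
    exact Finset.sum_le_sum fun i _ => sec2 (D i)
  have hD : 0 ≤ ∑ i, ∑ j, D i j ^ 2 := by positivity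
  calc _ ≤ κ * (S * Z) + (1 + 1 / κ) / 2 * (η * (∑ i, ∑ j, D i j ^ 2) * Z) := by gcongr
    _ = κ * S * Z + ((1 + 1 / κ) * η) * ((∑ i, ∑ j, D i j ^ 2) / 2 * Z) := by ring
    _ ≤ κ * S * Z + 1 * ((∑ i, ∑ j, D i j ^ 2) / 2 * Z) := by gcongr
    _ = _ := by ring

def Zl {k n : ℕ} (K : Set (EuclideanSpace ℝ (Fin n))) (t c : ℝ) (G : Fin k → Fin n → ℝ) : ℝ≥0∞ :=
  ∫⁻ x in K, ENNReal.ofReal (Real.exp (-qq t c G x))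

theorem qq_joint_cont {k n : ℕ} (t c : ℝ) : Continuous
    (fun p : (Fin k → Fin n → ℝ) × EuclideanSpace ℝ (Fin n) => qq t c p.1 p.2) := by
  unfold qq lf
  fun_prop

theorem Zl_meas {k n : ℕ} (K : Set (EuclideanSpace ℝ (Fin n))) (t c : ℝ) :
    Measurable (fun G : Fin k → Fin n → ℝ => Zl K t c G) := by
  unfold Zl
  refine Measurable.lintegral_prod_right' (f := fun p : (Fin k → Fin n → ℝ) ×
    EuclideanSpace ℝ (Fin n) => ENNReal.ofReal (Real.exp (-qq t c p.1 p.2))) ?_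
  have := (qq_joint_cont (k := k) (n := n) t c).measurable
  fun_prop

theorem Zl_eq {k n : ℕ} (K : Set (EuclideanSpace ℝ (Fin n))) (hK : IsCompact K) (t c : ℝ)
    (G : Fin k → Fin n → ℝ) :
    Zl K t c G = ENNReal.ofReal (∫ x in K, Real.exp (-qq t c G x)) := by
  unfold Zl
  rw [ofReal_integral_eq_lintegral_ofReal]
  · have := qq_cont t c G
    exact (Continuous.continuousOn (by fun_prop)).integrableOn_compact hK
  · exact Eventually.of_forall fun x => (Real.exp_pos _).le

theorem lf_mid {n : ℕ} (t : ℝ) (g : Fin n → ℝ) (x y : EuclideanSpace ℝ (Fin n)) :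
    lf t g ((1 / 2 : ℝ) • (x + y)) = (lf t g x + lf t g y) / 2 := by
  unfold lf
  rw [← mul_add, ← Finset.sum_add_distrib, mul_div_assoc, Finset.sum_div]
  congr 1
  refine Finset.sum_congr rfl fun j _ => ?_
  simp; ring

theorem qq_mid {k n : ℕ} (t c c' : ℝ) (G : Fin k → Fin n → ℝ) (x y : EuclideanSpace ℝ (Fin n)) :
    2 * qq t ((c + c') / 2) G ((1 / 2 : ℝ) • (x + y)) ≤ qq t c G x + qq t c' G y := by
  unfold qq
  rw [← add_div, ← Finset.sum_add_distrib, mul_div_assoc', Finset.mul_sum]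
  refine div_le_div_of_nonneg_right (Finset.sum_le_sum fun i _ => ?_) (by norm_num)
  rw [lf_mid]
  nlinarith [sq_nonneg ((lf t (G i) x - c) - (lf t (G i) y - c'))]

theorem Zl_pl {k n : ℕ} (K : Set (EuclideanSpace ℝ (Fin n))) (hK : IsCompact K)
    (hc : Convex ℝ K) (t c c' : ℝ) (G : Fin k → Fin n → ℝ) :
    Zl K t c G * Zl K t c' G ≤ (Zl K t ((c + c') / 2) G) ^ 2 := by
  have hm := hK.measurableSet
  unfold Zl
  rw [← lintegral_indicator hm, ← lintegral_indicator hm, ← lintegral_indicator hm]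
  have ms : ∀ c, Measurable (fun x => ENNReal.ofReal (Real.exp (-qq t c G x))) := by
    intro c
    have := (qq_cont t c G).measurable
    fun_prop
  refine gpl_volume n _ _ _ ((ms c).indicator hm) ((ms c').indicator hm) ((ms _).indicator hm) ?_
  intro x y
  by_cases hx : x ∈ K
  swap
  · simp [hx]
  by_cases hy : y ∈ K
  swap
  · simp [hy]
  have hxy : (1 / 2 : ℝ) • (x + y) ∈ K := by
    rw [smul_add]
    exact hc hx hy (by norm_num) (by norm_num) (by norm_num)
  rw [Set.indicator_of_mem hx, Set.indicator_of_mem hy, Set.indicator_of_mem hxy,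
    ← ENNReal.ofReal_mul (Real.exp_pos _).le, ← ENNReal.ofReal_pow (Real.exp_pos _).le,
    ← Real.exp_add, ← Real.exp_nat_mul]
  refine ENNReal.ofReal_le_ofReal (Real.exp_le_exp.2 ?_)
  have := qq_mid t c c' G x y
  push_cast
  linarith

def Bset (k n : ℕ) (M : ℝ) : Set (Fin k → Fin n → ℝ) := {G | ∑ i, ∑ j, G i j ^ 2 ≤ M * k * n}

theorem Bset_meas (k n : ℕ) (M : ℝ) : MeasurableSet (Bset k n M) := by
  refine measurableSet_le ?_ measurable_const
  exact Continuous.measurable (by fun_prop)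

theorem outer {n k : ℕ} (hn : 0 < n) (K : Set (EuclideanSpace ℝ (Fin n))) (hK : IsCompact K)
    (hc : Convex ℝ K)
    (hvol : volume K = 1) (α b L : ℝ) (hα : α ∈ Set.Icc (1 : ℝ) 2) (hb : 0 < b) (hL : 0 < L)
    (hiso : ∀ θ : EuclideanSpace ℝ (Fin n), ‖θ‖ = 1 → ∫ x in K, ⟪x, θ⟫ ^ 2 = L ^ 2)
    (hpsi : ∀ θ : EuclideanSpace ℝ (Fin n), ‖θ‖ = 1 →
      ∫ x in K, Real.exp ((|⟪x, θ⟫| / (b * L)) ^ α) ≤ 2)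
    (t : ℝ) (ht : t ^ 2 * L ^ 2 * n = 1) (M c c' S η κ : ℝ) (hS : 1 ≤ S)
    (hS2 : (M + c ^ 2) * k ≤ S) (hS3 : (M + c' ^ 2) * k ≤ S)
    (hη : 5 * b ^ 2 * S ^ (2 / α) ≤ η * n) (hκ : 0 < κ) (hκη : (1 + 1 / κ) * η ≤ 1) :
    (∫⁻ G in Bset k n M, Zl K t c G ∂(gam k n)) * ∫⁻ G in Bset k n M, Zl K t c' G ∂(gam k n)
      ≤ (ENNReal.ofReal (Real.exp (κ * S)) * ∫⁻ G, Zl K t ((c + c') / 2) G ∂(gam k n)) ^ 2 := by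
  have hB := Bset_meas k n M
  rw [← lintegral_indicator hB, ← lintegral_indicator hB,
    ← lintegral_const_mul _ (Zl_meas K t _)]
  refine gpl_gam k n _ _ _ ((Zl_meas K t _).indicator hB) ((Zl_meas K t _).indicator hB)
    ((Zl_meas K t _).const_mul _) ?_
  intro X Y
  by_cases hX : X ∈ Bset k n M
  swap
  · simp [hX]
  by_cases hY : Y ∈ Bset k n M
  swap
  · simp [hY]
  rw [Set.indicator_of_mem hX, Set.indicator_of_mem hY]
  set m : Fin k → Fin n → ℝ := (1 / 2 : ℝ) • (X + Y) with hm
  have key : ∀ (c : ℝ) (X Y : Fin k → Fin n → ℝ), (M + c ^ 2) * k ≤ S → X ∈ Bset k n M →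
      Zl K t c X ≤ ENNReal.ofReal (Real.exp (κ * S)) *
        ENNReal.ofReal (Real.exp ((∑ i, ∑ j, (X i j - Y i j) ^ 2) / 8)) *
        Zl K t c ((1 / 2 : ℝ) • (X + Y)) := by
    intro c X Y h1 hX
    have := lip hn K hK hvol α b L hα hb hL hiso hpsi t ht M c S η κ hS h1 hη hκ hκη X
      ((1 / 2 : ℝ) • (Y - X)) hX
    have e1 : X + (1 / 2 : ℝ) • (Y - X) = (1 / 2 : ℝ) • (X + Y) := by
      funext i j; simp; ring
    have e2 : (∑ i, ∑ j, ((1 / 2 : ℝ) • (Y - X)) i j ^ 2) / 2 =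
        (∑ i, ∑ j, (X i j - Y i j) ^ 2) / 8 := by
      rw [Finset.sum_div, Finset.sum_div]
      refine Finset.sum_congr rfl fun i _ => ?_
      rw [Finset.sum_div, Finset.sum_div]
      refine Finset.sum_congr rfl fun j _ => ?_
      simp; ring
    rw [e1, e2] at this
    rw [Zl_eq K hK, Zl_eq K hK, ← ENNReal.ofReal_mul (Real.exp_pos _).le, ← Real.exp_add,
      ← ENNReal.ofReal_mul (Real.exp_pos _).le]
    exact ENNReal.ofReal_le_ofReal this
  have k1 := key c X Y hS2 hX
  have k2 := key c' Y X hS3 hY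
  have e3 : ∑ i, ∑ j, (Y i j - X i j) ^ 2 = ∑ i, ∑ j, (X i j - Y i j) ^ 2 := by
    refine Finset.sum_congr rfl fun i _ => Finset.sum_congr rfl fun j _ => by ring
  rw [add_comm Y X, e3] at k2
  rw [← hm] at k1 k2
  set A := ENNReal.ofReal (Real.exp (κ * S))
  set V := ENNReal.ofReal (Real.exp ((∑ i, ∑ j, (X i j - Y i j) ^ 2) / 8))
  calc Zl K t c X * Zl K t c' Y ≤ (A * V * Zl K t c m) * (A * V * Zl K t c' m) := mul_le_mul' k1 k2
    _ = (A * V) ^ 2 * (Zl K t c m * Zl K t c' m) := by ring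
    _ ≤ (A * V) ^ 2 * (Zl K t ((c + c') / 2) m) ^ 2 := by gcongr; exact Zl_pl K hK hc t c c' m
    _ = _ := by ring

theorem gauss1 (v : NNReal) (c : ℝ) :
    ∫ x, Real.exp (-(x - c) ^ 2 / 2) ∂(ProbabilityTheory.gaussianReal 0 v) =
      (Real.sqrt (1 + v))⁻¹ * Real.exp (-c ^ 2 / (2 * (1 + v))) := by
  by_cases hv : v = 0
  · subst hv
    rw [ProbabilityTheory.gaussianReal_zero_var, integral_dirac]
    simp
  · rw [ProbabilityTheory.integral_gaussianReal_eq_integral_smul hv]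
    have v0 : (0 : ℝ) < v := by positivity
    set w : NNReal := v / (1 + v) with hw
    have w0 : w ≠ 0 := by rw [hw]; positivity
    have wr : (w : ℝ) = v / (1 + v) := by rw [hw]; push_cast; rfl
    have e : ∀ x : ℝ, ProbabilityTheory.gaussianPDFReal 0 v x • Real.exp (-(x - c) ^ 2 / 2) =
        ((Real.sqrt (1 + v))⁻¹ * Real.exp (-c ^ 2 / (2 * (1 + v)))) *
          ProbabilityTheory.gaussianPDFReal (c * v / (1 + v)) w x := by
      intro x
      rw [ProbabilityTheory.gaussianPDFReal_def, ProbabilityTheory.gaussianPDFReal_def]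
      simp only [smul_eq_mul]
      have a1 : Real.sqrt (2 * Real.pi * v) = Real.sqrt (1 + v) * Real.sqrt (2 * Real.pi * w) := by
        rw [← Real.sqrt_mul (by positivity), wr]; congr 1; field_simp
      rw [a1, mul_inv]
      have a2 : Real.exp (-(x - 0) ^ 2 / (2 * v)) * Real.exp (-(x - c) ^ 2 / 2) =
          Real.exp (-c ^ 2 / (2 * (1 + v))) *
            Real.exp (-(x - c * v / (1 + v)) ^ 2 / (2 * w)) := by
        rw [← Real.exp_add, ← Real.exp_add, wr]; congr 1; field_simp; ring
      linear_combination (Real.sqrt (1 + v))⁻¹ * (Real.sqrt (2 * Real.pi * w))⁻¹ * a2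
    simp_rw [e]
    rw [integral_const_mul, ProbabilityTheory.integral_gaussianPDFReal_eq_one _ w0, mul_one]

theorem gauss2 : ∫ x, Real.exp (x ^ 2 / 4) ∂(ProbabilityTheory.gaussianReal 0 1) = Real.sqrt 2 := by
  rw [ProbabilityTheory.integral_gaussianReal_eq_integral_smul one_ne_zero]
  have e : ∀ x : ℝ, ProbabilityTheory.gaussianPDFReal 0 1 x • Real.exp (x ^ 2 / 4) =
      Real.sqrt 2 * ProbabilityTheory.gaussianPDFReal 0 2 x := by
    intro x
    rw [ProbabilityTheory.gaussianPDFReal_def, ProbabilityTheory.gaussianPDFReal_def]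
    simp only [smul_eq_mul, NNReal.coe_one, NNReal.coe_ofNat, mul_one, sub_zero]
    rw [Real.sqrt_mul (by positivity) 2, mul_inv, mul_assoc, ← Real.exp_add]
    have : (-x ^ 2 / 2 + x ^ 2 / 4) = -x ^ 2 / (2 * 2) := by ring
    rw [this]
    have : Real.sqrt 2 ≠ 0 := by positivity
    field_simp
  simp_rw [e]
  rw [integral_const_mul, ProbabilityTheory.integral_gaussianPDFReal_eq_one _ (by norm_num), mul_one]

def JJ (c ρ : ℝ) : ℝ := (Real.sqrt (1 + ρ))⁻¹ * Real.exp (-c ^ 2 / (2 * (1 + ρ)))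

theorem row_int {n : ℕ} (t c : ℝ) (x : EuclideanSpace ℝ (Fin n)) :
    ∫ g, Real.exp (-(lf t g x - c) ^ 2 / 2)
      ∂(Measure.pi (fun _ : Fin n => ProbabilityTheory.gaussianReal 0 1)) =
      JJ c (t ^ 2 * ‖x‖ ^ 2) := by
  set Λ : StrongDual ℝ (EuclideanSpace ℝ (Fin n)) := innerSL ℝ (t • x) with hΛ
  have h1 : ∀ g : Fin n → ℝ, lf t g x = Λ (WithLp.toLp 2 g) := by
    intro g
    simp only [hΛ, innerSL_apply_apply, PiLp.inner_apply, lf, Finset.mul_sum]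
    refine Finset.sum_congr rfl fun j _ => ?_
    simp; ring
  have m0 : Measurable (fun y : ℝ => Real.exp (-(y - c) ^ 2 / 2)) := by fun_prop
  have mp : Measurable (WithLp.toLp 2 : (Fin n → ℝ) → EuclideanSpace ℝ (Fin n)) := by fun_prop
  have mΛ : Measurable Λ := Λ.continuous.measurable
  simp_rw [h1]
  rw [← integral_map (φ := WithLp.toLp 2) (f := fun z : EuclideanSpace ℝ (Fin n) => Real.exp (-(Λ z - c) ^ 2 / 2))
    mp.aemeasurable (m0.comp mΛ).aestronglyMeasurable,
    ProbabilityTheory.map_pi_eq_stdGaussian,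
    ← integral_map (φ := Λ) (f := fun y => Real.exp (-(y - c) ^ 2 / 2))
    mΛ.aemeasurable m0.aestronglyMeasurable,
    ProbabilityTheory.IsGaussian.map_eq_gaussianReal Λ,
    ProbabilityTheory.integral_strongDual_stdGaussian,
    ProbabilityTheory.variance_dual_stdGaussian, gauss1]
  have : ‖Λ‖ ^ 2 = t ^ 2 * ‖x‖ ^ 2 := by
    rw [hΛ, innerSL_apply_norm, norm_smul, mul_pow]; simp
  rw [this, Real.coe_toNNReal _ (by positivity)]
  rfl

theorem gam_int {k n : ℕ} (t c : ℝ) (x : EuclideanSpace ℝ (Fin n)) :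
    ∫⁻ G, ENNReal.ofReal (Real.exp (-qq t c G x)) ∂(gam k n) =
      ENNReal.ofReal (JJ c (t ^ 2 * ‖x‖ ^ 2) ^ k) := by
  rw [← ofReal_integral_eq_lintegral_ofReal]
  rotate_left
  · refine Integrable.mono' (integrable_const (1 : ℝ)) ?_ (Eventually.of_forall fun G => ?_)
    · have : Continuous (fun G : Fin k → Fin n → ℝ => qq t c G x) := by
        unfold qq lf; fun_prop
      exact (Continuous.measurable (by fun_prop)).aestronglyMeasurable
    · rw [Real.norm_eq_abs, abs_of_pos (Real.exp_pos _)]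
      exact Real.exp_le_one_iff.2 (by linarith [qq_nonneg t c G x])
  · exact Eventually.of_forall fun x => (Real.exp_pos _).le
  congr 1
  rw [← row_int]
  have e : ∀ G : Fin k → Fin n → ℝ, Real.exp (-qq t c G x) =
      ∏ i, Real.exp (-(lf t (G i) x - c) ^ 2 / 2) := by
    intro G
    rw [← Real.exp_sum, qq, ← neg_div, ← Finset.sum_div, Finset.sum_neg_distrib]
  simp_rw [e]
  unfold gam
  have := integral_fintype_prod_eq_pow (ι := Fin k) (μ := Measure.pi (fun _ : Fin n => ProbabilityTheory.gaussianReal 0 1))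
    (fun g : Fin n → ℝ => Real.exp (-(lf t g x - c) ^ 2 / 2))
  simpa using this

theorem Phi_eq {k n : ℕ} (K : Set (EuclideanSpace ℝ (Fin n))) (t c : ℝ) :
    ∫⁻ G, Zl K t c G ∂(gam k n) =
      ∫⁻ x in K, ENNReal.ofReal (JJ c (t ^ 2 * ‖x‖ ^ 2) ^ k) := by
  unfold Zl
  rw [lintegral_lintegral_swap]
  · simp_rw [gam_int]
  · have := (qq_joint_cont (k := k) (n := n) t c).measurable
    exact Measurable.aemeasurable (by unfold Function.uncurry; fun_prop)

theorem tail {k n : ℕ} (M : ℝ) : gam k n (Bset k n M)ᶜ ≤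
    ENNReal.ofReal ((Real.sqrt 2 * Real.exp (-M / 4)) ^ (k * n)) := by
  have h1 : ∫ G, ∏ i, ∏ j, Real.exp (G i j ^ 2 / 4) ∂(gam k n) = Real.sqrt 2 ^ (k * n) := by
    unfold gam
    have e := integral_fintype_prod_eq_pow (ι := Fin k)
      (μ := Measure.pi (fun _ : Fin n => ProbabilityTheory.gaussianReal 0 1))
      (fun g : Fin n → ℝ => ∏ j, Real.exp (g j ^ 2 / 4))
    have e2 := integral_fintype_prod_eq_pow (ι := Fin n)
      (μ := ProbabilityTheory.gaussianReal 0 1) (fun g : ℝ => Real.exp (g ^ 2 / 4))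
    rw [e, e2, gauss2, ← pow_mul]; simp [mul_comm]
  have hI : Integrable (fun G : Fin k → Fin n → ℝ => ∏ i, ∏ j, Real.exp (G i j ^ 2 / 4)) (gam k n) := by
    by_contra hc
    rw [integral_undef hc] at h1
    have : (0:ℝ) < Real.sqrt 2 ^ (k * n) := by positivity
    linarith
  have e : ∀ G : Fin k → Fin n → ℝ, ∏ i, ∏ j, Real.exp (G i j ^ 2 / 4) =
      Real.exp ((∑ i, ∑ j, G i j ^ 2) / 4) := by
    intro G
    simp_rw [← Real.exp_sum, ← Finset.sum_div]
  simp_rw [e] at h1 hI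
  have mk := mul_meas_ge_le_integral_of_nonneg (μ := gam k n)
    (Eventually.of_forall fun G => (Real.exp_pos _).le) hI (Real.exp (M * k * n / 4))
  have sub : (Bset k n M)ᶜ ⊆ {G | Real.exp (M * k * n / 4) ≤ Real.exp ((∑ i, ∑ j, G i j ^ 2) / 4)} := by
    intro G hG
    have : M * k * n < ∑ i, ∑ j, G i j ^ 2 := not_le.1 hG
    exact Real.exp_le_exp.2 (by linarith)
  have m2 := (ENNReal.toReal_mono (measure_ne_top _ _) (measure_mono (μ := gam k n) sub))
  rw [ENNReal.le_ofReal_iff_toReal_le (measure_ne_top _ _) (by positivity)]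
  rw [h1] at mk
  have e3 : (Real.sqrt 2 * Real.exp (-M / 4)) ^ (k * n) =
      Real.sqrt 2 ^ (k * n) * (Real.exp (M * k * n / 4))⁻¹ := by
    rw [mul_pow, ← Real.exp_neg, ← Real.exp_nat_mul]; congr 2; push_cast; ring
  rw [e3, ← div_eq_mul_inv, le_div_iff₀ (Real.exp_pos _)]
  refine le_trans ?_ mk
  rw [mul_comm]
  exact mul_le_mul_of_nonneg_left m2 (Real.exp_pos _).le

theorem JJ_nonneg (c ρ : ℝ) : 0 ≤ JJ c ρ := by unfold JJ; positivity

theorem JJ_low (a h ρ : ℝ) (ha : 0 ≤ a) (h1 : a ≤ ρ) (h2 : ρ ≤ a + h) :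
    (Real.sqrt (1 + a + h))⁻¹ * Real.exp (-1 / 2) ≤ JJ (Real.sqrt (1 + a)) ρ := by
  unfold JJ
  rw [Real.sq_sqrt (by linarith)]
  have : (0:ℝ) < Real.sqrt (1 + ρ) := Real.sqrt_pos.2 (by linarith)
  refine mul_le_mul (inv_anti₀ this (Real.sqrt_le_sqrt (by linarith))) ?_ (Real.exp_pos _).le
    (by positivity)
  refine Real.exp_le_exp.2 ?_
  rw [le_div_iff₀ (by linarith)]; linarith

theorem JJ_up (c ρ : ℝ) (hc : 0 < c) (h1 : 0 ≤ ρ) :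
    JJ c ρ ^ 2 ≤ (Real.exp 1 * c ^ 2)⁻¹ := by
  have s0 : 0 < 1 + ρ := by linarith
  have e : JJ c ρ ^ 2 = (1 + ρ)⁻¹ * Real.exp (-(c ^ 2 / (1 + ρ))) := by
    unfold JJ
    rw [mul_pow, inv_pow, Real.sq_sqrt s0.le, ← Real.exp_nat_mul]
    congr 2; push_cast; field_simp
  rw [e, Real.exp_neg, ← mul_inv]
  refine inv_anti₀ (by positivity) ?_
  have := Real.add_one_le_exp (c ^ 2 / (1 + ρ) - 1)
  have e2 : Real.exp (c ^ 2 / (1 + ρ)) = Real.exp 1 * Real.exp (c ^ 2 / (1 + ρ) - 1) := by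
    rw [← Real.exp_add]; congr 1; ring
  rw [e2]
  have h3 : c ^ 2 / (1 + ρ) ≤ Real.exp (c ^ 2 / (1 + ρ) - 1) := by linarith
  rw [div_le_iff₀ s0] at h3
  have := Real.exp_pos 1
  nlinarith

theorem Zl_le_one {k n : ℕ} (K : Set (EuclideanSpace ℝ (Fin n))) (hvol : volume K = 1) (t c : ℝ)
    (G : Fin k → Fin n → ℝ) : Zl K t c G ≤ 1 := by
  unfold Zl
  calc _ ≤ ∫⁻ x in K, 1 := by
        refine lintegral_mono fun x => ?_
        rw [ENNReal.ofReal_le_one]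
        exact Real.exp_le_one_iff.2 (by linarith [qq_nonneg t c G x])
    _ = 1 := by simp [hvol]

theorem FB_low {k n : ℕ} (K : Set (EuclideanSpace ℝ (Fin n))) (hvol : volume K = 1) (t c M : ℝ) :
    ∫⁻ G, Zl K t c G ∂(gam k n) ≤ (∫⁻ G in Bset k n M, Zl K t c G ∂(gam k n)) +
      ENNReal.ofReal ((Real.sqrt 2 * Real.exp (-M / 4)) ^ (k * n)) := by
  rw [← lintegral_add_compl _ (Bset_meas k n M)]
  refine add_le_add le_rfl (le_trans ?_ (tail M))
  calc _ ≤ ∫⁻ G in (Bset k n M)ᶜ, 1 ∂(gam k n) := lintegral_mono fun G => Zl_le_one K hvol t c G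
    _ = _ := by simp

def pp {n : ℕ} (K : Set (EuclideanSpace ℝ (Fin n))) (t a h : ℝ) : ℝ :=
  (volume.restrict K {x | a ≤ t ^ 2 * ‖x‖ ^ 2 ∧ t ^ 2 * ‖x‖ ^ 2 ≤ a + h}).toReal

theorem pp_meas {n : ℕ} (t a h : ℝ) :
    MeasurableSet {x : EuclideanSpace ℝ (Fin n) | a ≤ t ^ 2 * ‖x‖ ^ 2 ∧ t ^ 2 * ‖x‖ ^ 2 ≤ a + h} := by
  have mm : Measurable (fun x : EuclideanSpace ℝ (Fin n) => t ^ 2 * ‖x‖ ^ 2) := by fun_prop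
  refine MeasurableSet.inter ?_ ?_
  · exact measurableSet_le measurable_const mm
  · exact measurableSet_le mm measurable_const

theorem F_low {k n : ℕ} (K : Set (EuclideanSpace ℝ (Fin n))) (hvol : volume K = 1) (t a h : ℝ)
    (ha : 0 ≤ a) :
    ENNReal.ofReal (((Real.sqrt (1 + a + h))⁻¹ * Real.exp (-1 / 2)) ^ k * pp K t a h) ≤
      ∫⁻ G, Zl K t (Real.sqrt (1 + a)) G ∂(gam k n) := by
  have : IsProbabilityMeasure (volume.restrict K) := ⟨by simp [hvol]⟩
  rw [Phi_eq, ENNReal.ofReal_mul (by positivity), pp, ENNReal.ofReal_toReal (measure_ne_top _ _),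
    ← setLIntegral_const]
  refine le_trans ?_ (setLIntegral_le_lintegral {x | a ≤ t ^ 2 * ‖x‖ ^ 2 ∧ t ^ 2 * ‖x‖ ^ 2 ≤ a + h} _)
  refine setLIntegral_mono' (pp_meas t a h) ?_
  intro x hx
  refine ENNReal.ofReal_le_ofReal ?_
  exact pow_le_pow_left₀ (by positivity) (JJ_low a h _ ha hx.1 hx.2) k

theorem F_up {k n : ℕ} (K : Set (EuclideanSpace ℝ (Fin n))) (hvol : volume K = 1) (t c : ℝ)
    (hc : 0 < c) :
    (∫⁻ G, Zl K t c G ∂(gam k n)) ^ 2 ≤ ENNReal.ofReal ((Real.exp 1 * c ^ 2)⁻¹ ^ k) := by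
  have h1 : ∫⁻ G, Zl K t c G ∂(gam k n) ≤
      ENNReal.ofReal (Real.sqrt ((Real.exp 1 * c ^ 2)⁻¹) ^ k) := by
    rw [Phi_eq]
    calc _ ≤ ∫⁻ x in K, ENNReal.ofReal (Real.sqrt ((Real.exp 1 * c ^ 2)⁻¹) ^ k) := by
          refine lintegral_mono fun x => ENNReal.ofReal_le_ofReal ?_
          refine pow_le_pow_left₀ (JJ_nonneg _ _) ?_ k
          exact Real.le_sqrt_of_sq_le (JJ_up c _ hc (by positivity))
      _ = _ := by simp [hvol]
  calc _ ≤ (ENNReal.ofReal (Real.sqrt ((Real.exp 1 * c ^ 2)⁻¹) ^ k)) ^ 2 := by gcongr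
    _ = _ := by
      rw [← ENNReal.ofReal_pow (by positivity), ← pow_mul, mul_comm k 2, pow_mul,
        Real.sq_sqrt (by positivity)]

theorem pp_le_one {n : ℕ} (K : Set (EuclideanSpace ℝ (Fin n))) (hvol : volume K = 1) (t a h : ℝ) :
    pp K t a h ≤ 1 := by
  have : IsProbabilityMeasure (volume.restrict K) := ⟨by simp [hvol]⟩
  exact ENNReal.toReal_mono ENNReal.one_ne_top prob_le_one

theorem pp_nonneg {n : ℕ} (K : Set (EuclideanSpace ℝ (Fin n))) (t a h : ℝ) :
    0 ≤ pp K t a h := ENNReal.toReal_nonneg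

theorem bucket {n k : ℕ} (hn : 0 < n) (K : Set (EuclideanSpace ℝ (Fin n))) (hK : IsCompact K)
    (hc : Convex ℝ K)
    (hvol : volume K = 1) (α b L : ℝ) (hα : α ∈ Set.Icc (1 : ℝ) 2) (hb : 0 < b) (hL : 0 < L)
    (hiso : ∀ θ : EuclideanSpace ℝ (Fin n), ‖θ‖ = 1 → ∫ x in K, ⟪x, θ⟫ ^ 2 = L ^ 2)
    (hpsi : ∀ θ : EuclideanSpace ℝ (Fin n), ‖θ‖ = 1 →
      ∫ x in K, Real.exp ((|⟪x, θ⟫| / (b * L)) ^ α) ≤ 2)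
    (t : ℝ) (ht : t ^ 2 * L ^ 2 * n = 1) (M C₁ η κ ε a a' h : ℝ) (ha : 0 ≤ a) (ha' : 0 ≤ a')
    (hh : 0 ≤ h)
    (hS : 1 ≤ C₁ * k)
    (hS2 : M + (1 + a) ≤ C₁) (hS3 : M + (1 + a') ≤ C₁)
    (hη : 5 * b ^ 2 * (C₁ * k) ^ (2 / α) ≤ η * n) (hκ : 0 < κ) (hκη : (1 + 1 / κ) * η ≤ 1)
    (hε : 0 ≤ ε)
    (hrat : Real.exp (2 * κ * C₁) * (Real.sqrt (1 + a + h) * Real.sqrt (1 + a' + h)) ≤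
      Real.exp (-ε) * ((Real.sqrt (1 + a) + Real.sqrt (1 + a')) / 2) ^ 2)
    (hM : Real.sqrt 2 * Real.exp (-M / 4) ≤
      Real.exp (-ε) * ((Real.sqrt (1 + a + h))⁻¹ * Real.exp (-1 / 2)))
    (hM' : Real.sqrt 2 * Real.exp (-M / 4) ≤
      Real.exp (-ε) * ((Real.sqrt (1 + a' + h))⁻¹ * Real.exp (-1 / 2))) :
    pp K t a h * pp K t a' h ≤ 4 * Real.exp (-ε) ^ k := by
  set τ := Real.sqrt 2 * Real.exp (-M / 4) with hτ
  set m := (Real.sqrt (1 + a + h))⁻¹ * Real.exp (-1 / 2) with hm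
  set m' := (Real.sqrt (1 + a' + h))⁻¹ * Real.exp (-1 / 2) with hm'
  have τ0 : 0 < τ := by positivity
  have q0 : 0 < Real.sqrt (1 + a + h) := Real.sqrt_pos.2 (by linarith)
  have q0' : 0 < Real.sqrt (1 + a' + h) := Real.sqrt_pos.2 (by linarith)
  have m0 : 0 < m := by positivity
  have m0' : 0 < m' := by positivity
  have E1 : Real.exp (-ε) ≤ 1 := Real.exp_le_one_iff.2 (by linarith)
  have q1 : 1 ≤ Real.sqrt (1 + a + h) := Real.one_le_sqrt.2 (by linarith)
  have m1 : m ≤ 1 := by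
    rw [hm]
    have : Real.exp (-1/2) ≤ 1 := Real.exp_le_one_iff.2 (by norm_num)
    exact mul_le_one₀ (inv_le_one_of_one_le₀ q1) (Real.exp_pos _).le this
  have τ1 : τ ≤ 1 := hM.trans (mul_le_one₀ E1 m0.le m1)
  have τn : τ ^ (k * n) ≤ τ ^ k :=
    pow_le_pow_of_le_one τ0.le τ1 (Nat.le_mul_of_pos_right k hn)
  -- the small cases
  have small : ∀ p m : ℝ, 0 < m → τ ≤ Real.exp (-ε) * m → m ^ k * p < 2 * τ ^ (k * n) →
      p ≤ 2 * Real.exp (-ε) ^ k := by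
    intro p m m0 h1 h2
    have h3 : m ^ k * p ≤ m ^ k * (2 * Real.exp (-ε) ^ k) := by
      have : τ ^ k ≤ Real.exp (-ε) ^ k * m ^ k := by
        rw [← mul_pow]; exact pow_le_pow_left₀ τ0.le h1 k
      linarith
    exact le_of_mul_le_mul_left h3 (by positivity)
  have p1 := pp_le_one K hvol t a h
  have p1' := pp_le_one K hvol t a' h
  have p0 := pp_nonneg K t a h
  have p0' := pp_nonneg K t a' h
  have Ek : 0 < Real.exp (-ε) ^ k := by positivity
  by_cases c1 : m ^ k * pp K t a h < 2 * τ ^ (k * n)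
  · have := small _ _ m0 hM c1
    nlinarith
  by_cases c2 : m' ^ k * pp K t a' h < 2 * τ ^ (k * n)
  · have := small _ _ m0' hM' c2
    nlinarith
  push Not at c1 c2
  have sq : ∀ a : ℝ, 0 ≤ a → Real.sqrt (1 + a) ^ 2 = 1 + a := fun a ha => Real.sq_sqrt (by linarith)
  have k0 : (0:ℝ) ≤ k := by positivity
  have main := outer (k := k) hn K hK hc hvol α b L hα hb hL hiso hpsi t ht M (Real.sqrt (1 + a))
    (Real.sqrt (1 + a')) (C₁ * k) η κ hS
    (by rw [sq a ha]; exact mul_le_mul_of_nonneg_right hS2 k0)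
    (by rw [sq a' ha']; exact mul_le_mul_of_nonneg_right hS3 k0) hη hκ hκη
  set c := (Real.sqrt (1 + a) + Real.sqrt (1 + a')) / 2 with hcdef
  have c0 : 0 < c := by
    have : 0 < Real.sqrt (1 + a) := Real.sqrt_pos.2 (by linarith)
    positivity
  rw [mul_pow] at main
  have main2 := main.trans (mul_le_mul_right (F_up (k := k) K hvol t c c0) _)
  rw [← ENNReal.ofReal_pow (Real.exp_pos _).le, ← ENNReal.ofReal_mul (by positivity)] at main2
  have low : ∀ a, 0 ≤ a → 2 * τ ^ (k * n) ≤
      ((Real.sqrt (1 + a + h))⁻¹ * Real.exp (-1 / 2)) ^ k * pp K t a h →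
      ENNReal.ofReal (((Real.sqrt (1 + a + h))⁻¹ * Real.exp (-1 / 2)) ^ k * pp K t a h / 2) ≤
      ∫⁻ G in Bset k n M, Zl K t (Real.sqrt (1 + a)) G ∂(gam k n) := by
    intro a ha h1
    have := (F_low (k := k) K hvol t a h ha).trans (FB_low K hvol t _ M)
    rw [← tsub_le_iff_right, ← ENNReal.ofReal_sub _ (by positivity)] at this
    refine le_trans (ENNReal.ofReal_le_ofReal ?_) this
    rw [← hτ]
    linarith
  have main3 := (mul_le_mul' (low a ha c1) (low a' ha' c2)).trans main2
  rw [← ENNReal.ofReal_mul (by positivity), ENNReal.ofReal_le_ofReal_iff (by positivity)] at main3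
  rw [← hm, ← hm'] at main3
  -- conclude
  have e1 : Real.exp (κ * (C₁ * k)) ^ 2 = Real.exp (2 * κ * C₁) ^ k := by
    rw [← Real.exp_nat_mul, ← Real.exp_nat_mul]; congr 1; push_cast; ring
  have e2 : m * m' = (Real.exp 1 * (Real.sqrt (1 + a + h) * Real.sqrt (1 + a' + h)))⁻¹ := by
    rw [hm, hm', mul_inv, mul_inv, ← Real.exp_neg]
    have : Real.exp (-1) = Real.exp (-1/2) * Real.exp (-1/2) := by
      rw [← Real.exp_add]; congr 1; norm_num
    rw [this]; ring
  have e3 : Real.exp (2 * κ * C₁) * (Real.exp 1 * c ^ 2)⁻¹ ≤ Real.exp (-ε) * (m * m') := by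
    rw [e2, ← div_eq_mul_inv, ← div_eq_mul_inv, div_le_div_iff₀ (by positivity) (by positivity)]
    have := mul_le_mul_of_nonneg_left hrat (Real.exp_pos 1).le
    linarith
  rw [e1, ← mul_pow] at main3
  have e4 := main3.trans (pow_le_pow_left₀ (by positivity) e3 k)
  rw [mul_pow (Real.exp (-ε)), mul_pow m m'] at e4
  have mm : 0 < m ^ k * m' ^ k := by positivity
  refine le_of_mul_le_mul_left (a := m ^ k * m' ^ k) ?_ mm
  linarith

theorem pp_cover {n : ℕ} (K : Set (EuclideanSpace ℝ (Fin n))) (hvol : volume K = 1) (t a h : ℝ)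
    (N : ℕ) :
    pp K t a ((N + 1 : ℕ) * h) ≤ ∑ i ∈ Finset.range (N + 1), pp K t (a + i * h) h := by
  have : IsProbabilityMeasure (volume.restrict K) := ⟨by simp [hvol]⟩
  induction N with
  | zero => simp
  | succ N ih =>
    rw [Finset.sum_range_succ]
    refine le_trans ?_ (add_le_add_left ih _)
    unfold pp
    rw [← ENNReal.toReal_add (measure_ne_top _ _) (measure_ne_top _ _)]
    refine ENNReal.toReal_mono (by finiteness) ?_
    refine le_trans (measure_mono ?_) (measure_union_le _ _)
    rintro x ⟨h1, h2⟩
    rcases le_total (t ^ 2 * ‖x‖ ^ 2) (a + (N + 1 : ℕ) * h) with h3 | h3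
    · exact Or.inl ⟨h1, h3⟩
    · refine Or.inr ⟨h3, h2.trans (le_of_eq ?_)⟩
      push_cast; ring

theorem pp_mono {n : ℕ} (K : Set (EuclideanSpace ℝ (Fin n))) (hvol : volume K = 1) (t a h h' : ℝ)
    (hh : h ≤ h') : pp K t a h ≤ pp K t a h' := by
  have : IsProbabilityMeasure (volume.restrict K) := ⟨by simp [hvol]⟩
  refine ENNReal.toReal_mono (measure_ne_top _ _) (measure_mono ?_)
  rintro x ⟨h1, h2⟩
  exact ⟨h1, by linarith⟩

theorem u4 (α u : ℝ) (hα : 1 ≤ α) (hu : 0 ≤ u) :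
    u ^ 4 ≤ 24 * Real.exp 1 * Real.exp (u ^ α) := by
  have h1 := Real.pow_div_factorial_le_exp u hu 4
  have h2 : u ≤ 1 + u ^ α := by
    rcases le_total u 1 with h | h
    · have := Real.rpow_nonneg hu α; linarith
    · have := Real.rpow_le_rpow_of_exponent_le h hα
      rw [Real.rpow_one] at this; linarith
  have h3 : Real.exp u ≤ Real.exp 1 * Real.exp (u ^ α) := by
    rw [← Real.exp_add]; exact Real.exp_le_exp.2 h2
  have h4 : ((Nat.factorial 4 : ℕ) : ℝ) = 24 := by norm_num [Nat.factorial]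
  rw [h4] at h1
  linarith

theorem moments {n : ℕ} (hn : 0 < n) (K : Set (EuclideanSpace ℝ (Fin n))) (hK : IsCompact K)
    (hvol : volume K = 1) (α b L : ℝ) (hα : α ∈ Set.Icc (1 : ℝ) 2) (hb : 0 < b) (hL : 0 < L)
    (hiso : ∀ θ : EuclideanSpace ℝ (Fin n), ‖θ‖ = 1 → ∫ x in K, ⟪x, θ⟫ ^ 2 = L ^ 2)
    (hpsi : ∀ θ : EuclideanSpace ℝ (Fin n), ‖θ‖ = 1 →
      ∫ x in K, Real.exp ((|⟪x, θ⟫| / (b * L)) ^ α) ≤ 2)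
    (t : ℝ) (ht : t ^ 2 * L ^ 2 * n = 1) (s M : ℝ) (hs : 0 ≤ s) (hM : 0 < M) :
    1 ≤ s + M * pp K t s (M - s) + 48 * Real.exp 1 * b ^ 4 / M := by
  have : IsProbabilityMeasure (volume.restrict K) := ⟨by simp [hvol]⟩
  have ic : ∀ f : EuclideanSpace ℝ (Fin n) → ℝ, Continuous f → Integrable f (volume.restrict K) :=
    fun f hf => hf.continuousOn.integrableOn_compact hK
  have nrm : ∀ x : EuclideanSpace ℝ (Fin n), ‖x‖ ^ 2 = ∑ i, x i ^ 2 := fun x => by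
    rw [EuclideanSpace.norm_sq_eq]; simp
  have inn : ∀ (i : Fin n) (x : EuclideanSpace ℝ (Fin n)),
      ⟪x, EuclideanSpace.single i (1 : ℝ)⟫ = x i := fun i x => by
    rw [real_inner_comm, EuclideanSpace.inner_single_left]; simp
  have un : ∀ i : Fin n, ‖(EuclideanSpace.single i (1 : ℝ) : EuclideanSpace ℝ (Fin n))‖ = 1 :=
    fun i => by simp
  have i2 : ∀ i : Fin n, ∫ x in K, x i ^ 2 = L ^ 2 := fun i => by
    have := hiso _ (un i)
    simpa only [inn] using this
  have i4 : ∀ i : Fin n, ∫ x in K, x i ^ 4 ≤ (b * L) ^ 4 * (48 * Real.exp 1) := fun i => by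
    have h1 := hpsi _ (un i)
    simp only [inn] at h1
    have a0 : 0 ≤ α := by linarith [hα.1]
    have : ∫ x in K, x i ^ 4 ≤ ∫ x in K, ((b * L) ^ 4 * (24 * Real.exp 1)) *
        Real.exp ((|x i| / (b * L)) ^ α) := by
      refine integral_mono (ic _ (by fun_prop)) ((ic _ ?_).const_mul _) fun x => ?_
      · refine Real.continuous_exp.comp ?_
        refine Continuous.rpow_const (by fun_prop) fun x => Or.inr a0
      · have := u4 α (|x i| / (b * L)) hα.1 (by positivity)
        have e : x i ^ 4 = (b * L) ^ 4 * (|x i| / (b * L)) ^ 4 := by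
          rw [div_pow, Even.pow_abs ⟨2, rfl⟩]; field_simp
        simp only [e]
        rw [mul_assoc]
        gcongr
    rw [integral_const_mul] at this
    refine this.trans ?_
    have : 0 < (b * L) ^ 4 * (24 * Real.exp 1) := by positivity
    nlinarith
  have j1 : ∫ x in K, t ^ 2 * ‖x‖ ^ 2 = 1 := by
    simp only [nrm]
    rw [integral_const_mul, integral_finsetSum _ fun i _ => ic _ (by fun_prop)]
    simp only [i2]
    simp
    linarith
  have j2 : ∫ x in K, (t ^ 2 * ‖x‖ ^ 2) ^ 2 ≤ 48 * Real.exp 1 * b ^ 4 := by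
    have h1 : ∫ x in K, (t ^ 2 * ‖x‖ ^ 2) ^ 2 ≤ ∫ x in K, t ^ 4 * n * ∑ i, x i ^ 4 := by
      refine integral_mono (ic _ (by fun_prop)) (ic _ (by fun_prop)) fun x => ?_
      have := sq_sum_le_card_mul_sum_sq (s := Finset.univ) (f := fun i => x i ^ 2)
      simp only [Finset.card_univ, Fintype.card_fin, ← pow_mul] at this
      simp only [nrm]
      have t4 : 0 ≤ t ^ 4 := by positivity
      have := mul_le_mul_of_nonneg_left this t4
      calc _ = t ^ 4 * (∑ i, x i ^ 2) ^ 2 := by ring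
        _ ≤ _ := this
        _ = _ := by ring
    rw [integral_const_mul, integral_finsetSum _ fun i _ => ic _ (by fun_prop)] at h1
    refine h1.trans ?_
    calc _ ≤ t ^ 4 * n * ∑ i : Fin n, (b * L) ^ 4 * (48 * Real.exp 1) := by
          gcongr with i; exact i4 i
      _ = (t ^ 2 * L ^ 2 * n) ^ 2 * (48 * Real.exp 1 * b ^ 4) := by
          simp; ring
      _ = _ := by rw [ht]; ring
  set A := {x : EuclideanSpace ℝ (Fin n) | s ≤ t ^ 2 * ‖x‖ ^ 2 ∧ t ^ 2 * ‖x‖ ^ 2 ≤ s + (M - s)}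
    with hA
  have mA : MeasurableSet A := pp_meas t s (M - s)
  have iA : Integrable (A.indicator fun _ => M) (volume.restrict K) :=
    (integrable_const M).indicator mA
  have iS : Integrable (fun x => s + A.indicator (fun _ => M) x) (volume.restrict K) :=
    (integrable_const s).add iA
  have fin : ∫ x in K, t ^ 2 * ‖x‖ ^ 2 ≤ ∫ x in K, ((s + A.indicator (fun _ => M) x) +
      (t ^ 2 * ‖x‖ ^ 2) ^ 2 / M) := by
    refine integral_mono (ic _ (by fun_prop)) (iS.add
      (ic _ (by fun_prop))) fun x => ?_
    simp only
    have n0 : 0 ≤ t ^ 2 * ‖x‖ ^ 2 := by positivity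
    have n1 : 0 ≤ (t ^ 2 * ‖x‖ ^ 2) ^ 2 / M := by positivity
    by_cases hx : x ∈ A
    · rw [Set.indicator_of_mem hx]
      have := hx.2
      linarith
    · rw [Set.indicator_of_notMem hx]
      by_cases h1 : s ≤ t ^ 2 * ‖x‖ ^ 2
      · have h2 : M < t ^ 2 * ‖x‖ ^ 2 := by
          by_contra hc
          exact hx ⟨h1, by linarith⟩
        have : t ^ 2 * ‖x‖ ^ 2 ≤ (t ^ 2 * ‖x‖ ^ 2) ^ 2 / M := by
          rw [le_div_iff₀ hM]; nlinarith
        linarith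
      · linarith
  rw [j1, integral_add iS (ic _ (by fun_prop)),
    integral_add (integrable_const s) iA, integral_indicator mA, integral_div] at fin
  have e : ∫ x in A, M ∂(volume.restrict K) = M * pp K t s (M - s) := by
    simp [pp, Measure.real, hA, mul_comm]
  rw [e] at fin
  simp at fin
  have : (∫ x in K, (t ^ 2 * ‖x‖ ^ 2) ^ 2) / M ≤ 48 * Real.exp 1 * b ^ 4 / M := by gcongr
  linarith

set_option maxHeartbeats 1000000 in
theorem params (s₁ s₂ w : ℝ) (h1 : 0 ≤ s₁) (h12 : s₁ < s₂) (hw : s₂ ≤ w) :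
    ∃ ε > 0, ∃ h > 0, ∃ M : ℝ, ∃ C₁ ≥ (1 : ℝ), ∃ κ > 0, ∀ a a' : ℝ, 0 ≤ a → a ≤ s₁ →
      s₂ ≤ a' → a' ≤ w →
      M + (1 + a) ≤ C₁ ∧ M + (1 + a') ≤ C₁ ∧
      Real.exp (2 * κ * C₁) * (Real.sqrt (1 + a + h) * Real.sqrt (1 + a' + h)) ≤
        Real.exp (-ε) * ((Real.sqrt (1 + a) + Real.sqrt (1 + a')) / 2) ^ 2 ∧
      Real.sqrt 2 * Real.exp (-M / 4) ≤
        Real.exp (-ε) * ((Real.sqrt (1 + a + h))⁻¹ * Real.exp (-1 / 2)) ∧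
      Real.sqrt 2 * Real.exp (-M / 4) ≤
        Real.exp (-ε) * ((Real.sqrt (1 + a' + h))⁻¹ * Real.exp (-1 / 2)) := by
  set W := 1 + w with hW
  have W1 : 1 ≤ W := by linarith
  set g := s₂ - s₁ with hg
  have g0 : 0 < g := by linarith
  set δ := (g / (2 * W)) ^ 2 / (4 * W) with hδ
  have δ0 : 0 < δ := by positivity
  set ε := Real.log (1 + δ) / 4 with hε
  have ε0 : 0 < ε := by
    have := Real.log_pos (by linarith : 1 < 1 + δ)
    positivity
  have e4 : Real.exp (4 * ε) = 1 + δ := by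
    rw [hε, mul_div_cancel₀ _ (by norm_num), Real.exp_log (by linarith)]
  set h := Real.exp ε - 1 with hh
  have h0 : 0 < h := by have := Real.add_one_lt_exp ε0.ne'; linarith
  set R := Real.exp (-ε) * ((Real.sqrt (1 + w + h))⁻¹ * Real.exp (-1 / 2)) with hR
  have sq0 : 0 < Real.sqrt (1 + w + h) := Real.sqrt_pos.2 (by linarith)
  have R0 : 0 < R := by positivity
  obtain ⟨M, M0, hM⟩ : ∃ M : ℝ, 0 ≤ M ∧ Real.sqrt 2 * Real.exp (-M / 4) ≤ R := by
    have s2 : 0 < Real.sqrt 2 := by positivity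
    refine ⟨max 0 (-4 * Real.log (R / Real.sqrt 2)), le_max_left _ _, ?_⟩
    have : Real.exp (-(max 0 (-4 * Real.log (R / Real.sqrt 2))) / 4) ≤ R / Real.sqrt 2 := by
      rw [← Real.le_log_iff_exp_le (by positivity)]
      have := le_max_right 0 (-4 * Real.log (R / Real.sqrt 2))
      linarith
    rw [le_div_iff₀ s2] at this
    linarith
  have Rle : ∀ a, 0 ≤ a → a ≤ w →
      R ≤ Real.exp (-ε) * ((Real.sqrt (1 + a + h))⁻¹ * Real.exp (-1 / 2)) := by
    intro a ha hw
    have : 0 < Real.sqrt (1 + a + h) := Real.sqrt_pos.2 (by linarith)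
    rw [hR]
    have := inv_anti₀ this (Real.sqrt_le_sqrt (by linarith : 1 + a + h ≤ 1 + w + h))
    gcongr
  refine ⟨ε, ε0, h, h0, M, M + W, by linarith, ε / (2 * (M + W)), by positivity, ?_⟩
  intro a a' ha hs hs' hw'
  have ha' : 0 ≤ a' := by linarith
  refine ⟨by linarith, by linarith, ?_, hM.trans (Rle a ha (by linarith)), hM.trans (Rle a' ha' hw')⟩
  have ec : 2 * (ε / (2 * (M + W))) * (M + W) = ε := by field_simp
  rw [ec]
  set p := Real.sqrt (1 + a) with hp
  set q := Real.sqrt (1 + a') with hq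
  have p2 : p ^ 2 = 1 + a := Real.sq_sqrt (by linarith)
  have q2 : q ^ 2 = 1 + a' := Real.sq_sqrt (by linarith)
  have p1 : 1 ≤ p := Real.one_le_sqrt.2 (by linarith)
  have q1 : 1 ≤ q := Real.one_le_sqrt.2 (by linarith)
  have pw : p ≤ W := by nlinarith
  have qw : q ≤ W := by nlinarith
  have pqd : g / (2 * W) ≤ q - p := by
    rw [div_le_iff₀ (by linarith)]
    have g1 : g ≤ (q - p) * (q + p) := by
      have : (q - p) * (q + p) = q ^ 2 - p ^ 2 := by ring
      linarith
    have g2 : 0 ≤ q - p := sub_nonneg.2 (Real.sqrt_le_sqrt (by linarith))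
    exact g1.trans (mul_le_mul_of_nonneg_left (by linarith) g2)
  have pqW : p * q ≤ W := by
    have : (p * q) ^ 2 ≤ W ^ 2 := by
      rw [mul_pow, p2, q2, sq W]
      exact mul_le_mul (by linarith) (by linarith) (by linarith) (by linarith)
    exact (pow_le_pow_iff_left₀ (by positivity) (by positivity) two_ne_zero).1 this
  have key : p * q * (1 + δ) ≤ ((p + q) / 2) ^ 2 := by
    have h1 : (g / (2 * W)) ^ 2 ≤ (q - p) ^ 2 := by gcongr
    have h2 : p * q * δ ≤ (g / (2 * W)) ^ 2 / 4 := by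
      calc p * q * δ ≤ W * δ := by gcongr
        _ = (g / (2 * W)) ^ 2 / 4 := by rw [hδ]; field_simp
    nlinarith
  have sqb : ∀ a, 0 ≤ a → Real.sqrt (1 + a + h) ≤ Real.sqrt (Real.exp ε) * Real.sqrt (1 + a) := by
    intro a ha
    rw [← Real.sqrt_mul (Real.exp_pos _).le]
    refine Real.sqrt_le_sqrt ?_
    nlinarith
  have ee : Real.sqrt (Real.exp ε) * Real.sqrt (Real.exp ε) = Real.exp ε :=
    Real.mul_self_sqrt (Real.exp_pos _).le
  calc Real.exp ε * (Real.sqrt (1 + a + h) * Real.sqrt (1 + a' + h))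
      ≤ Real.exp ε * ((Real.sqrt (Real.exp ε) * p) * (Real.sqrt (Real.exp ε) * q)) := by
        gcongr
        · exact sqb a ha
        · exact sqb a' ha'
    _ = (Real.exp ε * Real.exp ε) * (p * q) := by
        linear_combination (Real.exp ε * p * q) * ee
    _ ≤ (Real.exp (-ε) * Real.exp (4 * ε)) * (p * q) := by
        rw [← Real.exp_add, ← Real.exp_add]
        exact mul_le_mul_of_nonneg_right (Real.exp_le_exp.2 (by linarith)) (by positivity)
    _ = Real.exp (-ε) * (p * q * (1 + δ)) := by rw [e4]; ring
    _ ≤ _ := by gcongr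

theorem combine {n k : ℕ} (hn : 0 < n) (K : Set (EuclideanSpace ℝ (Fin n))) (hK : IsCompact K)
    (hc : Convex ℝ K)
    (hvol : volume K = 1) (α b L : ℝ) (hα : α ∈ Set.Icc (1 : ℝ) 2) (hb : 0 < b) (hL : 0 < L)
    (hiso : ∀ θ : EuclideanSpace ℝ (Fin n), ‖θ‖ = 1 → ∫ x in K, ⟪x, θ⟫ ^ 2 = L ^ 2)
    (hpsi : ∀ θ : EuclideanSpace ℝ (Fin n), ‖θ‖ = 1 →
      ∫ x in K, Real.exp ((|⟪x, θ⟫| / (b * L)) ^ α) ≤ 2)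
    (t : ℝ) (ht : t ^ 2 * L ^ 2 * n = 1) (M C₁ η κ ε h s₁ s₂ w : ℝ) (h1 : 0 ≤ s₁)
    (h12 : s₁ < s₂) (hw : s₂ ≤ w) (hh : 0 < h)
    (hS : 1 ≤ C₁ * k)
    (hη : 5 * b ^ 2 * (C₁ * k) ^ (2 / α) ≤ η * n) (hκ : 0 < κ) (hκη : (1 + 1 / κ) * η ≤ 1)
    (hε : 0 ≤ ε)
    (hyp : ∀ a a' : ℝ, 0 ≤ a → a ≤ s₁ →
      s₂ ≤ a' → a' ≤ w →
      M + (1 + a) ≤ C₁ ∧ M + (1 + a') ≤ C₁ ∧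
      Real.exp (2 * κ * C₁) * (Real.sqrt (1 + a + h) * Real.sqrt (1 + a' + h)) ≤
        Real.exp (-ε) * ((Real.sqrt (1 + a) + Real.sqrt (1 + a')) / 2) ^ 2 ∧
      Real.sqrt 2 * Real.exp (-M / 4) ≤
        Real.exp (-ε) * ((Real.sqrt (1 + a + h))⁻¹ * Real.exp (-1 / 2)) ∧
      Real.sqrt 2 * Real.exp (-M / 4) ≤
        Real.exp (-ε) * ((Real.sqrt (1 + a' + h))⁻¹ * Real.exp (-1 / 2)))
    (N : ℕ) (hN : w ≤ (N + 1 : ℕ) * h) :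
    pp K t 0 s₁ * pp K t s₂ (w - s₂) ≤ ((N + 1 : ℕ) : ℝ) ^ 2 * (4 * Real.exp (-ε) ^ k) := by
  have N0 : (0 : ℝ) < (N + 1 : ℕ) := by positivity
  have cov : ∀ a d : ℝ, 0 ≤ d → d ≤ w → pp K t a d ≤
      ∑ i ∈ Finset.range (N + 1), pp K t (a + i * (d / (N + 1 : ℕ))) h := by
    intro a d d0 dw
    have := pp_cover K hvol t a (d / (N + 1 : ℕ)) N
    rw [mul_div_cancel₀ _ N0.ne'] at this
    refine this.trans (Finset.sum_le_sum fun i _ => pp_mono K hvol t _ _ _ ?_)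
    rw [div_le_iff₀ N0]; linarith
  have ib : ∀ d : ℝ, 0 ≤ d → ∀ i ∈ Finset.range (N + 1), 0 ≤ (i : ℝ) * (d / (N + 1 : ℕ)) ∧
      (i : ℝ) * (d / (N + 1 : ℕ)) ≤ d := by
    intro d d0 i hi
    refine ⟨by positivity, ?_⟩
    have : (i : ℝ) ≤ (N + 1 : ℕ) := by exact_mod_cast (Finset.mem_range.1 hi).le
    calc (i : ℝ) * (d / (N + 1 : ℕ)) ≤ (N + 1 : ℕ) * (d / (N + 1 : ℕ)) := by gcongr
      _ = d := mul_div_cancel₀ _ N0.ne'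
  have c1 := cov 0 s₁ h1 (by linarith)
  have c2 := cov s₂ (w - s₂) (by linarith) (by linarith)
  calc _ ≤ (∑ i ∈ Finset.range (N + 1), pp K t (0 + i * (s₁ / (N + 1 : ℕ))) h) *
        ∑ i ∈ Finset.range (N + 1), pp K t (s₂ + i * ((w - s₂) / (N + 1 : ℕ))) h :=
        mul_le_mul c1 c2 (pp_nonneg _ _ _ _) ((pp_nonneg _ _ _ _).trans c1)
    _ = ∑ i ∈ Finset.range (N + 1), ∑ j ∈ Finset.range (N + 1),
        pp K t (0 + i * (s₁ / (N + 1 : ℕ))) h * pp K t (s₂ + j * ((w - s₂) / (N + 1 : ℕ))) h :=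
        Finset.sum_mul_sum _ _ _ _
    _ ≤ ∑ i ∈ Finset.range (N + 1), ∑ j ∈ Finset.range (N + 1), 4 * Real.exp (-ε) ^ k := by
        refine Finset.sum_le_sum fun i hi => Finset.sum_le_sum fun j hj => ?_
        have b1 := ib s₁ h1 i hi
        have b2 := ib (w - s₂) (by linarith) j hj
        have ha : 0 ≤ 0 + (i : ℝ) * (s₁ / (N + 1 : ℕ)) := by linarith
        have ha' : 0 ≤ s₂ + (j : ℝ) * ((w - s₂) / (N + 1 : ℕ)) := by linarith
        obtain ⟨y1, y2, y3, y4, y5⟩ := hyp _ (s₂ + (j : ℝ) * ((w - s₂) / (N + 1 : ℕ))) ha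
          (by linarith) (by linarith) (by linarith)
        exact bucket hn K hK hc hvol α b L hα hb hL hiso hpsi t ht M C₁ η κ ε _ _ h ha ha' hh.le hS
          y1 y2 hη hκ hκη hε y3 y4 y5
    _ = _ := by
        rw [Finset.sum_const, Finset.sum_const, Finset.card_range]
        simp only [nsmul_eq_mul]; ring

set_option maxHeartbeats 2000000 in
theorem stmt7 (α : ℝ) (hα : α ∈ Set.Icc (1 : ℝ) 2) (b : ℝ) (hb : 0 < b)
    (K : (d : ℕ) → Set (EuclideanSpace ℝ (Fin d))) (L : ℕ → ℝ)
    -- each `K d` is a convex body ...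
    (hKcompact : ∀ d, IsCompact (K d)) (hKconv : ∀ d, Convex ℝ (K d))
    (hKint : ∀ d, (interior (K d)).Nonempty)
    -- ... which is isotropic with isotropic constant `L d` ...
    (hKvol : ∀ d, volume (K d) = 1)
    (hKbary : ∀ d, ∫ x in K d, x = 0)
    (hL : ∀ d, 0 < L d)
    (hKiso : ∀ d, ∀ θ : EuclideanSpace ℝ (Fin d), ‖θ‖ = 1 →
      ∫ x in K d, ⟪x, θ⟫ ^ 2 = (L d) ^ 2)
    -- ... and satisfies a ψ_α-estimate with constant `b`:
    (hKpsi : ∀ d, ∀ θ : EuclideanSpace ℝ (Fin d), ‖θ‖ = 1 →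
      ∫ x in K d, Real.exp ((|⟪x, θ⟫| / (b * L d)) ^ α) ≤ 2)
    -- the radii `r d` are nonnegative with `limsup_{d → ∞} r_d / L_{K_d} < 1`:
    (r : ℕ → ℝ) (hr : ∀ d, 0 ≤ r d)
    (hlimsup : ∃ s < (1 : ℝ), ∀ᶠ d in atTop, r d / L d ≤ s) :
    ∃ c > (0 : ℝ), ∃ C > (0 : ℝ), ∀ d : ℕ,
      (volume (K d ∩ Metric.closedBall 0 (r d * Real.sqrt d))).toReal ≤
        C * Real.exp (-c * (d : ℝ) ^ (α / 2)) := by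
  obtain ⟨s₀, hs₀, hev⟩ := hlimsup
  obtain ⟨d₀, hd₀⟩ := eventually_atTop.1 hev
  have a0 : 0 < α := by linarith [hα.1]
  set s := max s₀ 0 with hs
  have s0 : 0 ≤ s := le_max_right _ _
  have s1 : s < 1 := max_lt hs₀ one_pos
  set s₁ := s ^ 2 with hs₁
  have s₁0 : 0 ≤ s₁ := by positivity
  have s₁1 : s₁ < 1 := by nlinarith
  set s₂ := (1 + s₁) / 2 with hs₂
  have h12 : s₁ < s₂ := by linarith
  have h21 : s₂ < 1 := by linarith
  set C4 := 48 * Real.exp 1 * b ^ 4 with hC4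
  have C40 : 0 < C4 := by positivity
  set w := max 1 (2 * C4 / (1 - s₂)) with hw
  have w1 : 1 ≤ w := le_max_left _ _
  have w2 : C4 / w ≤ (1 - s₂) / 2 := by
    have : 2 * C4 / (1 - s₂) ≤ w := le_max_right _ _
    rw [div_le_iff₀ (by linarith)] at this
    rw [div_le_iff₀ (by linarith)]
    linarith
  obtain ⟨ε, ε0, h, h0, M, C₁, hC₁, κ, κ0, hyp⟩ := params s₁ s₂ w s₁0 h12 (by linarith)
  obtain ⟨N, hN⟩ := exists_nat_ge (w / h)
  have hN' : w ≤ (N + 1 : ℕ) * h := by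
    rw [div_le_iff₀ h0] at hN
    push_cast; nlinarith
  set η := (1 + 1 / κ)⁻¹ with hη
  have η0 : 0 < η := by positivity
  have hκη : (1 + 1 / κ) * η ≤ 1 := by
    rw [hη, mul_inv_cancel₀ (by positivity)]
  set δ := min (1 / C₁) (η / (5 * b ^ 2 * C₁)) with hδ
  have C₁0 : 0 < C₁ := by linarith
  have δ0 : 0 < δ := lt_min (by positivity) (by positivity)
  have δ1 : C₁ * δ ≤ 1 := by
    have : δ ≤ 1 / C₁ := min_le_left _ _
    rw [le_div_iff₀ C₁0] at this; linarith
  have δ2 : 5 * b ^ 2 * (C₁ * δ) ≤ η := by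
    have : δ ≤ η / (5 * b ^ 2 * C₁) := min_le_right _ _
    rw [le_div_iff₀ (by positivity)] at this; linarith
  set p₀ := (1 - s₂) / (2 * w) with hp₀
  have p₀0 : 0 < p₀ := div_pos (by linarith) (by linarith)
  -- the main range
  have main : ∀ d : ℕ, d₀ ≤ d → 1 ≤ δ * (d : ℝ) ^ (α / 2) →
      (volume (K d ∩ Metric.closedBall 0 (r d * Real.sqrt d))).toReal ≤
        (4 * ((N + 1 : ℕ) : ℝ) ^ 2 * Real.exp ε / p₀) *
          Real.exp (-(ε * δ) * (d : ℝ) ^ (α / 2)) := by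
    intro d hdd hd1
    have dpos : 0 < d := by
      rcases Nat.eq_zero_or_pos d with h | h
      · subst h
        rw [Nat.cast_zero, Real.zero_rpow (by positivity)] at hd1
        linarith
      · exact h
    have dr : (0 : ℝ) < d := by exact_mod_cast dpos
    set k := ⌊δ * (d : ℝ) ^ (α / 2)⌋₊ with hk
    have kle : (k : ℝ) ≤ δ * (d : ℝ) ^ (α / 2) := Nat.floor_le (by linarith)
    have kge : δ * (d : ℝ) ^ (α / 2) < k + 1 := Nat.lt_floor_add_one _
    have k1 : 1 ≤ k := (Nat.one_le_floor_iff _).2 hd1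
    have k1' : (1 : ℝ) ≤ k := by exact_mod_cast k1
    have Ld := hL d
    set t := 1 / (L d * Real.sqrt d) with ht
    have ht2 : t ^ 2 = 1 / (L d ^ 2 * d) := by
      rw [ht, div_pow, mul_pow, Real.sq_sqrt dr.le, one_pow]
    have ht1 : t ^ 2 * L d ^ 2 * d = 1 := by
      rw [ht2]; field_simp
    have e2a : 0 ≤ 2 / α := by positivity
    have p1 : 1 ≤ 2 / α := by rw [le_div_iff₀ a0]; linarith [hα.2]
    have hη2 : 5 * b ^ 2 * (C₁ * k) ^ (2 / α) ≤ η * d := by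
      have q1 : C₁ * k ≤ (C₁ * δ) * (d : ℝ) ^ (α / 2) := by
        rw [mul_assoc]; gcongr
      have q2 : (C₁ * k) ^ (2 / α) ≤ (C₁ * δ) ^ (2 / α) * d := by
        refine (Real.rpow_le_rpow (by positivity) q1 e2a).trans (le_of_eq ?_)
        rw [Real.mul_rpow (by positivity) (by positivity), ← Real.rpow_mul dr.le]
        have : α / 2 * (2 / α) = 1 := by field_simp
        rw [this, Real.rpow_one]
      have q3 : (C₁ * δ) ^ (2 / α) ≤ C₁ * δ := by
        have := Real.rpow_le_rpow_of_exponent_ge (by positivity : 0 < C₁ * δ) δ1 p1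
        rwa [Real.rpow_one] at this
      calc 5 * b ^ 2 * (C₁ * k) ^ (2 / α) ≤ 5 * b ^ 2 * ((C₁ * δ) * d) := by
            have q4 := q2.trans (mul_le_mul_of_nonneg_right q3 dr.le)
            exact mul_le_mul_of_nonneg_left q4 (by positivity)
        _ = (5 * b ^ 2 * (C₁ * δ)) * d := by ring
        _ ≤ η * d := by gcongr
    have cmb := combine (k := k) dpos (K d) (hKcompact d) (hKconv d) (hKvol d) α b (L d) hα hb Ld
      (hKiso d) (hKpsi d) t ht1 M C₁ η κ ε h s₁ s₂ w s₁0 h12 (by linarith) h0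
      (one_le_mul_of_one_le_of_one_le hC₁ k1') hη2 κ0
      hκη ε0.le hyp N hN'
    have mom := moments dpos (K d) (hKcompact d) (hKvol d) α b (L d) hα hb Ld
      (hKiso d) (hKpsi d) t ht1 s₂ w (by linarith) (by linarith)
    have pl : p₀ ≤ pp (K d) t s₂ (w - s₂) := by
      rw [hp₀, div_le_iff₀ (by linarith)]
      rw [← hC4] at mom
      linarith
    have vol : (volume (K d ∩ Metric.closedBall 0 (r d * Real.sqrt d))).toReal ≤
        pp (K d) t 0 s₁ := by
      have hp : IsProbabilityMeasure (volume.restrict (K d)) := ⟨by simp [hKvol d]⟩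
      unfold pp
      rw [Set.inter_comm, ← Measure.restrict_apply Metric.isClosed_closedBall.measurableSet]
      refine ENNReal.toReal_mono (measure_ne_top _ _) (measure_mono ?_)
      intro x hx
      rw [mem_closedBall_zero_iff] at hx
      refine ⟨by positivity, ?_⟩
      have hr1 : r d ≤ s * L d := by
        have := (hd₀ d hdd).trans (le_max_left s₀ 0)
        rwa [div_le_iff₀ Ld] at this
      have hx2 : ‖x‖ ^ 2 ≤ (s * L d) ^ 2 * d := by
        have : ‖x‖ ≤ s * L d * Real.sqrt d := hx.trans (by gcongr)
        calc ‖x‖ ^ 2 ≤ (s * L d * Real.sqrt d) ^ 2 := by gcongr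
          _ = _ := by rw [mul_pow, Real.sq_sqrt dr.le]
      calc t ^ 2 * ‖x‖ ^ 2 ≤ t ^ 2 * ((s * L d) ^ 2 * d) := by gcongr
        _ = s ^ 2 * (t ^ 2 * L d ^ 2 * d) := by ring
        _ = 0 + s₁ := by rw [ht1, hs₁]; ring
    have ex : Real.exp (-ε) ^ k ≤ Real.exp ε * Real.exp (-(ε * δ) * (d : ℝ) ^ (α / 2)) := by
      rw [← Real.exp_nat_mul, ← Real.exp_add]
      refine Real.exp_le_exp.2 ?_
      have := mul_le_mul_of_nonneg_left kge.le ε0.le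
      linarith
    refine vol.trans ?_
    have fin : pp (K d) t 0 s₁ * p₀ ≤
        ((N + 1 : ℕ) : ℝ) ^ 2 * (4 * (Real.exp ε * Real.exp (-(ε * δ) * (d : ℝ) ^ (α / 2)))) := by
      refine (mul_le_mul_of_nonneg_left pl (pp_nonneg _ _ _ _)).trans (cmb.trans ?_)
      gcongr
    rw [← le_div_iff₀ p₀0] at fin
    refine fin.trans (le_of_eq ?_)
    ring
  -- conclusion
  have triv : ∀ d : ℕ, (volume (K d ∩ Metric.closedBall 0 (r d * Real.sqrt d))).toReal ≤ 1 := by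
    intro d
    refine ENNReal.toReal_mono ENNReal.one_ne_top ?_
    rw [← hKvol d]
    exact measure_mono Set.inter_subset_left
  set X := 4 * ((N + 1 : ℕ) : ℝ) ^ 2 * Real.exp ε / p₀ with hX
  have X0 : 0 < X := by positivity
  set Y := Real.exp (ε * δ * (d₀ : ℝ) ^ (α / 2)) with hY
  have Y0 : 0 < Y := Real.exp_pos _
  refine ⟨ε * δ, by positivity, X + Y + Real.exp ε, by positivity, ?_⟩
  intro d
  have E0 := Real.exp_pos (-(ε * δ) * (d : ℝ) ^ (α / 2))
  have Ee := Real.exp_pos ε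
  by_cases hd : d₀ ≤ d
  · by_cases hd1 : 1 ≤ δ * (d : ℝ) ^ (α / 2)
    · refine (main d hd hd1).trans ?_
      exact mul_le_mul_of_nonneg_right (by linarith) E0.le
    · push Not at hd1
      refine (triv d).trans ?_
      have : 1 ≤ Real.exp ε * Real.exp (-(ε * δ) * (d : ℝ) ^ (α / 2)) := by
        rw [← Real.exp_add]
        refine Real.one_le_exp ?_
        have := mul_le_mul_of_nonneg_left hd1.le ε0.le
        linarith
      refine this.trans ?_
      exact mul_le_mul_of_nonneg_right (by linarith) E0.le
  · push Not at hd
    refine (triv d).trans ?_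
    have : 1 ≤ Y * Real.exp (-(ε * δ) * (d : ℝ) ^ (α / 2)) := by
      rw [hY, ← Real.exp_add]
      refine Real.one_le_exp ?_
      have h1 : (d : ℝ) ^ (α / 2) ≤ (d₀ : ℝ) ^ (α / 2) :=
        Real.rpow_le_rpow (by positivity) (by exact_mod_cast hd.le) (by positivity)
      have h2 := mul_le_mul_of_nonneg_left h1 (by positivity : 0 ≤ ε * δ)
      linarith
    refine this.trans ?_
    exact mul_le_mul_of_nonneg_right (by linarith) E0.le

end
end

section
/- Let α ∈ [1,2] and b > 0, and let (K_d)_{d∈ℕ} be a sequence where K_d ⊆ ℝ^d is a symmetric isotropic convex body satisfying a ψ_α-estimate with constant b, and suppose limsup_{d→∞} rad(K_d)/(√d·L_{K_d}) < 2. Let (A_d), (B_d) be positive reals with A_d ≥ a/(√d·L_{K_d}) and B_d ≥ b'/(d·L_{K_d}²) for all d, for some a, b' > 0. Then there exist constants c > 0, γ > 0 and ε₀ ∈ (0,1) such that for every d ∈ ℕ, every n ∈ ℕ with n < c·(1+γ)^{d^{α/2}}, every choice of points x₁,…,x_n ∈ K_d and every map φ : ℝⁿ → ℝ, there exists f ∈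 C¹_d(A_d,B_d,K_d) with |∫_{K_d} f(x) dx − φ(f(x₁),…,f(x_n))| ≥ ε₀. (This expresses the information-complexity lower bound n(ε,C¹_d(A_d,B_d,K_d)) ≥ c(1+γ)^{d^{α/2}} for all ε < ε₀.) -/
open MeasureTheory Filter
open scoped RealInnerProductSpace

noncomputable section

/-- The class `C¹_d(A, B, K)` of continuously differentiable functions `f : ℝ^d → ℝ`
with `|f| ≤ 1` on `K`, `f` being `A`-Lipschitz on `K` and its gradient `B`-Lipschitz on `K`. -/
def MemC1Class (d : ℕ) (A B : ℝ) (K : Set (EuclideanSpace ℝ (Fin d)))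
    (f : EuclideanSpace ℝ (Fin d) → ℝ) : Prop :=
  ContDiff ℝ 1 f ∧ (∀ x ∈ K, |f x| ≤ 1) ∧
    (∀ x ∈ K, ∀ y ∈ K, |f x - f y| ≤ A * ‖x - y‖) ∧
    (∀ x ∈ K, ∀ y ∈ K, ‖fderiv ℝ f x - fderiv ℝ f y‖ ≤ B * ‖x - y‖)

/-- The radius `rad(K) = sup_{y ∈ K} ‖y‖₂` of a symmetric convex body. -/
def symRad {d : ℕ} (K : Set (EuclideanSpace ℝ (Fin d))) : ℝ :=
  sSup ((fun y => ‖y‖) '' K)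


lemma exists_proj {E : Type*} [NormedAddCommGroup E] [InnerProductSpace ℝ E] (C : Set E)
    (hne : C.Nonempty) (hc : IsCompact C) (hconv : Convex ℝ C) :
    ∃ P : E → E, ∀ x, P x ∈ C ∧ (∀ z ∈ C, ⟪x - P x, z - P x⟫ ≤ 0) := by
  have h : ∀ x : E, ∃ p, p ∈ C ∧ (∀ z ∈ C, ⟪x - p, z - p⟫ ≤ 0) := by
    intro x
    obtain ⟨p, hp, hpe⟩ := exists_norm_eq_iInf_of_complete_convex hne hc.isComplete hconv x
    exact ⟨p, hp, (norm_eq_iInf_iff_real_inner_le_zero hconv hp).1 hpe⟩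
  choose P hP using h
  exact ⟨P, hP⟩

lemma resid_lip {E : Type*} [NormedAddCommGroup E] [InnerProductSpace ℝ E] (C : Set E)
    (P : E → E) (hP : ∀ x, P x ∈ C ∧ (∀ z ∈ C, ⟪x - P x, z - P x⟫ ≤ 0)) (x y : E) :
    ‖(x - P x) - (y - P y)‖ ≤ ‖x - y‖ := by
  have h1 := (hP x).2 (P y) (hP y).1
  have h2 := (hP y).2 (P x) (hP x).1
  have h3 : ‖(x - P x) - (y - P y)‖ ^ 2 ≤ ⟪(x - P x) - (y - P y), x - y⟫ := by
    rw [← real_inner_self_eq_norm_sq]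
    simp only [inner_sub_left, inner_sub_right] at *
    linarith [real_inner_comm x y, real_inner_comm (P x) y, real_inner_comm x (P y),
      real_inner_comm (P x) (P y), real_inner_comm x (P x), real_inner_comm y (P y)]
  have h4 := real_inner_le_norm ((x - P x) - (y - P y)) (x - y)
  by_contra hlt
  push Not at hlt
  nlinarith [norm_nonneg (x - y)]

lemma sq_expand {E : Type*} [NormedAddCommGroup E] [InnerProductSpace ℝ E] (C : Set E)
    (P : E → E) (hP : ∀ x, P x ∈ C ∧ (∀ z ∈ C, ⟪x - P x, z - P x⟫ ≤ 0)) (x y : E) :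
    ‖y - P y‖ ^ 2 ≤ ‖x - P x‖ ^ 2 + 2 * ⟪x - P x, y - x⟫ + ‖y - x‖ ^ 2 := by
  have h1 : ‖y - P x‖ ^ 2 = ‖x - P x‖ ^ 2 + 2 * ⟪x - P x, y - x⟫ + ‖y - x‖ ^ 2 := by
    rw [← norm_add_sq_real]; congr 2; abel
  have h2 : ‖y - P x‖ ^ 2 = ‖y - P y‖ ^ 2 - 2 * ⟪y - P y, P x - P y⟫ + ‖P x - P y‖ ^ 2 := by
    rw [← norm_sub_sq_real]; congr 2; abel
  have h3 := (hP y).2 (P x) (hP x).1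
  nlinarith [sq_nonneg ‖P x - P y‖]

lemma sq_hasFDerivAt {E : Type*} [NormedAddCommGroup E] [InnerProductSpace ℝ E] (C : Set E)
    (P : E → E) (hP : ∀ x, P x ∈ C ∧ (∀ z ∈ C, ⟪x - P x, z - P x⟫ ≤ 0)) (x : E) :
    HasFDerivAt (fun x => ‖x - P x‖ ^ 2) ((2 : ℝ) • innerSL ℝ (x - P x)) x := by
  rw [hasFDerivAt_iff_isLittleO]
  have hO : (fun y => ‖y - P y‖ ^ 2 - ‖x - P x‖ ^ 2 - ((2 : ℝ) • innerSL ℝ (x - P x)) (y - x))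
      =O[nhds x] (fun y => ‖y - x‖ ^ 2) := by
    apply Asymptotics.IsBigO.of_bound 3
    filter_upwards with y
    have h1 := sq_expand C P hP x y
    have h2 := sq_expand C P hP y x
    have h3 := resid_lip C P hP x y
    have h4 := abs_real_inner_le_norm ((x - P x) - (y - P y)) (x - y)
    have h5 : ⟪(x - P x) - (y - P y), x - y⟫
      = - ⟪x - P x, y - x⟫ - ⟪y - P y, x - y⟫ := by
      rw [inner_sub_left, ← neg_sub y x, inner_neg_right, inner_neg_right]
    rw [h5] at h4
    have h6 : ‖x - y‖ = ‖y - x‖ := norm_sub_rev _ _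
    rw [h6] at h2 h3 h4
    have h7 := mul_le_mul_of_nonneg_right h3 (norm_nonneg (y - x))
    have h8 := (abs_le.1 (h4.trans h7))
    simp only [ContinuousLinearMap.smul_apply, innerSL_apply_apply, smul_eq_mul, norm_pow, norm_norm,
      Real.norm_eq_abs, abs_norm]
    rw [abs_le]
    constructor <;> nlinarith [sq_nonneg ‖y - x‖, h8.1, h8.2]
  refine hO.trans_isLittleO ?_
  have := Asymptotics.isLittleO_pow_sub_sub x (m := 2) (by norm_num)
  simpa using this

lemma sq_contDiff {E : Type*} [NormedAddCommGroup E] [InnerProductSpace ℝ E] (C : Set E)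
    (P : E → E) (hP : ∀ x, P x ∈ C ∧ (∀ z ∈ C, ⟪x - P x, z - P x⟫ ≤ 0)) (M : ℝ) :
    ContDiff ℝ 1 (fun x => M * ‖x - P x‖ ^ 2) ∧
    ∀ x, fderiv ℝ (fun x => M * ‖x - P x‖ ^ 2) x = M • ((2 : ℝ) • innerSL ℝ (x - P x)) := by
  have hd : ∀ x, HasFDerivAt (fun x => M * ‖x - P x‖ ^ 2)
      (M • ((2 : ℝ) • innerSL ℝ (x - P x))) x := fun x =>
    (sq_hasFDerivAt C P hP x).const_mul M
  have hf : ∀ x, fderiv ℝ (fun x => M * ‖x - P x‖ ^ 2) x = M • ((2 : ℝ) • innerSL ℝ (x - P x)) :=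
    fun x => (hd x).fderiv
  refine ⟨?_, hf⟩
  rw [contDiff_one_iff_fderiv]
  refine ⟨fun x => (hd x).differentiableAt, ?_⟩
  have hc : Continuous (fun x => x - P x) := by
    have : LipschitzWith 1 (fun x => x - P x) := LipschitzWith.of_dist_le_mul (fun x y => by
      simpa [dist_eq_norm] using resid_lip C P hP x y)
    exact this.continuous
  have he : (fderiv ℝ (fun x => M * ‖x - P x‖ ^ 2)) =
      fun x => M • ((2 : ℝ) • innerSL ℝ (x - P x)) := funext hf
  rw [he]
  fun_prop

lemma sq_memClass (d : ℕ) (A B R M : ℝ) (K C : Set (EuclideanSpace ℝ (Fin d)))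
    (P : EuclideanSpace ℝ (Fin d) → EuclideanSpace ℝ (Fin d))
    (hP : ∀ x, P x ∈ C ∧ (∀ z ∈ C, ⟪x - P x, z - P x⟫ ≤ 0)) (hCK : C ⊆ K)
    (hR : ∀ x ∈ K, ‖x‖ ≤ R)
    (h1 : |M| * (4 * R ^ 2) ≤ 1) (h2 : |M| * (4 * R) ≤ A) (h3 : |M| * 2 ≤ B) :
    MemC1Class d A B K (fun x => M * ‖x - P x‖ ^ 2) := by
  have hQ : ∀ x ∈ K, ‖x - P x‖ ≤ 2 * R := fun x hx => by
    linarith [norm_sub_le x (P x), hR x hx, hR (P x) (hCK (hP x).1)]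
  refine ⟨(sq_contDiff C P hP M).1, ?_, ?_, ?_⟩
  · intro x hx
    rw [abs_mul, abs_of_nonneg (sq_nonneg ‖x - P x‖)]
    refine le_trans (mul_le_mul_of_nonneg_left ?_ (abs_nonneg M)) h1
    nlinarith [hQ x hx, norm_nonneg (x - P x)]
  · intro x hx y hy
    rw [← mul_sub, abs_mul]
    have e : ‖x - P x‖ ^ 2 - ‖y - P y‖ ^ 2 =
      (‖x - P x‖ - ‖y - P y‖) * (‖x - P x‖ + ‖y - P y‖) := by ring
    have e1 : |‖x - P x‖ ^ 2 - ‖y - P y‖ ^ 2| ≤ ‖x - y‖ * (4 * R) := by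
      rw [e, abs_mul, abs_of_nonneg (a := ‖x - P x‖ + ‖y - P y‖) (by positivity)]
      refine mul_le_mul ((abs_norm_sub_norm_le _ _).trans (resid_lip C P hP x y)) ?_
        (by positivity) (by positivity)
      linarith [hQ x hx, hQ y hy]
    calc _ ≤ |M| * (‖x - y‖ * (4 * R)) := mul_le_mul_of_nonneg_left e1 (abs_nonneg M)
      _ = |M| * (4 * R) * ‖x - y‖ := by ring
      _ ≤ _ := mul_le_mul_of_nonneg_right h2 (norm_nonneg _)
  · intro x hx y hy
    rw [(sq_contDiff C P hP M).2, (sq_contDiff C P hP M).2, ← smul_sub, ← smul_sub, ← map_sub,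
      norm_smul, norm_smul, innerSL_apply_norm, Real.norm_eq_abs, Real.norm_eq_abs, abs_two,
      ← mul_assoc]
    exact mul_le_mul h3 (resid_lip C P hP x y) (norm_nonneg _) (by
      refine le_trans ?_ h3; positivity)

lemma exists_unit (d : ℕ) (hd : 0 < d) (v : EuclideanSpace ℝ (Fin d)) :
    ∃ θ : EuclideanSpace ℝ (Fin d), ‖θ‖ = 1 ∧ v = ‖v‖ • θ := by
  by_cases hv : v = 0
  · refine ⟨EuclideanSpace.single ⟨0, hd⟩ 1, by simp, by simp [hv]⟩
  · have : ‖v‖ ≠ 0 := norm_ne_zero_iff.2 hv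
    refine ⟨‖v‖⁻¹ • v, ?_, ?_⟩
    · rw [norm_smul, norm_inv, norm_norm, inv_mul_cancel₀ this]
    · rw [smul_smul, mul_inv_cancel₀ this, one_smul]

lemma int_norm_sq (d : ℕ) (K : Set (EuclideanSpace ℝ (Fin d))) (hK : IsCompact K) (L : ℝ)
    (hKiso : ∀ θ : EuclideanSpace ℝ (Fin d), ‖θ‖ = 1 → ∫ x in K, ⟪x, θ⟫ ^ 2 = L ^ 2) :
    ∫ x in K, ‖x‖ ^ 2 = d * L ^ 2 := by
  have h : ∀ x : EuclideanSpace ℝ (Fin d),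
      ‖x‖ ^ 2 = ∑ i, ⟪x, EuclideanSpace.single i (1 : ℝ)⟫ ^ 2 := by
    intro x
    rw [EuclideanSpace.norm_sq_eq]
    simp [EuclideanSpace.inner_single_right]
  simp_rw [h]
  rw [integral_finset_sum]
  · rw [Finset.sum_congr rfl (fun i _ => hKiso (EuclideanSpace.single i 1) (by simp))]
    simp
  · intro i _
    exact (by fun_prop : Continuous fun x : EuclideanSpace ℝ (Fin d) =>
      ⟪x, EuclideanSpace.single i (1 : ℝ)⟫ ^ 2).continuousOn.integrableOn_compact hK

lemma int_lower (d n : ℕ) (hd : 0 < d) (α b L r T : ℝ) (hα : 0 < α) (hb : 0 < b) (hL : 0 < L)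
    (hr : 0 < r) (hrd : r ^ 2 = d * L ^ 2)
    (hT : T = (r / 8 / (b * L)) ^ α)
    (K : Set (EuclideanSpace ℝ (Fin d))) (hK : IsCompact K) (hvol : volume K = 1)
    (hKiso : ∀ θ : EuclideanSpace ℝ (Fin d), ‖θ‖ = 1 → ∫ x in K, ⟪x, θ⟫ ^ 2 = L ^ 2)
    (hKpsi : ∀ θ : EuclideanSpace ℝ (Fin d), ‖θ‖ = 1 →
      ∫ x in K, Real.exp ((|⟪x, θ⟫| / (b * L)) ^ α) ≤ 2)
    (hR : ∀ x ∈ K, ‖x‖ ≤ 2 * r)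
    (pts : Fin n → EuclideanSpace ℝ (Fin d)) (hpts : ∀ i, pts i ∈ K)
    (P : EuclideanSpace ℝ (Fin d) → EuclideanSpace ℝ (Fin d))
    (hP : ∀ x, P x ∈ convexHull ℝ (Set.range pts) ∧
      (∀ z ∈ convexHull ℝ (Set.range pts), ⟪x - P x, z - P x⟫ ≤ 0))
    (hn : (n : ℝ) ≤ 1 / 32 * Real.exp T) :
    r ^ 2 / 1024 ≤ ∫ x in K, ‖x - P x‖ ^ 2 := by
  choose θ hθ1 hθ2 using fun i => exists_unit d hd (pts i)
  have hpt : ∀ x ∈ K, ‖x‖ ^ 2 ≤ r ^ 2 / 2 + (256 * ‖x - P x‖ ^ 2 +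
      ∑ i, 4 * r ^ 2 * Real.exp (-T) * Real.exp ((|⟪x, θ i⟫| / (b * L)) ^ α)) := by
    intro x hx
    have hs : 0 ≤ ∑ i, 4 * r ^ 2 * Real.exp (-T) * Real.exp ((|⟪x, θ i⟫| / (b * L)) ^ α) :=
      Finset.sum_nonneg (fun i _ => by positivity)
    by_cases h1 : ‖x‖ ^ 2 ≤ r ^ 2 / 2
    · nlinarith [sq_nonneg ‖x - P x‖]
    push Not at h1
    have hx2 : ‖x‖ ^ 2 ≤ 4 * r ^ 2 := by nlinarith [hR x hx, norm_nonneg x]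
    by_cases h2 : r / 8 ≤ ‖x - P x‖
    · have : r ^ 2 / 64 ≤ ‖x - P x‖ ^ 2 := by nlinarith
      nlinarith
    push Not at h2
    have h3 : r ^ 2 / 4 < ⟪x, P x⟫ := by
      have e : ⟪x, P x⟫ = ‖x‖ ^ 2 - ⟪x, x - P x⟫ := by
        rw [inner_sub_right, real_inner_self_eq_norm_sq]; ring
      have := real_inner_le_norm x (x - P x)
      have h4 : ‖x‖ * ‖x - P x‖ ≤ (2 * r) * (r / 8) :=
        mul_le_mul (hR x hx) h2.le (norm_nonneg _) (by positivity)
      nlinarith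
    have h5 : ∃ i, r ^ 2 / 4 < ⟪x, pts i⟫ := by
      by_contra hcon
      push Not at hcon
      have hsub : convexHull ℝ (Set.range pts) ⊆ {w | innerSL ℝ x w ≤ r ^ 2 / 4} := by
        apply convexHull_min
        · rintro _ ⟨i, rfl⟩
          exact hcon i
        · exact convex_halfSpace_le (innerSL ℝ x).isLinear _
      have := hsub (hP x).1
      simp only [Set.mem_setOf_eq, innerSL_apply_apply] at this
      linarith
    obtain ⟨i, hi⟩ := h5
    rw [hθ2 i, inner_smul_right] at hi
    have h6 : r / 8 ≤ |⟪x, θ i⟫| := by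
      have h7 : ‖pts i‖ * ⟪x, θ i⟫ ≤ (2 * r) * |⟪x, θ i⟫| :=
        (mul_le_mul_of_nonneg_left (le_abs_self _) (norm_nonneg _)).trans
          (mul_le_mul_of_nonneg_right (hR _ (hpts i)) (abs_nonneg _))
      by_contra hh
      push Not at hh
      nlinarith
    have h8 : T ≤ (|⟪x, θ i⟫| / (b * L)) ^ α := by
      rw [hT]
      apply Real.rpow_le_rpow (by positivity) _ hα.le
      gcongr
    have h9 : 4 * r ^ 2 ≤ 4 * r ^ 2 * Real.exp (-T) * Real.exp ((|⟪x, θ i⟫| / (b * L)) ^ α) := by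
      rw [mul_assoc, ← Real.exp_add]
      have : 1 ≤ Real.exp (-T + (|⟪x, θ i⟫| / (b * L)) ^ α) := Real.one_le_exp (by linarith)
      nlinarith [sq_nonneg r]
    have h10 := Finset.single_le_sum (s := Finset.univ)
      (f := fun i => 4 * r ^ 2 * Real.exp (-T) * Real.exp ((|⟪x, θ i⟫| / (b * L)) ^ α))
      (fun i _ => by positivity) (Finset.mem_univ i)
    nlinarith [sq_nonneg ‖x - P x‖, sq_nonneg r]
  have hcont : Continuous (fun x => ‖x - P x‖ ^ 2) := by
    have := (sq_contDiff _ P hP 1).1.continuous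
    simpa using this
  have hce : ∀ i, Continuous fun x : EuclideanSpace ℝ (Fin d) =>
      4 * r ^ 2 * Real.exp (-T) * Real.exp ((|⟪x, θ i⟫| / (b * L)) ^ α) := by
    intro i
    refine continuous_const.mul (Real.continuous_exp.comp ?_)
    exact Continuous.rpow_const (by fun_prop) (fun _ => Or.inr hα.le)
  have i1 : IntegrableOn (fun x : EuclideanSpace ℝ (Fin d) => ‖x‖ ^ 2) K :=
    (by fun_prop : Continuous fun x : EuclideanSpace ℝ (Fin d) =>
      ‖x‖ ^ 2).continuousOn.integrableOn_compact hK
  have i2 : IntegrableOn (fun x : EuclideanSpace ℝ (Fin d) => 256 * ‖x - P x‖ ^ 2) K :=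
    (continuous_const.mul hcont).continuousOn.integrableOn_compact hK
  have i3 : ∀ i, IntegrableOn (fun x : EuclideanSpace ℝ (Fin d) =>
      4 * r ^ 2 * Real.exp (-T) * Real.exp ((|⟪x, θ i⟫| / (b * L)) ^ α)) K :=
    fun i => (hce i).continuousOn.integrableOn_compact hK
  have i4 : IntegrableOn (fun _ : EuclideanSpace ℝ (Fin d) => r ^ 2 / 2) K :=
    continuous_const.continuousOn.integrableOn_compact hK
  have i5 : IntegrableOn (fun x : EuclideanSpace ℝ (Fin d) =>
      ∑ i, 4 * r ^ 2 * Real.exp (-T) * Real.exp ((|⟪x, θ i⟫| / (b * L)) ^ α)) K :=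
    integrable_finset_sum _ (fun i _ => i3 i)
  have hint := setIntegral_mono_on i1 (i4.add (i2.add i5)) hK.measurableSet hpt
  rw [int_norm_sq d K hK L hKiso, integral_add' i4 (i2.add i5), integral_add' i2 i5,
    integral_finset_sum _ (fun i _ => i3 i), ← hrd, setIntegral_const, integral_const_mul] at hint
  have hsum : ∑ i, ∫ x in K, 4 * r ^ 2 * Real.exp (-T) * Real.exp ((|⟪x, θ i⟫| / (b * L)) ^ α)
      ≤ r ^ 2 / 4 := by
    calc _ ≤ ∑ i : Fin n, 4 * r ^ 2 * Real.exp (-T) * 2 := by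
          apply Finset.sum_le_sum
          intro i _
          rw [integral_const_mul]
          exact mul_le_mul_of_nonneg_left (hKpsi _ (hθ1 i)) (by positivity)
      _ = n * (8 * r ^ 2 * Real.exp (-T)) := by
          rw [Finset.sum_const, Finset.card_univ, Fintype.card_fin, nsmul_eq_mul]; ring
      _ ≤ (1 / 32 * Real.exp T) * (8 * r ^ 2 * Real.exp (-T)) :=
          mul_le_mul_of_nonneg_right hn (by positivity)
      _ = r ^ 2 / 4 * (Real.exp T * Real.exp (-T)) := by ring
      _ = r ^ 2 / 4 := by rw [← Real.exp_add]; simp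
  simp only [Measure.real, hvol, ENNReal.toReal_one, one_smul] at hint
  linarith

theorem stmt10 (α : ℝ) (hα : α ∈ Set.Icc (1 : ℝ) 2) (b : ℝ) (hb : 0 < b)
    (K : (d : ℕ) → Set (EuclideanSpace ℝ (Fin d))) (L : ℕ → ℝ)
    -- each `K d` is a symmetric convex body ...
    (hKcompact : ∀ d, IsCompact (K d)) (hKconv : ∀ d, Convex ℝ (K d))
    (hKint : ∀ d, (interior (K d)).Nonempty)
    (hKsymm : ∀ d, ∀ x ∈ K d, -x ∈ K d)
    -- ... which is isotropic with isotropic constant `L d` ...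
    (hKvol : ∀ d, volume (K d) = 1)
    (hKbary : ∀ d, ∫ x in K d, x = 0)
    (hL : ∀ d, 0 < L d)
    (hKiso : ∀ d, ∀ θ : EuclideanSpace ℝ (Fin d), ‖θ‖ = 1 →
      ∫ x in K d, ⟪x, θ⟫ ^ 2 = (L d) ^ 2)
    -- ... and satisfies a ψ_α-estimate with constant `b`:
    (hKpsi : ∀ d, ∀ θ : EuclideanSpace ℝ (Fin d), ‖θ‖ = 1 →
      ∫ x in K d, Real.exp ((|⟪x, θ⟫| / (b * L d)) ^ α) ≤ 2)
    -- `limsup_{d→∞} rad(K_d)/(√d·L_{K_d}) < 2`: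
    (hrad : ∃ s < (2 : ℝ), ∀ᶠ d in atTop, symRad (K d) / (Real.sqrt d * L d) ≤ s)
    -- the Lipschitz parameters:
    (A B : ℕ → ℝ) (hA : ∀ d, 0 < A d) (hB : ∀ d, 0 < B d)
    (a b' : ℝ) (ha : 0 < a) (hb' : 0 < b')
    (hAlow : ∀ d : ℕ, a / (Real.sqrt d * L d) ≤ A d)
    (hBlow : ∀ d : ℕ, b' / (d * (L d) ^ 2) ≤ B d) :
    ∃ c > (0 : ℝ), ∃ γ > (0 : ℝ), ∃ ε₀ ∈ Set.Ioo (0 : ℝ) 1,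
      ∀ d : ℕ, ∀ n : ℕ, (n : ℝ) < c * (1 + γ) ^ ((d : ℝ) ^ (α / 2)) →
        ∀ pts : Fin n → EuclideanSpace ℝ (Fin d), (∀ i, pts i ∈ K d) →
          ∀ φ : (Fin n → ℝ) → ℝ,
            ∃ f : EuclideanSpace ℝ (Fin d) → ℝ, MemC1Class d (A d) (B d) (K d) f ∧
              ε₀ ≤ |(∫ x in K d, f x) - φ (fun i => f (pts i))| := by
  obtain ⟨s, hs2, hs⟩ := hrad
  obtain ⟨D, hD⟩ := eventually_atTop.1 hs
  have hα0 : 0 < α := by linarith [hα.1]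
  set m : ℝ := min (1 / 16) (min (a / 8) (b' / 2)) with hm
  have hm0 : 0 < m := by rw [hm]; positivity
  have hm1 : m ≤ 1 / 16 := min_le_left _ _
  have hm2 : m ≤ a / 8 := (min_le_right _ _).trans (min_le_left _ _)
  have hm3 : m ≤ b' / 2 := (min_le_right _ _).trans (min_le_right _ _)
  set τ : ℝ := (1 / (8 * b)) ^ α with hτ
  have hτ0 : 0 < τ := by rw [hτ]; positivity
  refine ⟨min (1 / 32) (Real.exp (-(τ * ((D + 1 : ℕ) : ℝ) ^ (α / 2)))),
    lt_min (by norm_num) (Real.exp_pos _), Real.exp τ - 1, by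
      linarith [Real.add_one_lt_exp hτ0.ne'], m / 1024, ⟨by positivity, by linarith⟩, ?_⟩
  intro d n hn pts hpts φ
  rw [add_sub_cancel, ← Real.exp_mul] at hn
  -- it suffices to find `f` with `f` and `-f` in the class, equal on the points
  rcases Nat.eq_zero_or_pos n with rfl | hn0
  · have key : ∀ t : ℝ, |t| ≤ 1 → MemC1Class d (A d) (B d) (K d) (fun _ => t) := by
      intro t ht
      refine ⟨contDiff_const, fun x _ => ht, fun x _ y _ => ?_, fun x _ y _ => ?_⟩
      · simpa using mul_nonneg (hA d).le (norm_nonneg (x - y))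
      · simpa using mul_nonneg (hB d).le (norm_nonneg (x - y))
    have hI : ∀ t : ℝ, ∫ _ in K d, t = t := by
      intro t
      simp [setIntegral_const, Measure.real, hKvol]
    have e : ∀ g h : Fin 0 → ℝ, φ g = φ h := fun g h => congrArg φ (Subsingleton.elim _ _)
    by_cases h : φ (fun _ => 0) ≤ 0
    · refine ⟨fun _ => 1, key 1 (by simp), ?_⟩
      rw [hI, e _ (fun _ => 0)]
      exact le_trans (by linarith) (le_abs_self _)
    · refine ⟨fun _ => -1, key (-1) (by simp), ?_⟩
      rw [hI, e _ (fun _ => 0)]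
      exact le_trans (by linarith) (neg_le_abs _)
  have hn1 : (1 : ℝ) ≤ n := by exact_mod_cast hn0
  have hdD : D + 1 ≤ d := by
    by_contra hlt
    push Not at hlt
    have h1 : (d : ℝ) ^ (α / 2) ≤ ((D + 1 : ℕ) : ℝ) ^ (α / 2) :=
      Real.rpow_le_rpow (by positivity) (by exact_mod_cast hlt.le) (by positivity)
    have h2 : (n : ℝ) < Real.exp (-(τ * ((D + 1 : ℕ) : ℝ) ^ (α / 2))) *
        Real.exp (τ * (d : ℝ) ^ (α / 2)) :=
      hn.trans_le (mul_le_mul_of_nonneg_right (min_le_right _ _) (Real.exp_pos _).le)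
    rw [← Real.exp_add] at h2
    have h3 := mul_le_mul_of_nonneg_left h1 hτ0.le
    have h4 := Real.exp_le_one_iff.2 (by linarith :
      -(τ * ((D + 1 : ℕ) : ℝ) ^ (α / 2)) + τ * (d : ℝ) ^ (α / 2) ≤ 0)
    linarith
  have hd : 0 < d := by omega
  have hd' : (0 : ℝ) < d := by exact_mod_cast hd
  have hLd := hL d
  set r : ℝ := Real.sqrt d * L d with hr
  have hr0 : 0 < r := by positivity
  have hr2 : r ^ 2 = d * (L d) ^ 2 := by rw [hr, mul_pow, Real.sq_sqrt hd'.le]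
  have hR : ∀ x ∈ K d, ‖x‖ ≤ 2 * r := by
    intro x hx
    have h1 : ‖x‖ ≤ symRad (K d) :=
      le_csSup ((hKcompact d).image continuous_norm).bddAbove ⟨x, hx, rfl⟩
    have h2 := hD d (by omega)
    rw [div_le_iff₀ hr0] at h2
    nlinarith
  have hT : τ * (d : ℝ) ^ (α / 2) = (r / 8 / (b * L d)) ^ α := by
    have e1 : r / 8 / (b * L d) = (1 / (8 * b)) * Real.sqrt d := by
      rw [hr]; field_simp
    rw [e1, Real.mul_rpow (by positivity) (by positivity), Real.sqrt_eq_rpow, ← Real.rpow_mul hd'.le]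
    congr 2; ring
  have hCK : convexHull ℝ (Set.range pts) ⊆ K d :=
    convexHull_min (by rintro _ ⟨i, rfl⟩; exact hpts i) (hKconv d)
  obtain ⟨P, hP⟩ := exists_proj (convexHull ℝ (Set.range pts))
    ⟨pts ⟨0, hn0⟩, subset_convexHull _ _ ⟨_, rfl⟩⟩ ((Set.finite_range pts).isCompact_convexHull ℝ)
    (convex_convexHull _ _)
  have hlow := int_lower d n hd α b (L d) r _ hα0 hb hLd hr0 hr2 hT (K d) (hKcompact d) (hKvol d)
    (hKiso d) (hKpsi d) hR pts hpts P hP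
    (hn.le.trans (mul_le_mul_of_nonneg_right (min_le_left _ _) (Real.exp_pos _).le))
  have hmem : ∀ M : ℝ, |M| = m / r ^ 2 →
      MemC1Class d (A d) (B d) (K d) (fun x => M * ‖x - P x‖ ^ 2) := by
    intro M hM
    refine sq_memClass d (A d) (B d) (2 * r) M (K d) _ P hP hCK hR ?_ ?_ ?_
    · rw [hM]
      have : m / r ^ 2 * (4 * (2 * r) ^ 2) = 16 * m := by field_simp; ring
      rw [this]; linarith
    · rw [hM]
      refine le_trans ?_ (hAlow d)
      have : m / r ^ 2 * (4 * (2 * r)) = (8 * m) / r := by field_simp; ring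
      rw [this, ← hr]
      exact div_le_div_of_nonneg_right (by linarith) hr0.le
    · rw [hM]
      refine le_trans ?_ (hBlow d)
      rw [← hr2, div_mul_eq_mul_div]
      exact div_le_div_of_nonneg_right (by linarith) (by positivity)
  have hz : ∀ i, ‖pts i - P (pts i)‖ = 0 := by
    intro i
    have h1 := (hP (pts i)).2 (pts i) (subset_convexHull _ _ ⟨i, rfl⟩)
    rw [real_inner_self_eq_norm_sq] at h1
    nlinarith [norm_nonneg (pts i - P (pts i))]
  have hbig : m / 1024 ≤ m / r ^ 2 * ∫ x in K d, ‖x - P x‖ ^ 2 := by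
    have h1 := mul_le_mul_of_nonneg_left hlow (by positivity : 0 ≤ m / r ^ 2)
    have : m / r ^ 2 * (r ^ 2 / 1024) = m / 1024 := by field_simp
    linarith
  have hpos : 0 < m / r ^ 2 := by positivity
  by_cases h : φ (fun _ => 0) ≤ 0
  · refine ⟨_, hmem (m / r ^ 2) (abs_of_pos hpos), ?_⟩
    simp only [hz, integral_const_mul]
    norm_num
    exact le_trans (by linarith) (le_abs_self _)
  · refine ⟨_, hmem (-(m / r ^ 2)) (by rw [abs_neg, abs_of_pos hpos]), ?_⟩
    simp only [hz, integral_const_mul]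
    norm_num
    exact le_trans (by linarith) (neg_le_abs _)

end
end

section
/- Let b > 0 and let (K_d)_{d∈ℕ} be a sequence where K_d ⊆ ℝ^d is a symmetric isotropic convex body satisfying a ψ₂-estimate with constant b, and suppose limsup_{d→∞} rad(K_d)/(√d·L_{K_d}) < 2. Let (A_d), (B_d) be positive reals with limsup_{d→∞} min{A_d·√d·L_{K_d}, B_d·d·L_{K_d}²} > 0. Then the curse of dimensionality holds for the classes C¹_d(A_d,B_d,K_d): there exist constants c > 0, γ > 0 and ε₀ ∈ (0,1) such that for infinitely many d ∈ ℕ, for every n ∈ ℕ with n < c·(1+γ)^d, every choice of points x₁,…,x_n ∈ K_d and every map φ : ℝⁿ → ℝ, there exists f ∈ C¹_d(A_d,B_d,K_d) with |∫_{K_d} f(x) dx − φ(f(x₁),…,f(x_n))| ≥ ε₀. -/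
open MeasureTheory Filter
open scoped RealInnerProductSpace

noncomputable section

lemma proj_firm {E : Type*} [NormedAddCommGroup E] [InnerProductSpace ℝ E]
    (C : Set E) (P : E → E) (hP : ∀ x, P x ∈ C)
    (hPi : ∀ x, ∀ w ∈ C, inner ℝ (x - P x) (w - P x) ≤ 0) (x y : E) :
    ‖P x - P y‖ ^ 2 ≤ inner ℝ (x - y) (P x - P y) := by
  have h1 := hPi x (P y) (hP y)
  have h2 := hPi y (P x) (hP x)
  have e : inner ℝ (x - y) (P x - P y) - ‖P x - P y‖ ^ 2
      = - inner ℝ (x - P x) (P y - P x) - inner ℝ (y - P y) (P x - P y) := by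
    rw [← real_inner_self_eq_norm_sq]
    simp only [inner_sub_left, inner_sub_right]
    ring
  linarith

lemma proj_res {E : Type*} [NormedAddCommGroup E] [InnerProductSpace ℝ E]
    (C : Set E) (P : E → E) (hP : ∀ x, P x ∈ C)
    (hPi : ∀ x, ∀ w ∈ C, inner ℝ (x - P x) (w - P x) ≤ 0) (x y : E) :
    ‖(x - P x) - (y - P y)‖ ≤ ‖x - y‖ := by
  have h := proj_firm C P hP hPi x y
  have e : (x - P x) - (y - P y) = (x - y) - (P x - P y) := by abel
  rw [e]
  have h2 := norm_sub_sq_real (x - y) (P x - P y)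
  have h3 := sq_nonneg ‖P x - P y‖
  exact abs_le_of_sq_le_sq' (by linarith) (norm_nonneg _) |>.2

lemma proj_deriv {E : Type*} [NormedAddCommGroup E] [InnerProductSpace ℝ E]
    (C : Set E) (P : E → E) (hP : ∀ x, P x ∈ C)
    (hPi : ∀ x, ∀ w ∈ C, inner ℝ (x - P x) (w - P x) ≤ 0) (x : E) :
    HasFDerivAt (fun y => ‖y - P y‖ ^ 2) ((2 : ℝ) • innerSL ℝ (x - P x)) x := by
  have key : ∀ y, |‖y - P y‖ ^ 2 - ‖x - P x‖ ^ 2 - 2 * inner ℝ (x - P x) (y - x)|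
      ≤ ‖y - x‖ ^ 2 := by
    intro y
    have h1 := hPi x (P y) (hP y)
    have h2 := hPi y (P x) (hP x)
    have hf := proj_firm C P hP hPi y x
    have e : ‖y - P y‖ ^ 2 - ‖x - P x‖ ^ 2 - 2 * inner ℝ (x - P x) (y - x)
      = ‖(y - P y) - (x - P x)‖ ^ 2 - 2 * inner ℝ (x - P x) (P y - P x) := by
      simp only [← real_inner_self_eq_norm_sq]
      simp only [inner_sub_left, inner_sub_right, real_inner_comm]
      ring
    have e' : ‖y - P y‖ ^ 2 - ‖x - P x‖ ^ 2 - 2 * inner ℝ (x - P x) (y - x)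
      = ‖y - x‖ ^ 2 - ‖P y - P x‖ ^ 2 + 2 * inner ℝ (y - P y) (P x - P y) := by
      simp only [← real_inner_self_eq_norm_sq]
      simp only [inner_sub_left, inner_sub_right, real_inner_comm]
      ring
    rw [abs_le]
    constructor
    · rw [e]; nlinarith [sq_nonneg ‖(y - P y) - (x - P x)‖, sq_nonneg ‖y - x‖]
    · rw [e']; nlinarith [sq_nonneg ‖P y - P x‖]
  rw [hasFDerivAt_iff_isLittleO]
  have hO : (fun y => ‖y - P y‖ ^ 2 - ‖x - P x‖ ^ 2 -
      ((2 : ℝ) • innerSL ℝ (x - P x)) (y - x)) =O[nhds x] fun y => ‖y - x‖ ^ 2 := by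
    apply Asymptotics.IsBigO.of_bound 1
    filter_upwards with y
    have := key y
    rw [ContinuousLinearMap.smul_apply, innerSL_apply_apply, smul_eq_mul, Real.norm_eq_abs, one_mul,
      Real.norm_eq_abs, abs_of_nonneg (sq_nonneg ‖y - x‖)]
    exact this
  refine hO.trans_isLittleO ?_
  have := (Asymptotics.isLittleO_pow_sub_sub x (m := 2) (by norm_num))
  simpa using this

lemma proj_exists {E : Type*} [NormedAddCommGroup E] [InnerProductSpace ℝ E] [CompleteSpace E]
    (C : Set E) (hne : C.Nonempty) (hcl : IsClosed C) (hc : Convex ℝ C) :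
    ∃ P : E → E, (∀ x, P x ∈ C) ∧ ∀ x, ∀ w ∈ C, inner ℝ (x - P x) (w - P x) ≤ 0 := by
  have h : ∀ x, ∃ v ∈ C, ∀ w ∈ C, inner ℝ (x - v) (w - v) ≤ 0 := by
    intro x
    obtain ⟨v, hv, hv'⟩ := exists_norm_eq_iInf_of_complete_convex hne hcl.isComplete hc x
    exact ⟨v, hv, (norm_eq_iInf_iff_real_inner_le_zero hc hv).1 hv'⟩
  choose P h1 h2 using h
  exact ⟨P, h1, h2⟩

lemma proj_contDiff {E : Type*} [NormedAddCommGroup E] [InnerProductSpace ℝ E]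
    (C : Set E) (P : E → E) (hP : ∀ x, P x ∈ C)
    (hPi : ∀ x, ∀ w ∈ C, inner ℝ (x - P x) (w - P x) ≤ 0) :
    ContDiff ℝ 1 (fun y => ‖y - P y‖ ^ 2) := by
  rw [contDiff_one_iff_fderiv]
  refine ⟨fun x => (proj_deriv C P hP hPi x).differentiableAt, ?_⟩
  have e : fderiv ℝ (fun y => ‖y - P y‖ ^ 2) = fun x => (2 : ℝ) • innerSL ℝ (x - P x) := by
    funext x
    exact (proj_deriv C P hP hPi x).fderiv
  rw [e]
  have hc : Continuous (fun x => x - P x) := by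
    have : LipschitzWith 1 (fun x => x - P x) := by
      apply LipschitzWith.of_dist_le_mul
      intro x y
      simpa [dist_eq_norm] using proj_res C P hP hPi x y
    exact this.continuous
  exact ((innerSL ℝ).continuous.comp hc).const_smul (2 : ℝ)

lemma proj_memClass {d : ℕ} (A B R a : ℝ) (K : Set (EuclideanSpace ℝ (Fin d)))
    (C : Set (EuclideanSpace ℝ (Fin d)))
    (P : EuclideanSpace ℝ (Fin d) → EuclideanSpace ℝ (Fin d)) (hP : ∀ x, P x ∈ C)
    (hPi : ∀ x, ∀ w ∈ C, inner ℝ (x - P x) (w - P x) ≤ 0) (h0 : (0 : EuclideanSpace ℝ (Fin d)) ∈ C)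
    (hR : ∀ x ∈ K, ‖x‖ ≤ R) (a' : ℝ) (ha' : |a'| = a)
    (h1 : a * R ^ 2 ≤ 1) (h2 : a * (2 * R) ≤ A) (h3 : a * 2 ≤ B) :
    MemC1Class d A B K (fun x => a' * ‖x - P x‖ ^ 2) := by
  have ha : 0 ≤ a := ha' ▸ abs_nonneg a'
  have hu : ∀ x ∈ K, ‖x - P x‖ ≤ R := by
    intro x hx
    have h := hPi x 0 h0
    have : ‖x - P x‖ ^ 2 ≤ ‖x - P x‖ * ‖x‖ := by
      have e : ‖x - P x‖ ^ 2 = inner ℝ (x - P x) x + inner ℝ (x - P x) (0 - P x) := by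
        rw [← real_inner_self_eq_norm_sq, ← inner_add_right]
        congr 1
        abel
      have := real_inner_le_norm (x - P x) x
      linarith
    have h4 := norm_nonneg (x - P x)
    have h5 := hR x hx
    have h6 := norm_nonneg x
    by_contra hcon
    push Not at hcon
    nlinarith
  refine ⟨contDiff_const.mul (proj_contDiff C P hP hPi), ?_, ?_, ?_⟩
  · intro x hx
    rw [abs_mul, ha', abs_of_nonneg (sq_nonneg _)]
    have := hu x hx
    have : ‖x - P x‖ ^ 2 ≤ R ^ 2 := by gcongr
    nlinarith
  · intro x hx y hy
    have e : a' * ‖x - P x‖ ^ 2 - a' * ‖y - P y‖ ^ 2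
      = a' * ((‖x - P x‖ - ‖y - P y‖) * (‖x - P x‖ + ‖y - P y‖)) := by ring
    rw [e, abs_mul, ha', abs_mul, abs_of_nonneg (a := ‖x - P x‖ + ‖y - P y‖) (by positivity)]
    have g1 : |‖x - P x‖ - ‖y - P y‖| ≤ ‖x - y‖ :=
      (abs_norm_sub_norm_le _ _).trans (proj_res C P hP hPi x y)
    have g2 := hu x hx
    have g3 := hu y hy
    calc a * (|‖x - P x‖ - ‖y - P y‖| * (‖x - P x‖ + ‖y - P y‖))
        ≤ a * (‖x - y‖ * (2 * R)) := by
          gcongr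
          linarith
      _ = a * (2 * R) * ‖x - y‖ := by ring
      _ ≤ A * ‖x - y‖ := by gcongr
  · intro x hx y hy
    have hd : ∀ x, fderiv ℝ (fun x => a' * ‖x - P x‖ ^ 2) x
        = a' • ((2 : ℝ) • innerSL ℝ (x - P x)) := fun x =>
      ((proj_deriv C P hP hPi x).const_mul a').fderiv
    rw [hd, hd, ← smul_sub, ← smul_sub, ← map_sub, norm_smul, norm_smul, innerSL_apply_norm,
      Real.norm_eq_abs, ha']
    have := proj_res C P hP hPi x y
    calc a * (‖(2 : ℝ)‖ * ‖x - P x - (y - P y)‖) ≤ a * (‖(2 : ℝ)‖ * ‖x - y‖) := by gcongr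
      _ = a * 2 * ‖x - y‖ := by norm_num; ring
      _ ≤ B * ‖x - y‖ := by gcongr

lemma int_normsq {d : ℕ} (K : Set (EuclideanSpace ℝ (Fin d))) (hK : IsCompact K) (L : ℝ)
    (hKiso : ∀ θ : EuclideanSpace ℝ (Fin d), ‖θ‖ = 1 → ∫ x in K, inner ℝ x θ ^ 2 = L ^ 2) :
    ∫ x in K, ‖x‖ ^ 2 = d * L ^ 2 := by
  have e : ∀ x : EuclideanSpace ℝ (Fin d), ‖x‖ ^ 2
      = ∑ j, inner ℝ x (EuclideanSpace.basisFun (Fin d) ℝ j) ^ 2 := by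
    intro x
    rw [← OrthonormalBasis.sum_sq_inner_left (EuclideanSpace.basisFun (Fin d) ℝ) x]
  simp_rw [e]
  rw [integral_finsetSum]
  · rw [Finset.sum_congr rfl (fun j _ => hKiso _ (OrthonormalBasis.norm_eq_one _ j))]
    simp
  · intro j _
    exact ContinuousOn.integrableOn_compact hK (by fun_prop)

lemma pt_bound {d n : ℕ} (R T b L : ℝ) (hb : 0 < b) (hL : 0 < L) (hT : 0 < T) (hRT : R = 2 * T * L)
    (pts θ : Fin n → EuclideanSpace ℝ (Fin d)) (hθ : ∀ i, pts i = ‖pts i‖ • θ i)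
    (hpts : ∀ i, ‖pts i‖ ≤ R)
    (P : EuclideanSpace ℝ (Fin d) → EuclideanSpace ℝ (Fin d))
    (hP : ∀ x, P x ∈ convexHull ℝ (insert 0 (Set.range pts)))
    (x : EuclideanSpace ℝ (Fin d)) (hx : ‖x‖ ≤ R) :
    ‖x‖ ^ 2 ≤ 5 / 8 * (T * L) ^ 2 + 4 * (T * L) ^ 2 * (Real.exp (-(T / (16 * b)) ^ 2) *
      ∑ i, Real.exp ((inner ℝ x (θ i) / (b * L)) ^ 2)) + 2 * ‖x - P x‖ ^ 2 := by
  set q := Real.exp (-(T / (16 * b)) ^ 2) with hq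
  set S := ∑ i, Real.exp ((inner ℝ x (θ i) / (b * L)) ^ 2) with hS
  set M := 1 / 8 * (T * L) ^ 2 + 4 * (T * L) ^ 2 * (q * S) with hM
  have hS0 : 0 ≤ S := Finset.sum_nonneg (fun i _ => (Real.exp_pos _).le)
  have hq0 : 0 < q := Real.exp_pos _
  clear_value q S
  have hM1 : 0 ≤ 4 * (T * L) ^ 2 * (q * S) :=
    mul_nonneg (by positivity) (mul_nonneg hq0.le hS0)
  have hM0 : 0 ≤ M := add_nonneg (by positivity) hM1
  have hR0 : 0 < R := by rw [hRT]; positivity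
  have hi : ∀ i, inner ℝ x (pts i) ≤ M := by
    intro i
    rcases le_or_gt (inner ℝ x (pts i)) (1 / 8 * (T * L) ^ 2) with h | h
    · linarith
    · have h1 : inner ℝ x (pts i) ≤ 4 * (T * L) ^ 2 := by
        calc inner ℝ x (pts i) ≤ ‖x‖ * ‖pts i‖ := real_inner_le_norm _ _
          _ ≤ R * R := by gcongr; exact hpts i
          _ = 4 * (T * L) ^ 2 := by rw [hRT]; ring
      have h2 : inner ℝ x (pts i) = ‖pts i‖ * inner ℝ x (θ i) := by
        conv_lhs => rw [hθ i]
        rw [real_inner_smul_right]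
      have hpos : 0 < inner ℝ x (θ i) := by
        have : 0 < ‖pts i‖ * inner ℝ x (θ i) := by rw [← h2]; nlinarith [sq_nonneg (T * L)]
        exact pos_of_mul_pos_right this (norm_nonneg _)
      have h3 : T * L / 16 ≤ inner ℝ x (θ i) := by
        have : 1 / 8 * (T * L) ^ 2 ≤ R * inner ℝ x (θ i) := by
          have := mul_le_mul_of_nonneg_right (hpts i) hpos.le
          linarith
        rw [hRT] at this
        have hTL : 0 < T * L := by positivity
        have h' : (T * L) * (T * L / 16) ≤ (T * L) * inner ℝ x (θ i) := by nlinarith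
        exact le_of_mul_le_mul_left h' hTL
      have h4 : T / (16 * b) ≤ inner ℝ x (θ i) / (b * L) := by
        rw [div_le_div_iff₀ (by positivity) (by positivity)]
        nlinarith
      have h5 : (T / (16 * b)) ^ 2 ≤ (inner ℝ x (θ i) / (b * L)) ^ 2 := by
        have : 0 ≤ T / (16 * b) := by positivity
        gcongr
      have h6 : 1 ≤ q * S := by
        calc (1 : ℝ) ≤ q * Real.exp ((inner ℝ x (θ i) / (b * L)) ^ 2) := by
              rw [hq, ← Real.exp_add]
              apply Real.one_le_exp
              linarith
          _ ≤ q * S := by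
              gcongr
              rw [hS]
              exact Finset.single_le_sum (f := fun i => Real.exp ((inner ℝ x (θ i) / (b * L)) ^ 2))
                (fun i _ => (Real.exp_pos _).le) (Finset.mem_univ i)
      have : 4 * (T * L) ^ 2 * 1 ≤ 4 * (T * L) ^ 2 * (q * S) := by gcongr
      nlinarith [sq_nonneg (T * L)]
  have hconv : Convex ℝ {w : EuclideanSpace ℝ (Fin d) | inner ℝ x w ≤ M} :=
    convex_halfSpace_le (innerSL ℝ x).toLinearMap.isLinear M
  have hsub : convexHull ℝ (insert 0 (Set.range pts)) ⊆ {w | inner ℝ x w ≤ M} := by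
    apply convexHull_min _ hconv
    rintro w (rfl | ⟨i, rfl⟩)
    · simpa using hM0
    · exact hi i
  have hp : inner ℝ x (P x) ≤ M := hsub (hP x)
  have e : ‖x‖ ^ 2 = inner ℝ x (P x) + inner ℝ x (x - P x) := by
    rw [← real_inner_self_eq_norm_sq, ← inner_add_right]
    congr 1
    abel
  have h7 : inner ℝ x (x - P x) ≤ R * ‖x - P x‖ :=
    (real_inner_le_norm _ _).trans (by gcongr)
  rw [hRT] at h7
  have h8 := sq_nonneg (T * L - 2 * ‖x - P x‖)
  nlinarith

theorem stmt11 (b : ℝ) (hb : 0 < b)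
    (K : (d : ℕ) → Set (EuclideanSpace ℝ (Fin d))) (L : ℕ → ℝ)
    -- each `K d` is a symmetric convex body ...
    (hKcompact : ∀ d, IsCompact (K d)) (hKconv : ∀ d, Convex ℝ (K d))
    (hKint : ∀ d, (interior (K d)).Nonempty)
    (hKsymm : ∀ d, ∀ x ∈ K d, -x ∈ K d)
    -- ... which is isotropic with isotropic constant `L d` ...
    (hKvol : ∀ d, volume (K d) = 1)
    (hKbary : ∀ d, ∫ x in K d, x = 0)
    (hL : ∀ d, 0 < L d)
    (hKiso : ∀ d, ∀ θ : EuclideanSpace ℝ (Fin d), ‖θ‖ = 1 →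
      ∫ x in K d, ⟪x, θ⟫ ^ 2 = (L d) ^ 2)
    -- ... and satisfies a ψ₂-estimate with constant `b`:
    (hKpsi : ∀ d, ∀ θ : EuclideanSpace ℝ (Fin d), ‖θ‖ = 1 →
      ∫ x in K d, Real.exp ((⟪x, θ⟫ / (b * L d)) ^ 2) ≤ 2)
    -- `limsup_{d→∞} rad(K_d)/(√d·L_{K_d}) < 2`:
    (hrad : ∃ s < (2 : ℝ), ∀ᶠ d in atTop, symRad (K d) / (Real.sqrt d * L d) ≤ s)
    -- the Lipschitz parameters, with `limsup_{d→∞} min{A_d √d L_d, B_d d L_d²} > 0`: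
    (A B : ℕ → ℝ) (hA : ∀ d, 0 < A d) (hB : ∀ d, 0 < B d)
    (hlimsup : ∃ ρ > (0 : ℝ), ∃ᶠ d : ℕ in atTop,
      ρ ≤ min (A d * Real.sqrt d * L d) (B d * d * (L d) ^ 2)) :
    ∃ c > (0 : ℝ), ∃ γ > (0 : ℝ), ∃ ε₀ ∈ Set.Ioo (0 : ℝ) 1,
      ∃ᶠ d : ℕ in atTop,
        ∀ n : ℕ, (n : ℝ) < c * (1 + γ) ^ d →
          ∀ pts : Fin n → EuclideanSpace ℝ (Fin d), (∀ i, pts i ∈ K d) →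
            ∀ φ : (Fin n → ℝ) → ℝ,
              ∃ f : EuclideanSpace ℝ (Fin d) → ℝ, MemC1Class d (A d) (B d) (K d) f ∧
                ε₀ ≤ |(∫ x in K d, f x) - φ (fun i => f (pts i))| := by
  obtain ⟨s, hs, hrad⟩ := hrad
  obtain ⟨ρ, hρ, hlim⟩ := hlimsup
  set κ : ℝ := min (1 / 4) (ρ / 4) with hκ
  have hκ0 : 0 < κ := lt_min (by norm_num) (by positivity)
  have hκ1 : κ ≤ 1 / 4 := min_le_left _ _
  have hκ2 : κ ≤ ρ / 4 := min_le_right _ _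
  refine ⟨1 / 64, by norm_num, Real.exp (1 / (256 * b ^ 2)) - 1, ?_, κ / 8,
    ⟨by positivity, by linarith⟩, ?_⟩
  · have : (0 : ℝ) < 1 / (256 * b ^ 2) := by positivity
    linarith [Real.one_lt_exp_iff.2 this]
  refine (hlim.and_eventually (hrad.and (eventually_ge_atTop 1))).mono ?_
  rintro d ⟨hρd, hsd, hd1⟩ n hn pts hpts φ
  have hLd := hL d
  set T : ℝ := Real.sqrt d with hT
  have hdpos : (0 : ℝ) < d := by exact_mod_cast hd1
  have hT0 : 0 < T := Real.sqrt_pos.2 hdpos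
  have hT2 : T ^ 2 = d := Real.sq_sqrt hdpos.le
  have hTL : 0 < T * L d := by positivity
  set R : ℝ := 2 * T * L d with hRdef
  have hR : ∀ x ∈ K d, ‖x‖ ≤ R := by
    intro x hx
    have h1 : ‖x‖ ≤ symRad (K d) :=
      le_csSup ((hKcompact d).image continuous_norm).bddAbove ⟨x, hx, rfl⟩
    have h2 : symRad (K d) ≤ s * (T * L d) := (div_le_iff₀ hTL).1 hsd
    have : s * (T * L d) ≤ 2 * (T * L d) := by gcongr
    rw [hRdef]; linarith
  have hK0 : (0 : EuclideanSpace ℝ (Fin d)) ∈ K d := by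
    obtain ⟨x, hx⟩ := hKint d
    have hx := interior_subset hx
    have := (hKconv d) hx (hKsymm d x hx) (a := 1 / 2) (b := 1 / 2) (by norm_num) (by norm_num)
      (by norm_num)
    simpa using this
  set C := convexHull ℝ (insert 0 (Set.range pts)) with hC
  have hsub : insert 0 (Set.range pts) ⊆ C := subset_convexHull ℝ _
  have hC0 : (0 : EuclideanSpace ℝ (Fin d)) ∈ C := hsub (Set.mem_insert _ _)
  have hCcl : IsClosed C := by
    have hfin : (insert 0 (Set.range pts)).Finite := (Set.finite_range pts).insert 0
    exact (hfin.isCompact_convexHull (𝕜 := ℝ)).isClosed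
  obtain ⟨P, hP, hPi⟩ := proj_exists C ⟨0, hC0⟩ hCcl (convex_convexHull ℝ _)
  set a : ℝ := κ / (T * L d) ^ 2 with ha
  have ha0 : 0 < a := by positivity
  have hm1 : ρ ≤ A d * T * L d := hρd.trans (min_le_left _ _)
  have hm2 : ρ ≤ B d * (T * L d) ^ 2 := by
    have := hρd.trans (min_le_right _ _)
    rw [mul_pow, hT2]; linarith
  have h1 : a * R ^ 2 ≤ 1 := by
    have : a * R ^ 2 = 4 * κ := by rw [ha, hRdef]; field_simp; ring
    linarith
  have h2 : a * (2 * R) ≤ A d := by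
    have : a * (2 * R) = 4 * κ / (T * L d) := by rw [ha, hRdef]; field_simp; ring
    rw [this, div_le_iff₀ hTL]
    linarith
  have h3 : a * 2 ≤ B d := by
    have : a * 2 = 2 * κ / (T * L d) ^ 2 := by rw [ha]; ring
    rw [this, div_le_iff₀ (by positivity)]
    linarith
  have hmem := proj_memClass (A d) (B d) R a (K d) C P hP hPi hC0 hR
  have hzero : ∀ i, ‖pts i - P (pts i)‖ ^ 2 = 0 := by
    intro i
    have h := hPi (pts i) (pts i) (hsub (Set.mem_insert_of_mem _ ⟨i, rfl⟩))
    rw [real_inner_self_eq_norm_sq] at h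
    exact le_antisymm h (sq_nonneg _)
  -- unit directions
  have hθex : ∀ i, ∃ θ : EuclideanSpace ℝ (Fin d), ‖θ‖ = 1 ∧ pts i = ‖pts i‖ • θ := by
    intro i
    by_cases h : pts i = 0
    · exact ⟨EuclideanSpace.single ⟨0, hd1⟩ 1, by simp, by simp [h]⟩
    · have h' : ‖pts i‖ ≠ 0 := norm_ne_zero_iff.2 h
      refine ⟨‖pts i‖⁻¹ • pts i, ?_, ?_⟩
      · rw [norm_smul, norm_inv, norm_norm, inv_mul_cancel₀ h']
      · rw [smul_smul, mul_inv_cancel₀ h', one_smul]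
  choose θ hθ1 hθ using hθex
  have hpt := pt_bound R T b (L d) hb hLd hT0 hRdef pts θ hθ (fun i => hR _ (hpts i)) P hP
  have hcont := (proj_contDiff C P hP hPi).continuous
  have hint : ∀ g : EuclideanSpace ℝ (Fin d) → ℝ, Continuous g → IntegrableOn g (K d) :=
    fun g hg => hg.continuousOn.integrableOn_compact (hKcompact d)
  set q := Real.exp (-(T / (16 * b)) ^ 2) with hq
  have hmono := setIntegral_mono_on (μ := volume) (s := K d) (hint (fun x => ‖x‖ ^ 2) (by fun_prop))
    (hint (fun x => 5 / 8 * (T * L d) ^ 2 + 4 * (T * L d) ^ 2 * (q *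
      ∑ i, Real.exp ((inner ℝ x (θ i) / (b * L d)) ^ 2)) + 2 * ‖x - P x‖ ^ 2)
      (by fun_prop)) (hKcompact d).measurableSet (fun x hx => hpt x (hR x hx))
  have hvol : (volume : Measure (EuclideanSpace ℝ (Fin d))).real (K d) = 1 := by
    simp [Measure.real, hKvol d]
  rw [int_normsq (K d) (hKcompact d) (L d) (hKiso d),
    integral_add (hint _ (by fun_prop)) (hint _ (by fun_prop)),
    integral_add (hint _ (by fun_prop)) (hint _ (by fun_prop)),
    integral_const_mul, integral_const_mul, integral_const_mul, integral_const_mul,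
    integral_finsetSum _ (fun i _ => hint _ (by fun_prop)), setIntegral_const, hvol,
    one_smul] at hmono
  have hsum : ∑ i, ∫ x in K d, Real.exp ((inner ℝ x (θ i) / (b * L d)) ^ 2) ≤ n * 2 := by
    calc _ ≤ ∑ i : Fin n, (2 : ℝ) := Finset.sum_le_sum (fun i _ => hKpsi d (θ i) (hθ1 i))
      _ = n * 2 := by simp
  have hq' : q * Real.exp (1 / (256 * b ^ 2)) ^ d = 1 := by
    rw [hq, ← Real.exp_nat_mul, ← Real.exp_add, ← hT2, Real.exp_eq_one_iff]
    field_simp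
    ring
  have hqn : q * (n * 2) ≤ 1 / 32 := by
    have hq0 : 0 < q := Real.exp_pos _
    have e : (1 : ℝ) + (Real.exp (1 / (256 * b ^ 2)) - 1) = Real.exp (1 / (256 * b ^ 2)) := by ring
    rw [e] at hn
    have := mul_le_mul_of_nonneg_left hn.le hq0.le
    nlinarith
  set I := ∫ x in K d, ‖x - P x‖ ^ 2 with hI
  have hIb : (T * L d) ^ 2 / 8 ≤ I := by
    have hq0 : 0 < q := Real.exp_pos _
    have g1 := (mul_le_mul_of_nonneg_left hsum hq0.le).trans hqn
    have g2 : 4 * (T * L d) ^ 2 * (q *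
        ∑ i, ∫ x in K d, Real.exp ((inner ℝ x (θ i) / (b * L d)) ^ 2))
        ≤ 4 * (T * L d) ^ 2 * (1 / 32) := by gcongr
    have g3 : (d : ℝ) * L d ^ 2 = (T * L d) ^ 2 := by rw [mul_pow, hT2]
    rw [g3] at hmono
    linarith
  have haI : κ / 8 ≤ a * I := by
    calc κ / 8 = a * ((T * L d) ^ 2 / 8) := by rw [ha]; field_simp
      _ ≤ a * I := by gcongr
  have hfin : ∀ a' : ℝ, (∫ x in K d, a' * ‖x - P x‖ ^ 2) = a' * I := fun a' =>
    integral_const_mul _ _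
  rcases le_total (φ (fun _ => 0)) 0 with h | h
  · refine ⟨_, hmem a (abs_of_pos ha0) h1 h2 h3, ?_⟩
    rw [hfin]
    simp only [hzero, mul_zero]
    exact le_trans (by linarith) (le_abs_self _)
  · refine ⟨_, hmem (-a) (by rw [abs_neg, abs_of_pos ha0]) h1 h2 h3, ?_⟩
    rw [hfin]
    simp only [hzero, mul_zero]
    exact le_trans (by linarith) (neg_le_abs _)

end
end
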